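/- There exist constants C, c > 0 depending only on Ω such that for all ε ∈ (0, 1/2]: sup_{θ⋆ ∈ D} P( sup_{λ ∈ [λ_min, λ_max]} W₂(μ̂_{(θ̂_λ, θ⋆)}, μ⋆_λ)² ≥ ε ) ≤ C ε^{−max(1,a)−1} N^{(1/p − 1)₊} exp(−c N ε² ε^a (log ε)^{−2}), where a = 1/2 + 1/p. -/

import Mathlib

open MeasureTheory ProbabilityTheory
open scoped ENNReal NNReal

noncomputable section

/-- Standard Gaussian density φ. -/
def gphi (x : ℝ) : ℝ := Real.exp (-x ^ 2 / 2) / Real.sqrt (2 * Real.pi)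

/-- Standard Gaussian CDF Φ. -/
def gPhi (x : ℝ) : ℝ := ∫ t in Set.Iic x, gphi t

/-- Soft thresholding η(x; b) = sign(x)(|x| − b)₊. -/
def eta (x b : ℝ) : ℝ := Real.sign x * max (|x| - b) 0

/-- Derivative in x of soft thresholding: η′(x; b) = 1_{|x| > b}. -/
def eta' (x b : ℝ) : ℝ := if b < |x| then 1 else 0

/-- The ℓ_p ball F_p(ξ) = {x : (1/N) ∑ |xᵢ|^p ≤ ξ^p}. -/
def Fball (N : ℕ) (p ξ : ℝ) : Set (Fin N → ℝ) :=
  {x | (1 / (N : ℝ)) * ∑ i, |x i| ^ p ≤ ξ ^ p}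

/-- Number of nonzero entries ‖x‖₀. -/
def l0 {N : ℕ} (x : Fin N → ℝ) : ℕ := (Finset.univ.filter fun i => x i ≠ 0).card

/-- The ℓ₀ ball F_0(s) = {x : ‖x‖₀ ≤ sN}. -/
def F0ball (N : ℕ) (s : ℝ) : Set (Fin N → ℝ) := {x | (l0 x : ℝ) ≤ s * N}

/-- The critical sparsity s_max(δ). -/
def smax (δ : ℝ) : ℝ :=
  δ * sSup ((fun α : ℝ =>
      (1 - (2 / δ) * ((1 + α ^ 2) * gPhi (-α) - α * gphi α)) /
      (1 + α ^ 2 - 2 * ((1 + α ^ 2) * gPhi (-α) - α * gphi α))) '' Set.Ici 0)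

/-- Empirical distribution of the entries of a vector. -/
def empDist {N : ℕ} (θ : Fin N → ℝ) : Measure ℝ :=
  ((N : ℝ≥0∞))⁻¹ • ∑ i : Fin N, Measure.dirac (θ i)

/-- Empirical distribution of pairs of entries of two vectors. -/
def empDist2 {N : ℕ} (u v : Fin N → ℝ) : Measure (ℝ × ℝ) :=
  ((N : ℝ≥0∞))⁻¹ • ∑ i : Fin N, Measure.dirac (u i, v i)

/-- Squared order-2 Wasserstein distance between measures on ℝ². -/
def W2sq (μ ν : Measure (ℝ × ℝ)) : ℝ :=
  sInf {r : ℝ | ∃ γ : Measure ((ℝ × ℝ) × (ℝ × ℝ)),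
    γ.map Prod.fst = μ ∧ γ.map Prod.snd = ν ∧
    r = ∫ q, ((q.1.1 - q.2.1) ^ 2 + (q.1.2 - q.2.2) ^ 2) ∂γ}

/-- Order-2 Wasserstein distance. -/
def W2 (μ ν : Measure (ℝ × ℝ)) : ℝ := Real.sqrt (W2sq μ ν)

/-- Standard Gaussian measure on ℝ. -/
def stdG : Measure ℝ := gaussianReal 0 1

/-- The state-evolution fixed point equations (for (Θ,Z) ∼ μ ⊗ N(0,1)),
together with positivity of (β, τ). -/
def StateEvo (δ σ : ℝ) (μ : Measure ℝ) (lam β τ : ℝ) : Prop :=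
  0 < β ∧ 0 < τ ∧
  τ ^ 2 = σ ^ 2 + (1 / δ) *
    ∫ q : ℝ × ℝ, (eta (q.1 + τ * q.2) (τ * lam / β) - q.1) ^ 2 ∂(μ.prod stdG) ∧
  β = τ * (1 - (1 / δ) *
    ∫ q : ℝ × ℝ, eta' (q.1 + τ * q.2) (τ * lam / β) ∂(μ.prod stdG))

/-- s⋆ = P(|Θ + τZ| ≥ ατ) for (Θ,Z) ∼ μ ⊗ N(0,1). -/
def sStar (μ : Measure ℝ) (τ α : ℝ) : ℝ :=
  ((μ.prod stdG) {q : ℝ × ℝ | α * τ ≤ |q.1 + τ * q.2|}).toReal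

/-- The limit law μ⋆: law of (η(Θ + τZ; ατ), Θ) for (Θ,Z) ∼ μ ⊗ N(0,1). -/
def muStar (μ : Measure ℝ) (τ α : ℝ) : Measure (ℝ × ℝ) :=
  (μ.prod stdG).map (fun q => (eta (q.1 + τ * q.2) (α * τ), q.1))

/-- The limit law for the debiased Lasso: law of (Θ + τZ, Θ). -/
def muStarD (μ : Measure ℝ) (τ : ℝ) : Measure (ℝ × ℝ) :=
  (μ.prod stdG).map (fun q => (q.1 + τ * q.2, q.1))

/-- Law of the design matrix: i.i.d. N(0, 1/n) entries. -/
def PX (n N : ℕ) : Measure (Fin n → Fin N → ℝ) :=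
  Measure.pi fun _ => Measure.pi fun _ => gaussianReal 0 ((n : ℝ≥0))⁻¹

/-- Law of the noise: i.i.d. standard Gaussian entries. -/
def Pz (n : ℕ) : Measure (Fin n → ℝ) :=
  Measure.pi fun _ => gaussianReal 0 1

/-- Joint law of (X, z). -/
def Pmodel (n N : ℕ) : Measure ((Fin n → Fin N → ℝ) × (Fin n → ℝ)) :=
  (PX n N).prod (Pz n)

/-- The response y = Xθ⋆ + σz. -/
def yvec {n N : ℕ} (σ : ℝ) (θstar : Fin N → ℝ) (X : Fin n → Fin N → ℝ)
    (z : Fin n → ℝ) : Fin n → ℝ :=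
  fun i => (∑ j, X i j * θstar j) + σ * z i

/-- The Lasso cost (1/(2n))‖y − Xθ‖² + (λ/n)‖θ‖₁. -/
def lassoCost {n N : ℕ} (X : Fin n → Fin N → ℝ) (y : Fin n → ℝ) (lam : ℝ)
    (θ : Fin N → ℝ) : ℝ :=
  (1 / (2 * (n : ℝ))) * ∑ i, (y i - ∑ j, X i j * θ j) ^ 2
    + (lam / (n : ℝ)) * ∑ j, |θ j|

/-- The uniformity class: D is either an ℓ_p ball F_p(ξ) or an ℓ₀ ball F_0(s) with
s below the critical sparsity, with the corresponding exponent q. -/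
def DFamSpec (δ : ℝ) (Dfam : (M : ℕ) → Set (Fin M → ℝ)) (q : ℝ) : Prop :=
  (∃ p ξ : ℝ, 0 < p ∧ 0 < ξ ∧ (∀ M, Dfam M = Fball M p ξ) ∧ q = max (1 / p - 1) 0) ∨
  (∃ s : ℝ, 0 ≤ s ∧ s < smax δ ∧ (∀ M, Dfam M = F0ball M s) ∧ q = 0)

/-- Bounded `C¹` functions with bounded derivative. -/
def BddC1 {E : Type*} [NormedAddCommGroup E] [NormedSpace ℝ E] (φ : E → ℝ) : Prop :=
  ContDiff ℝ 1 φ ∧ ∃ C, ∀ x, |φ x| ≤ C ∧ ‖fderiv ℝ φ x‖ ≤ C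

lemma BddC1.integrable_comp {E : Type*} [NormedAddCommGroup E] [NormedSpace ℝ E]
    [MeasurableSpace E] [BorelSpace E] [SecondCountableTopology E] {φ : E → ℝ} (h : BddC1 φ)
    {Ω : Type*} [MeasurableSpace Ω] {P : Measure Ω} [IsFiniteMeasure P] {X : Ω → E}
    (hX : Measurable X) : Integrable (fun ω => φ (X ω)) P := by
  obtain ⟨hc, C, hC⟩ := h
  exact Integrable.of_bound (hc.continuous.measurable.comp hX).aestronglyMeasurable C
    (Filter.Eventually.of_forall fun ω => (hC _).1)

lemma BddC1.integrable_fderiv_comp {E : Type*} [NormedAddCommGroup E] [NormedSpace ℝ E]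
    [MeasurableSpace E] [BorelSpace E] [SecondCountableTopology E] {φ : E → ℝ} (h : BddC1 φ)
    {Ω : Type*} [MeasurableSpace Ω] {P : Measure Ω} [IsFiniteMeasure P] {X : Ω → E}
    (hX : Measurable X) (v : E) : Integrable (fun ω => fderiv ℝ φ (X ω) v) P := by
  obtain ⟨hc, C, hC⟩ := h
  have : Continuous fun x => fderiv ℝ φ x v :=
    (hc.continuous_fderiv (by norm_num)).clm_apply continuous_const
  refine Integrable.of_bound (this.measurable.comp hX).aestronglyMeasurable (C * ‖v‖)
    (Filter.Eventually.of_forall fun ω => ?_)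
  exact ((fderiv ℝ φ (X ω)).le_opNorm v).trans
    (mul_le_mul_of_nonneg_right (hC _).2 (norm_nonneg _))

lemma BddC1.integrable_mul_comp {E : Type*} [NormedAddCommGroup E] [NormedSpace ℝ E]
    [MeasurableSpace E] [BorelSpace E] [SecondCountableTopology E] {φ : E → ℝ} (h : BddC1 φ)
    {Ω : Type*} [MeasurableSpace Ω] {P : Measure Ω} {X : Ω → E} {Y : Ω → ℝ}
    (hX : Measurable X) (hY : Integrable Y P) : Integrable (fun ω => Y ω * φ (X ω)) P := by
  obtain ⟨hc, C, hC⟩ := h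
  exact hY.mul_bdd (c := C) (hc.continuous.measurable.comp hX).aestronglyMeasurable
    (Filter.Eventually.of_forall fun ω => (hC _).1)

lemma BddC1.comp_affine {E F : Type*} [NormedAddCommGroup E] [NormedSpace ℝ E]
    [NormedAddCommGroup F] [NormedSpace ℝ F] {φ : E → ℝ} (h : BddC1 φ) (L : F →L[ℝ] E) (y : E) :
    BddC1 (fun x => φ (L x + y)) ∧
      ∀ x v, fderiv ℝ (fun x => φ (L x + y)) x v = fderiv ℝ φ (L x + y) (L v) := by
  obtain ⟨hc, C, hC⟩ := h
  have hd : ∀ x, HasFDerivAt (fun x => φ (L x + y)) ((fderiv ℝ φ (L x + y)).comp L) x := by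
    intro x
    have h1 : HasFDerivAt (fun x => L x + y) L x := L.hasFDerivAt.add_const y
    exact ((hc.differentiable (by norm_num)) _).hasFDerivAt.comp x h1
  refine ⟨⟨hc.comp (L.contDiff.add contDiff_const), C * ‖L‖ + |C|, fun x => ⟨?_, ?_⟩⟩, ?_⟩
  · have := (hC (L x + y)).1
    have h0 : 0 ≤ C := (abs_nonneg _).trans this
    have := mul_nonneg h0 (norm_nonneg L)
    have := le_abs_self C
    linarith
  · rw [(hd x).fderiv]
    refine (ContinuousLinearMap.opNorm_comp_le _ _).trans ?_
    have := mul_le_mul_of_nonneg_right (hC (L x + y)).2 (norm_nonneg L)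
    have := abs_nonneg C
    linarith
  · intro x v
    rw [(hd x).fderiv]; rfl

/-- Gaussian integration by parts on the line. -/
lemma gaussianReal_integral_mul {v : ℝ≥0} (hv : v ≠ 0) {ψ : ℝ → ℝ} (h : BddC1 ψ) :
    ∫ x, x * ψ x ∂(gaussianReal 0 v) = v * ∫ x, deriv ψ x ∂(gaussianReal 0 v) := by
  have hv' : (v : ℝ) ≠ 0 := by exact_mod_cast hv
  have hd : ∀ x, HasDerivAt (gaussianPDFReal 0 v) (-(x / v) * gaussianPDFReal 0 v x) x := by
    intro x
    unfold gaussianPDFReal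
    have : HasDerivAt (fun x : ℝ => -(x - 0) ^ 2 / (2 * v)) (-(x / v)) x := by
      have h1 := (((hasDerivAt_id x).sub_const 0).pow 2).neg.div_const (2 * (v : ℝ))
      refine HasDerivAt.congr_deriv h1 ?_
      simp only [id_eq, Nat.cast_ofNat, Nat.add_one_sub_one, pow_one, sub_zero]
      field_simp
    exact (this.exp.const_mul (√(2 * Real.pi * v))⁻¹).congr_deriv (by ring)
  have e1 : ∀ g : ℝ → ℝ, ∫ x, g x ∂(gaussianReal 0 v) = ∫ x, g x * gaussianPDFReal 0 v x := by
    intro g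
    rw [integral_gaussianReal_eq_integral_smul hv]
    simp [mul_comm]
  have i1 : ∀ g : ℝ → ℝ, Integrable g (gaussianReal 0 v) →
      Integrable (fun x => g x * gaussianPDFReal 0 v x) := by
    intro g hg
    rw [gaussianReal_of_var_ne_zero _ hv] at hg
    have := (integrable_withDensity_iff_integrable_smul' (measurable_gaussianPDF 0 v)
      (Filter.Eventually.of_forall fun x => gaussianPDF_lt_top)).1 hg
    refine this.congr (Filter.Eventually.of_forall fun x => ?_)
    simp [toReal_gaussianPDF, mul_comm]
  have iid : Integrable (fun x : ℝ => x) (gaussianReal 0 v) :=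
    (memLp_id_gaussianReal (μ := 0) (v := v) 1).integrable (by norm_num)
  have hdiff : ∀ x, HasDerivAt ψ (deriv ψ x) x := fun x =>
    (h.1.differentiable (by norm_num) x).hasDerivAt
  have id' : Integrable (fun x => deriv ψ x) (gaussianReal 0 v) := by
    have := h.integrable_fderiv_comp (P := gaussianReal 0 v) measurable_id (1 : ℝ)
    simpa using this
  have im : Integrable (fun x => x * ψ x) (gaussianReal 0 v) :=
    h.integrable_mul_comp measurable_id iid
  have ip : Integrable (fun x => ψ x) (gaussianReal 0 v) := h.integrable_comp measurable_id
  have key := integral_mul_deriv_eq_deriv_mul_of_integrable (u := ψ) (v := gaussianPDFReal 0 v)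
    (u' := deriv ψ) (v' := fun x => -(x / v) * gaussianPDFReal 0 v x) (fun x _ => hdiff x)
    (fun x _ => hd x) ?_ (i1 _ id') (i1 _ ip)
  · rw [e1, e1]
    have : ∫ x, ψ x * (-(x / v) * gaussianPDFReal 0 v x)
        = -(1 / (v : ℝ)) * ∫ x, x * ψ x * gaussianPDFReal 0 v x := by
      rw [← integral_const_mul]; congr 1; ext x; ring
    rw [this] at key
    field_simp at key
    linarith
  · have := (i1 _ im).const_mul (-(1 / (v : ℝ)))
    refine this.congr (Filter.Eventually.of_forall fun x => ?_)
    simp; ring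

/-- A random vector satisfying Gaussian integration by parts with covariance `S`. -/
structure SteinVec {Ω A : Type*} [MeasurableSpace Ω] [Fintype A] [DecidableEq A] (P : Measure Ω)
    (X : Ω → A → ℝ) (S : A → A → ℝ) : Prop where
  meas : Measurable X
  int : ∀ a, Integrable (fun ω => X ω a) P
  ibp : ∀ φ : (A → ℝ) → ℝ, BddC1 φ → ∀ a, ∫ ω, X ω a * φ (X ω) ∂P
    = ∑ b, S a b * ∫ ω, fderiv ℝ φ (X ω) (Pi.single b 1) ∂P

section
variable {A : Type*} [Fintype A] [DecidableEq A]

lemma clm_pi_apply_eq_sum (L : (A → ℝ) →L[ℝ] ℝ) (v : A → ℝ) :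
    L v = ∑ b, v b * L (Pi.single b 1) := by
  conv_lhs => rw [pi_eq_sum_univ' v]
  simp [map_sum]

lemma steinVec_gaussianReal {v : ℝ≥0} (hv : v ≠ 0) (u : A → ℝ) :
    SteinVec (gaussianReal 0 v) (fun x a => x * u a) (fun a b => v * (u a * u b)) := by
  have iid : Integrable (fun x : ℝ => x) (gaussianReal 0 v) :=
    (memLp_id_gaussianReal (μ := 0) (v := v) 1).integrable (by norm_num)
  have hm : Measurable (fun (x : ℝ) a => x * u a) := by fun_prop
  refine ⟨hm, fun a => iid.mul_const _, fun φ hφ a => ?_⟩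
  let L : ℝ →L[ℝ] (A → ℝ) := (ContinuousLinearMap.id ℝ ℝ).smulRight u
  have hL : ∀ x, L x + 0 = fun a => x * u a := by intro x; ext a; simp [L]
  obtain ⟨hb, hf⟩ := hφ.comp_affine L 0
  have key := gaussianReal_integral_mul hv hb
  have hder : ∀ x, deriv (fun x => φ (L x + 0)) x
      = ∑ b, u b * fderiv ℝ φ (fun a => x * u a) (Pi.single b 1) := by
    intro x
    rw [← fderiv_apply_one_eq_deriv, hf, clm_pi_apply_eq_sum, hL]
    simp [L]
  simp_rw [hder, hL] at key
  rw [integral_finsetSum] at key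
  · simp_rw [integral_const_mul] at key
    have : ∫ ω, ω * u a * φ (fun a => ω * u a) ∂(gaussianReal 0 v)
       = u a * ∫ ω, ω * φ (fun a => ω * u a) ∂(gaussianReal 0 v) := by
      rw [← integral_const_mul]; congr 1; ext; ring
    rw [this, key, Finset.mul_sum, Finset.mul_sum]
    refine Finset.sum_congr rfl fun b _ => by ring
  · intro b _
    exact (hφ.integrable_fderiv_comp hm _).const_mul _

lemma SteinVec.add_prod {Ω Ω' : Type*} [MeasurableSpace Ω] [MeasurableSpace Ω'] {P : Measure Ω}
    {P' : Measure Ω'} [IsProbabilityMeasure P] [IsProbabilityMeasure P'] {X : Ω → A → ℝ}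
    {Y : Ω' → A → ℝ} {S S' : A → A → ℝ} (hX : SteinVec P X S) (hY : SteinVec P' Y S') :
    SteinVec (P.prod P') (fun ω a => X ω.1 a + Y ω.2 a) (fun a b => S a b + S' a b) := by
  have hm : Measurable (fun (ω : Ω × Ω') a => X ω.1 a + Y ω.2 a) :=
    (hX.meas.comp measurable_fst).add (hY.meas.comp measurable_snd)
  have hX1 : ∀ a, Integrable (fun ω : Ω × Ω' => X ω.1 a) (P.prod P') := fun a => (hX.int a).comp_fst P'
  have hY1 : ∀ a, Integrable (fun ω : Ω × Ω' => Y ω.2 a) (P.prod P') := fun a => (hY.int a).comp_snd P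
  refine ⟨hm, fun a => (hX1 a).add (hY1 a), fun φ hφ a => ?_⟩
  have i1 := hφ.integrable_mul_comp hm (hX1 a)
  have i2 := hφ.integrable_mul_comp hm (hY1 a)
  have i3 : ∀ b, Integrable (fun ω : Ω × Ω' =>
      fderiv ℝ φ (fun a => X ω.1 a + Y ω.2 a) (Pi.single b 1)) (P.prod P') :=
    fun b => hφ.integrable_fderiv_comp hm _
  have e1 : ∫ ω : Ω × Ω', X ω.1 a * φ (fun a => X ω.1 a + Y ω.2 a) ∂(P.prod P')
      = ∑ b, S a b * ∫ ω : Ω × Ω', fderiv ℝ φ (fun a => X ω.1 a + Y ω.2 a) (Pi.single b 1)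
        ∂(P.prod P') := by
    rw [integral_prod_symm _ i1]
    have : ∀ y : Ω', ∫ x, X x a * φ (fun a => X x a + Y y a) ∂P
       = ∑ b, S a b * ∫ x, fderiv ℝ φ (fun a => X x a + Y y a) (Pi.single b 1) ∂P := by
      intro y
      obtain ⟨hb, hf⟩ := hφ.comp_affine (ContinuousLinearMap.id ℝ (A → ℝ)) (Y y)
      have := hX.ibp _ hb a
      simp_rw [hf] at this
      exact this
    simp_rw [this]
    rw [integral_finsetSum]
    · refine Finset.sum_congr rfl fun b _ => ?_
      rw [integral_const_mul, integral_prod_symm _ (i3 b)]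
    · intro b _
      exact ((i3 b).integral_prod_right).const_mul _
  have e2 : ∫ ω : Ω × Ω', Y ω.2 a * φ (fun a => X ω.1 a + Y ω.2 a) ∂(P.prod P')
      = ∑ b, S' a b * ∫ ω : Ω × Ω', fderiv ℝ φ (fun a => X ω.1 a + Y ω.2 a) (Pi.single b 1)
        ∂(P.prod P') := by
    rw [integral_prod _ i2]
    have : ∀ x : Ω, ∫ y, Y y a * φ (fun a => X x a + Y y a) ∂P'
       = ∑ b, S' a b * ∫ y, fderiv ℝ φ (fun a => X x a + Y y a) (Pi.single b 1) ∂P' := by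
      intro x
      obtain ⟨hb, hf⟩ := hφ.comp_affine (ContinuousLinearMap.id ℝ (A → ℝ)) (X x)
      have := hY.ibp _ hb a
      simp_rw [hf] at this
      have hc : ∀ y : Ω', (ContinuousLinearMap.id ℝ (A → ℝ)) (Y y) + X x
          = fun a => X x a + Y y a := by intro y; ext c; simp [add_comm]
      simp_rw [hc] at this
      exact this
    simp_rw [this]
    rw [integral_finsetSum]
    · refine Finset.sum_congr rfl fun b _ => ?_
      rw [integral_const_mul, integral_prod _ (i3 b)]
    · intro b _
      exact ((i3 b).integral_prod_left).const_mul _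
  simp_rw [add_mul]
  rw [integral_add i1 i2, e1, e2, Finset.sum_add_distrib]

lemma SteinVec.of_measurePreserving {Ω Ω' : Type*} [MeasurableSpace Ω] [MeasurableSpace Ω']
    {P : Measure Ω} {P' : Measure Ω'} {X : Ω' → A → ℝ} {S : A → A → ℝ} (hX : SteinVec P' X S)
    (T : Ω → Ω') (hT : MeasurePreserving T P P') :
    SteinVec P (fun ω => X (T ω)) S := by
  refine ⟨hX.meas.comp hT.measurable, fun a => ?_, fun φ hφ a => ?_⟩
  · exact hT.integrable_comp_of_integrable (hX.int a)
  · have := hX.ibp φ hφ a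
    rw [← hT.map_eq] at this
    have hφm := hφ.1.continuous.measurable
    rw [integral_map hT.measurable.aemeasurable] at this
    · rw [this]
      refine Finset.sum_congr rfl fun b _ => ?_
      rw [integral_map hT.measurable.aemeasurable]
      have : Continuous fun x => fderiv ℝ φ x (Pi.single b 1) :=
        (hφ.1.continuous_fderiv (by norm_num)).clm_apply continuous_const
      exact (this.measurable.comp hX.meas).aestronglyMeasurable
    · exact (((measurable_pi_apply a).comp hX.meas).mul
        (hφm.comp hX.meas)).aestronglyMeasurable

lemma steinVec_pi {n : ℕ} {Ω : Type*} [MeasurableSpace Ω] (P : Fin n → Measure Ω)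
    [∀ i, IsProbabilityMeasure (P i)] (X : Fin n → Ω → A → ℝ) (S : Fin n → A → A → ℝ)
    (h : ∀ i, SteinVec (P i) (X i) (S i)) :
    SteinVec (Measure.pi P) (fun ω a => ∑ i, X i (ω i) a) (fun a b => ∑ i, S i a b) := by
  induction n with
  | zero =>
    refine ⟨by simp, by simp, fun φ hφ a => by simp⟩
  | succ n ih =>
    have h2 := ih (fun i => P i.succ) (fun i => X i.succ) (fun i => S i.succ) (fun i => h i.succ)
    have h3 := (h 0).add_prod h2
    have := h3.of_measurePreserving _ (measurePreserving_piFinSuccAbove P 0)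
    convert this using 3
    · rw [Fin.sum_univ_succ]; rfl
    · rw [Fin.sum_univ_succ]

lemma SteinVec.neg {Ω : Type*} [MeasurableSpace Ω] {P : Measure Ω} {X : Ω → A → ℝ}
    {S : A → A → ℝ} (hX : SteinVec P X S) : SteinVec P (fun ω a => -X ω a) S := by
  refine ⟨hX.meas.neg, fun a => (hX.int a).neg, fun φ hφ a => ?_⟩
  obtain ⟨hb, hf⟩ := hφ.comp_affine (-ContinuousLinearMap.id ℝ (A → ℝ)) 0
  have := hX.ibp _ hb a
  simp_rw [hf] at this
  have hc : ∀ x : A → ℝ, (-ContinuousLinearMap.id ℝ (A → ℝ)) x + 0 = fun a => -x a := by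
    intro x; ext c; simp
  simp_rw [hc] at this
  simp_rw [neg_mul, integral_neg, this, ← Finset.sum_neg_distrib]
  refine Finset.sum_congr rfl fun b _ => ?_
  have : (-ContinuousLinearMap.id ℝ (A → ℝ)) (Pi.single b 1) = -Pi.single b 1 := by ext; simp
  rw [this]
  simp_rw [map_neg, integral_neg]
  ring

end

lemma BddC1.const {E : Type*} [NormedAddCommGroup E] [NormedSpace ℝ E] (c : ℝ) :
    BddC1 (fun _ : E => c) := by
  refine ⟨contDiff_const, |c|, fun x => ⟨le_rfl, ?_⟩⟩
  simp

lemma BddC1.add {E : Type*} [NormedAddCommGroup E] [NormedSpace ℝ E] {f g : E → ℝ}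
    (hf : BddC1 f) (hg : BddC1 g) : BddC1 (fun x => f x + g x) := by
  obtain ⟨hf, C, hC⟩ := hf
  obtain ⟨hg, D, hD⟩ := hg
  refine ⟨hf.add hg, C + D, fun x => ⟨?_, ?_⟩⟩
  · exact (abs_add_le _ _).trans (add_le_add (hC x).1 (hD x).1)
  · rw [fderiv_fun_add (hf.differentiable (by norm_num) x) (hg.differentiable (by norm_num) x)]
    exact (norm_add_le _ _).trans (add_le_add (hC x).2 (hD x).2)

lemma BddC1.mul {E : Type*} [NormedAddCommGroup E] [NormedSpace ℝ E] {f g : E → ℝ}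
    (hf : BddC1 f) (hg : BddC1 g) : BddC1 (fun x => f x * g x) := by
  obtain ⟨hf, C, hC⟩ := hf
  obtain ⟨hg, D, hD⟩ := hg
  have hC0 : 0 ≤ C := (abs_nonneg _).trans (hC 0).1
  have hD0 : 0 ≤ D := (abs_nonneg _).trans (hD 0).1
  refine ⟨hf.mul hg, C * D + C * D, fun x => ⟨?_, ?_⟩⟩
  · rw [abs_mul]
    have := mul_le_mul (hC x).1 (hD x).1 (abs_nonneg _) hC0
    nlinarith [mul_nonneg hC0 hD0]
  · rw [fderiv_fun_mul (hf.differentiable (by norm_num) x) (hg.differentiable (by norm_num) x)]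
    refine (norm_add_le _ _).trans ?_
    rw [norm_smul, norm_smul, Real.norm_eq_abs, Real.norm_eq_abs]
    have h1 := mul_le_mul (hC x).1 (hD x).2 (norm_nonneg _) hC0
    have h2 := mul_le_mul (hD x).1 (hC x).2 (norm_nonneg _) hD0
    linarith

section
variable {A : Type*} [Fintype A] [DecidableEq A]

/-- Partial derivative along a coordinate. -/
def pderiv (a : A) (f : (A → ℝ) → ℝ) (x : A → ℝ) : ℝ := fderiv ℝ f x (Pi.single a 1)

/-- Bounded functions with bounded partial derivatives up to order two. -/
def BddC2 (f : (A → ℝ) → ℝ) : Prop := BddC1 f ∧ ∀ a, BddC1 (pderiv a f)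

lemma BddC1.hasFDerivAt {E : Type*} [NormedAddCommGroup E] [NormedSpace ℝ E] {f : E → ℝ}
    (hf : BddC1 f) (x : E) : HasFDerivAt f (fderiv ℝ f x) x :=
  (hf.1.differentiable (by norm_num) x).hasFDerivAt

lemma BddC2.const (c : ℝ) : BddC2 (fun _ : A → ℝ => c) := by
  refine ⟨BddC1.const c, fun a => ?_⟩
  convert BddC1.const (E := A → ℝ) 0 using 2
  simp [pderiv]

lemma BddC2.add {f g : (A → ℝ) → ℝ} (hf : BddC2 f) (hg : BddC2 g) :
    BddC2 (fun x => f x + g x) := by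
  refine ⟨hf.1.add hg.1, fun a => ?_⟩
  have : pderiv a (fun x => f x + g x) = fun x => pderiv a f x + pderiv a g x := by
    ext x
    simp [pderiv,
      fderiv_fun_add (hf.1.hasFDerivAt x).differentiableAt (hg.1.hasFDerivAt x).differentiableAt]
  rw [this]
  exact (hf.2 a).add (hg.2 a)

lemma BddC2.mul {f g : (A → ℝ) → ℝ} (hf : BddC2 f) (hg : BddC2 g) :
    BddC2 (fun x => f x * g x) := by
  refine ⟨hf.1.mul hg.1, fun a => ?_⟩
  have : pderiv a (fun x => f x * g x) = fun x => f x * pderiv a g x + g x * pderiv a f x := by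
    ext x
    simp [pderiv,
      fderiv_fun_mul (hf.1.hasFDerivAt x).differentiableAt (hg.1.hasFDerivAt x).differentiableAt]
  rw [this]
  exact (hf.1.mul (hg.2 a)).add (hg.1.mul (hf.2 a))

lemma BddC2.prod {ι : Type*} (s : Finset ι) {f : ι → (A → ℝ) → ℝ} (hf : ∀ i, BddC2 (f i)) :
    BddC2 (fun x => ∏ i ∈ s, f i x) := by
  classical
  induction s using Finset.induction_on with
  | empty => simpa using BddC2.const (A := A) 1
  | insert i s hi ih =>
    simp_rw [Finset.prod_insert hi]
    exact (hf i).mul ih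

lemma nonneg_of_hasDerivAt_of_le {φ : ℝ → ℝ} {d : ℝ} (h : HasDerivAt φ d 0)
    (hm : ∀ t, 0 ≤ t → φ 0 ≤ φ t) : 0 ≤ d := by
  have h1 := h.tendsto_slope_zero_right
  refine ge_of_tendsto h1 ?_
  filter_upwards [self_mem_nhdsWithin] with t ht
  have : (0 : ℝ) < t := ht
  have := hm t this.le
  simp only [zero_add, smul_eq_mul]
  have : 0 ≤ φ t - φ 0 := by linarith
  positivity

/-- Supermodularity forces nonnegative mixed second derivatives. -/
lemma pderiv_pderiv_nonneg {f : (A → ℝ) → ℝ} (hf : BddC2 f) (a b : A)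
    (H : ∀ x : A → ℝ, ∀ s t : ℝ, 0 ≤ s → 0 ≤ t →
      f (x + s • Pi.single b 1) + f (x + t • Pi.single a 1)
        ≤ f (x + s • Pi.single b 1 + t • Pi.single a 1) + f x) (x : A → ℝ) :
    0 ≤ pderiv b (pderiv a f) x := by
  have line : ∀ (g : (A → ℝ) → ℝ), BddC1 g → ∀ (y : A → ℝ) (c : A),
      HasDerivAt (fun t : ℝ => g (y + t • Pi.single c 1)) (pderiv c g y) 0 := by
    intro g hg y c
    have h1 : HasDerivAt (fun t : ℝ => y + t • (Pi.single c 1 : A → ℝ)) (Pi.single c 1) 0 := by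
      have := ((hasDerivAt_id (0 : ℝ)).smul_const (Pi.single c 1 : A → ℝ)).const_add y
      simpa using this
    have h2 : HasFDerivAt g (fderiv ℝ g y) (y + (0 : ℝ) • (Pi.single c 1 : A → ℝ)) := by
      simpa using hg.hasFDerivAt y
    exact h2.comp_hasDerivAt 0 h1
  refine nonneg_of_hasDerivAt_of_le (line _ (hf.2 a) x b) fun s hs => ?_
  have h1 := (line f hf.1 (x + s • Pi.single b 1) a).sub (line f hf.1 x a)
  have h2 := nonneg_of_hasDerivAt_of_le h1 fun t ht => by
    have := H x s t hs ht
    simp only [Pi.sub_apply, zero_smul, add_zero]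
    linarith
  simp only [zero_smul, add_zero]
  linarith

lemma SteinVec.ibp_prod {Ω Ω' : Type*} [MeasurableSpace Ω] [MeasurableSpace Ω'] {P : Measure Ω}
    {P' : Measure Ω'} [IsProbabilityMeasure P] [IsProbabilityMeasure P'] {X : Ω → A → ℝ}
    {Y : Ω' → A → ℝ} {S : A → A → ℝ} (hX : SteinVec P X S) (hY : Measurable Y) (c : ℝ)
    {φ : (A → ℝ) → ℝ} (hφ : BddC1 φ) (a : A) :
    ∫ ω : Ω × Ω', X ω.1 a * φ (fun a => c * X ω.1 a + Y ω.2 a) ∂(P.prod P')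
      = c * ∑ b, S a b * ∫ ω : Ω × Ω', pderiv b φ (fun a => c * X ω.1 a + Y ω.2 a)
        ∂(P.prod P') := by
  have hm : Measurable (fun (ω : Ω × Ω') a => c * X ω.1 a + Y ω.2 a) :=
    ((hX.meas.comp measurable_fst).const_smul c).add (hY.comp measurable_snd)
  have i1 := hφ.integrable_mul_comp (P := P.prod P') hm ((hX.int a).comp_fst P')
  have i3 : ∀ b, Integrable (fun ω : Ω × Ω' => pderiv b φ (fun a => c * X ω.1 a + Y ω.2 a))
      (P.prod P') := fun b => hφ.integrable_fderiv_comp hm _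
  rw [integral_prod_symm _ i1]
  have : ∀ y : Ω', ∫ x, X x a * φ (fun a => c * X x a + Y y a) ∂P
     = ∑ b, (c * S a b) * ∫ x, pderiv b φ (fun a => c * X x a + Y y a) ∂P := by
    intro y
    obtain ⟨hb, hf⟩ := hφ.comp_affine (c • ContinuousLinearMap.id ℝ (A → ℝ)) (Y y)
    have := hX.ibp _ hb a
    simp_rw [hf] at this
    refine this.trans (Finset.sum_congr rfl fun b _ => ?_)
    rw [mul_comm c, mul_assoc, ← integral_const_mul c]
    simp only [smul_apply, map_smul, smul_eq_mul]
    rfl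
  simp_rw [this]
  rw [integral_finsetSum, Finset.mul_sum]
  · refine Finset.sum_congr rfl fun b _ => ?_
    rw [integral_const_mul, integral_prod_symm _ (i3 b), mul_assoc]
  · intro b _
    exact ((i3 b).integral_prod_right).const_mul _

/-- Gaussian interpolation (Slepian–Gordon–Kahane) inequality. -/
lemma SteinVec.integral_le {Ω Ω' : Type*} [MeasurableSpace Ω] [MeasurableSpace Ω'] {P : Measure Ω}
    {P' : Measure Ω'} [IsProbabilityMeasure P] [IsProbabilityMeasure P'] {X : Ω → A → ℝ}
    {Y : Ω' → A → ℝ} {S S' : A → A → ℝ} (hX : SteinVec P X S) (hY : SteinVec P' Y S')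
    {f : (A → ℝ) → ℝ} (hf : BddC2 f)
    (hS : ∀ a b x, 0 ≤ (S a b - S' a b) * pderiv b (pderiv a f) x) :
    ∫ ω, f (Y ω) ∂P' ≤ ∫ ω, f (X ω) ∂P := by
  set Q := P.prod P'
  let U : ℝ → Ω × Ω' → A → ℝ := fun s ω a => Real.sin s * X ω.1 a + Real.cos s * Y ω.2 a
  have hUm : ∀ s, Measurable (U s) := fun s =>
    ((hX.meas.comp measurable_fst).const_smul (Real.sin s)).add
      ((hY.meas.comp measurable_snd).const_smul (Real.cos s))
  have hX1 : ∀ a, Integrable (fun ω : Ω × Ω' => X ω.1 a) Q := fun a => (hX.int a).comp_fst P'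
  have hY1 : ∀ a, Integrable (fun ω : Ω × Ω' => Y ω.2 a) Q := fun a => (hY.int a).comp_snd P
  obtain ⟨C, hC⟩ := hf.1.2
  let D : ℝ → Ω × Ω' → ℝ := fun s ω =>
    ∑ a, (Real.cos s * X ω.1 a - Real.sin s * Y ω.2 a) * pderiv a f (U s ω)
  have hder : ∀ s ω, HasDerivAt (fun s => f (U s ω)) (D s ω) s := by
    intro s ω
    have h1 : HasDerivAt (fun s => U s ω)
        (fun a => Real.cos s * X ω.1 a - Real.sin s * Y ω.2 a) s := by
      rw [hasDerivAt_pi]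
      intro a
      refine (((Real.hasDerivAt_sin s).mul_const (X ω.1 a)).add
        ((Real.hasDerivAt_cos s).mul_const (Y ω.2 a))).congr_deriv ?_
      ring
    refine ((hf.1.hasFDerivAt (U s ω)).comp_hasDerivAt s h1).congr_deriv ?_
    rw [clm_pi_apply_eq_sum]; rfl
  have hpd : ∀ a x, |pderiv a f x| ≤ C := by
    intro a x
    refine ((fderiv ℝ f x).le_opNorm _).trans ?_
    have : ‖(Pi.single a 1 : A → ℝ)‖ = 1 := by rw [Pi.norm_single]; simp
    rw [this, mul_one]; exact (hC x).2
  have hG : ∀ s, HasDerivAt (fun s => ∫ ω, f (U s ω) ∂Q) (∫ ω, D s ω ∂Q) s := by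
    intro s
    refine (hasDerivAt_integral_of_dominated_loc_of_deriv_le (s := Set.univ)
      (bound := fun ω => ∑ a, (|X ω.1 a| + |Y ω.2 a|) * C) Filter.univ_mem ?_ ?_ ?_ ?_ ?_ ?_).2
    · exact Filter.Eventually.of_forall fun s => (hf.1.integrable_comp (hUm s)).1
    · exact hf.1.integrable_comp (hUm s)
    · refine (integrable_finsetSum _ fun a _ => ?_).1
      exact (hf.2 a).integrable_mul_comp (hUm s)
        (((hX1 a).const_mul _).sub ((hY1 a).const_mul _))
    · refine Filter.Eventually.of_forall fun ω x _ => ?_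
      refine (norm_sum_le _ _).trans (Finset.sum_le_sum fun a _ => ?_)
      rw [norm_mul]
      refine mul_le_mul ?_ (hpd _ _) (norm_nonneg _) (by positivity)
      refine (norm_sub_le _ _).trans (add_le_add ?_ ?_)
      · rw [norm_mul]
        exact mul_le_of_le_one_left (abs_nonneg _) (Real.abs_cos_le_one x)
      · rw [norm_mul]
        exact mul_le_of_le_one_left (abs_nonneg _) (Real.abs_sin_le_one x)
    · exact integrable_finsetSum _ fun a _ => ((hX1 a).abs.add (hY1 a).abs).mul_const _
    · exact Filter.Eventually.of_forall fun ω x _ => hder x ω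
  have hval : ∀ s, ∫ ω, D s ω ∂Q = Real.sin s * Real.cos s *
      ∑ a, ∑ b, ∫ ω, (S a b - S' a b) * pderiv b (pderiv a f) (U s ω) ∂Q := by
    intro s
    have hpI : ∀ a b, Integrable (fun ω => pderiv b (pderiv a f) (U s ω)) Q := fun a b =>
      (hf.2 a).integrable_fderiv_comp (hUm s) _
    have eX : ∀ a, ∫ ω, X ω.1 a * pderiv a f (U s ω) ∂Q
        = Real.sin s * ∑ b, S a b * ∫ ω, pderiv b (pderiv a f) (U s ω) ∂Q := fun a =>
      hX.ibp_prod (hY.meas.const_smul (Real.cos s)) (Real.sin s) (hf.2 a) a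
    have eY : ∀ a, ∫ ω, Y ω.2 a * pderiv a f (U s ω) ∂Q
        = Real.cos s * ∑ b, S' a b * ∫ ω, pderiv b (pderiv a f) (U s ω) ∂Q := by
      intro a
      have hU : ∀ ω : Ω' × Ω, (fun c => Real.cos s * Y ω.1 c + Real.sin s * X ω.2 c)
          = U s ω.swap := by
        intro ω; ext c; simp [U, add_comm]
      have h1 : ∫ ω : Ω' × Ω, Y ω.1 a * pderiv a f
            (fun c => Real.cos s * Y ω.1 c + Real.sin s * X ω.2 c) ∂(P'.prod P)
          = Real.cos s * ∑ b, S' a b * ∫ ω : Ω' × Ω, pderiv b (pderiv a f)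
            (fun c => Real.cos s * Y ω.1 c + Real.sin s * X ω.2 c) ∂(P'.prod P) :=
        hY.ibp_prod (P' := P) (hX.meas.const_smul (Real.sin s)) (Real.cos s) (hf.2 a) a
      simp_rw [hU] at h1
      have hs : ∀ g : Ω × Ω' → ℝ, ∫ ω, g ω.swap ∂(P'.prod P) = ∫ ω, g ω ∂Q := fun g =>
        integral_prod_swap g
      have h2 := hs fun ω => Y ω.2 a * pderiv a f (U s ω)
      have h3 := fun b => hs fun ω => pderiv b (pderiv a f) (U s ω)
      simp_rw [h3] at h1
      exact h2.symm.trans h1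
    have iX : ∀ a, Integrable (fun ω => X ω.1 a * pderiv a f (U s ω)) Q := fun a =>
      (hf.2 a).integrable_mul_comp (hUm s) (hX1 a)
    have iY : ∀ a, Integrable (fun ω => Y ω.2 a * pderiv a f (U s ω)) Q := fun a =>
      (hf.2 a).integrable_mul_comp (hUm s) (hY1 a)
    have hD : ∀ ω, D s ω = ∑ a, (Real.cos s * (X ω.1 a * pderiv a f (U s ω))
        - Real.sin s * (Y ω.2 a * pderiv a f (U s ω))) := by
      intro ω
      exact Finset.sum_congr rfl fun a _ => by ring
    have iD : ∀ a ∈ Finset.univ, Integrable (fun ω =>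
        Real.cos s * (X ω.1 a * pderiv a f (U s ω))
          - Real.sin s * (Y ω.2 a * pderiv a f (U s ω))) Q :=
      fun a _ => ((iX a).const_mul _).sub ((iY a).const_mul _)
    simp_rw [hD]
    rw [integral_finsetSum _ iD, Finset.mul_sum]
    refine Finset.sum_congr rfl fun a _ => ?_
    rw [integral_sub ((iX a).const_mul _) ((iY a).const_mul _), integral_const_mul,
      integral_const_mul, eX, eY, Finset.mul_sum, Finset.mul_sum, Finset.mul_sum, Finset.mul_sum,
      Finset.mul_sum, ← Finset.sum_sub_distrib]
    refine Finset.sum_congr rfl fun b _ => ?_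
    rw [integral_const_mul]
    ring
  have hmono : MonotoneOn (fun s => ∫ ω, f (U s ω) ∂Q) (Set.Icc 0 (Real.pi / 2)) := by
    refine monotoneOn_of_deriv_nonneg (convex_Icc _ _)
      (fun s _ => (hG s).continuousAt.continuousWithinAt)
      (fun s _ => (hG s).differentiableAt.differentiableWithinAt) fun s hs => ?_
    rw [interior_Icc] at hs
    rw [(hG s).deriv, hval]
    refine mul_nonneg (mul_nonneg ?_ ?_) (Finset.sum_nonneg fun a _ =>
      Finset.sum_nonneg fun b _ => integral_nonneg fun ω => hS a b _)
    · exact Real.sin_nonneg_of_nonneg_of_le_pi hs.1.le (by linarith [hs.2, Real.pi_pos])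
    · exact Real.cos_nonneg_of_mem_Icc ⟨by linarith [hs.1, Real.pi_pos], hs.2.le⟩
  have := hmono ⟨le_rfl, by positivity⟩ ⟨by positivity, le_rfl⟩ (by positivity)
  simp only [U, Real.sin_zero, Real.cos_zero, Real.sin_pi_div_two, Real.cos_pi_div_two, zero_mul,
    one_mul, zero_add, add_zero] at this
  have e1 : ∫ ω : Ω × Ω', f (fun a => Y ω.2 a) ∂Q = ∫ ω, f (Y ω) ∂P' := by
    have := integral_fun_snd (μ := P) (ν := P') (fun ω => f (Y ω))
    simpa using this
  have e2 : ∫ ω : Ω × Ω', f (fun a => X ω.1 a) ∂Q = ∫ ω, f (X ω) ∂P := by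
    have := integral_fun_fst (μ := P) (ν := P') (fun ω => f (X ω))
    simpa using this
  rwa [e1, e2] at this

end

lemma BddC1.of_contDiff_real {h : ℝ → ℝ} (hh : ContDiff ℝ 1 h) {C C' : ℝ} (h0 : ∀ x, |h x| ≤ C)
    (h1 : ∀ x, |deriv h x| ≤ C') : BddC1 h := by
  refine ⟨hh, max C C', fun x => ⟨(h0 x).trans (le_max_left _ _), ?_⟩⟩
  rw [← norm_deriv_eq_norm_fderiv]
  exact (h1 x).trans (le_max_right _ _)

lemma bddC1_smoothTransition : BddC1 Real.smoothTransition ∧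
    BddC1 (deriv Real.smoothTransition) := by
  have hc : ContDiff ℝ (2 + 1) Real.smoothTransition := Real.smoothTransition.contDiff
  have hd : ContDiff ℝ 2 (deriv Real.smoothTransition) := by
    have := (contDiff_succ_iff_deriv (n := 2)).1 hc
    exact this.2.2
  have hd2 : Continuous (deriv (deriv Real.smoothTransition)) :=
    ContDiff.continuous_deriv hd (by norm_num)
  have hs : HasCompactSupport (deriv Real.smoothTransition) := by
    refine HasCompactSupport.intro (isCompact_Icc (a := (0 : ℝ)) (b := 1)) fun x hx => ?_
    rw [Set.mem_Icc, not_and_or, not_le, not_le] at hx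
    rcases hx with hx | hx
    · have : Real.smoothTransition =ᶠ[nhds x] fun _ => 0 := by
        filter_upwards [eventually_lt_nhds hx] with y hy
        exact Real.smoothTransition.zero_of_nonpos hy.le
      rw [this.deriv_eq]; simp
    · have : Real.smoothTransition =ᶠ[nhds x] fun _ => 1 := by
        filter_upwards [eventually_gt_nhds hx] with y hy
        exact Real.smoothTransition.one_of_one_le hy.le
      rw [this.deriv_eq]; simp
  obtain ⟨C1, h1⟩ := hs.exists_bound_of_continuous hd.continuous
  obtain ⟨C2, h2⟩ := hs.deriv.exists_bound_of_continuous hd2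
  have h0 : ∀ x, |Real.smoothTransition x| ≤ 1 := fun x => by
    rw [abs_of_nonneg (Real.smoothTransition.nonneg x)]
    exact Real.smoothTransition.le_one x
  exact ⟨.of_contDiff_real (hc.of_le (by norm_num)) h0 h1,
    .of_contDiff_real (hd.of_le (by norm_num)) h1 h2⟩

section
variable {A : Type*} [Fintype A] [DecidableEq A]

/-- A smooth version of the indicator of `x a ≤ t`. -/
def cutoff (t η : ℝ) (a : A) (x : A → ℝ) : ℝ := Real.smoothTransition ((t + η - x a) / η)

lemma bddC2_cutoff (t η : ℝ) (a : A) : BddC2 (cutoff t η a) := by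
  let L : (A → ℝ) →L[ℝ] ℝ := (-η⁻¹) • ContinuousLinearMap.proj (R := ℝ) (φ := fun _ : A => ℝ) a
  have he : cutoff t η a = fun x => Real.smoothTransition (L x + (t + η) / η) := by
    ext x
    simp only [cutoff, L]
    congr 1
    simp only [smul_apply, ContinuousLinearMap.proj_apply, smul_eq_mul]
    ring
  have h1 := bddC1_smoothTransition.1.comp_affine L ((t + η) / η)
  have h2 := bddC1_smoothTransition.2.comp_affine L ((t + η) / η)
  refine ⟨he ▸ h1.1, fun b => ?_⟩
  have : pderiv b (cutoff t η a)
      = fun x => deriv Real.smoothTransition (L x + (t + η) / η) * L (Pi.single b 1) := by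
    ext x
    rw [he]
    unfold pderiv
    rw [h1.2, fderiv_eq_smul_deriv, smul_eq_mul, mul_comm]
  rw [this]
  exact h2.1.mul (BddC1.const _)

end

lemma cutoff_mem {A : Type*} (t η : ℝ) (a : A) (x : A → ℝ) : 0 ≤ cutoff t η a x ∧ cutoff t η a x ≤ 1 :=
  ⟨Real.smoothTransition.nonneg _, Real.smoothTransition.le_one _⟩

lemma cutoff_eq_one {t η : ℝ} (hη : 0 < η) {A : Type*} {a : A} {x : A → ℝ} (h : x a ≤ t) :
    cutoff t η a x = 1 := by
  refine Real.smoothTransition.one_of_one_le ?_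
  rw [le_div_iff₀ hη]; linarith

lemma cutoff_eq_zero {t η : ℝ} (hη : 0 < η) {A : Type*} {a : A} {x : A → ℝ} (h : t + η ≤ x a) :
    cutoff t η a x = 0 := by
  refine Real.smoothTransition.zero_of_nonpos ?_
  exact div_nonpos_of_nonpos_of_nonneg (by linarith) hη.le

lemma cutoff_anti {t η : ℝ} (hη : 0 < η) {A : Type*} {a : A} {x y : A → ℝ} (h : x a ≤ y a) :
    cutoff t η a y ≤ cutoff t η a x := by
  refine Real.smoothTransition.monotone ?_
  gcongr

/-- Gordon's comparison inequality, in a form with a symmetrizing Gaussian. -/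
theorem gordon_half {I J Ω Ω' : Type*} [Fintype I] [DecidableEq I] [Fintype J] [DecidableEq J]
    [MeasurableSpace Ω] [MeasurableSpace Ω'] {P : Measure Ω}
    {P' : Measure Ω'} [IsProbabilityMeasure P] [IsProbabilityMeasure P'] {X : Ω → I × J → ℝ}
    {Y : Ω' → I × J → ℝ} {S S' : I × J → I × J → ℝ} (hX : SteinVec P X S) (hY : SteinVec P' Y S')
    (v : I × J → ℝ) (hv : ∀ a, 0 ≤ v a)
    (h1 : ∀ a b, S' a b ≤ S a b + v a * v b)
    (h2 : ∀ i j l, S (i, j) (i, l) + v (i, j) * v (i, l) = S' (i, j) (i, l))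
    (t : I × J → ℝ) {η : ℝ} (hη : 0 < η) :
    P {ω | ∃ i, ∀ j, X ω (i, j) ≤ t (i, j)}
      ≤ 2 * P' {ω | ∃ i, ∀ j, Y ω (i, j) < t (i, j) + η} := by
  classical
  let ψ : I × J → (I × J → ℝ) → ℝ := fun a => cutoff (t a) η a
  let u : I → (I × J → ℝ) → ℝ := fun i x => 1 - ∏ j, ψ (i, j) x
  let f : (I × J → ℝ) → ℝ := fun x => ∏ i, u i x
  have hψ : ∀ a x, 0 ≤ ψ a x ∧ ψ a x ≤ 1 := fun a x => cutoff_mem _ _ _ _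
  have hpm : ∀ i x, 0 ≤ ∏ j, ψ (i, j) x ∧ ∏ j, ψ (i, j) x ≤ 1 := fun i x =>
    ⟨Finset.prod_nonneg fun j _ => (hψ _ _).1,
      Finset.prod_le_one (fun j _ => (hψ _ _).1) fun j _ => (hψ _ _).2⟩
  have hu : ∀ i x, 0 ≤ u i x ∧ u i x ≤ 1 := fun i x => by
    have := hpm i x
    exact ⟨by simp only [u]; linarith, by simp only [u]; linarith⟩
  have hu2 : ∀ i, BddC2 (u i) := by
    intro i
    have := (BddC2.const (A := I × J) 1).add ((BddC2.const (A := I × J) (-1)).mul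
      (BddC2.prod Finset.univ fun j => bddC2_cutoff (t (i, j)) η (i, j)))
    convert this using 2
    simp only [u, ψ]; ring
  have hf : BddC2 f := BddC2.prod _ hu2
  have hf01 : ∀ x, 0 ≤ f x ∧ f x ≤ 1 := fun x =>
    ⟨Finset.prod_nonneg fun i _ => (hu i x).1,
      Finset.prod_le_one (fun i _ => (hu i x).1) fun i _ => (hu i x).2⟩
  have hmono : ∀ i (x y : I × J → ℝ), (∀ j, x (i, j) ≤ y (i, j)) → u i x ≤ u i y := by
    intro i x y h
    have : ∏ j, ψ (i, j) y ≤ ∏ j, ψ (i, j) x :=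
      Finset.prod_le_prod (fun j _ => (hψ _ _).1) fun j _ => cutoff_anti hη (h j)
    simp only [u]; linarith
  have hadd : ∀ (x : I × J → ℝ) (s : ℝ) (b : I × J) (i : I), 0 ≤ s →
      u i x ≤ u i (x + s • Pi.single b 1) := by
    intro x s b i hs
    refine hmono i _ _ fun j => ?_
    have : (0 : ℝ) ≤ (Pi.single b 1 : I × J → ℝ) (i, j) := by
      rw [Pi.single_apply]; split_ifs <;> norm_num
    simp only [Pi.add_apply, Pi.smul_apply, smul_eq_mul]
    nlinarith
  have heq : ∀ (x : I × J → ℝ) (s : ℝ) (b : I × J) (i : I), i ≠ b.1 →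
      u i (x + s • Pi.single b 1) = u i x := by
    intro x s b i hi
    have : ∀ j, (x + s • Pi.single b 1 : I × J → ℝ) (i, j) = x (i, j) := by
      intro j
      have : (i, j) ≠ b := fun h => hi (by rw [← h])
      simp [this]
    exact le_antisymm (hmono _ _ _ fun j => (this j).le) (hmono _ _ _ fun j => (this j).ge)
  have hmix : ∀ a b : I × J, a.1 ≠ b.1 → ∀ x, 0 ≤ pderiv b (pderiv a f) x := by
    intro a b hab
    refine pderiv_pderiv_nonneg hf a b fun x s r hs hr => ?_
    have hsplit : ∀ y, f y = u a.1 y * (u b.1 y * ∏ i ∈ (Finset.univ.erase a.1).erase b.1, u i y) := by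
      intro y
      rw [Finset.mul_prod_erase _ (fun i => u i y) (by simp [hab.symm]),
        Finset.mul_prod_erase _ (fun i => u i y) (by simp)]
    have hR : ∀ y z, (∀ i, i ≠ a.1 → i ≠ b.1 → u i y = u i z) →
        ∏ i ∈ (Finset.univ.erase a.1).erase b.1, u i y
          = ∏ i ∈ (Finset.univ.erase a.1).erase b.1, u i z := by
      intro y z h
      refine Finset.prod_congr rfl fun i hi => h i ?_ ?_
      · exact (Finset.mem_erase.1 (Finset.mem_erase.1 hi).2).1
      · exact (Finset.mem_erase.1 hi).1
    have r1 := hR (x + s • Pi.single b 1) x fun i _ hi => heq _ _ _ _ hi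
    have r2 := hR (x + r • Pi.single a 1) x fun i hi _ => heq _ _ _ _ hi
    have r3 := hR (x + s • Pi.single b 1 + r • Pi.single a 1) x fun i hi hi' => by
      rw [heq _ _ _ _ hi, heq _ _ _ _ hi']
    rw [hsplit, hsplit, hsplit, hsplit, r1, r2, r3, heq x s b a.1 hab, heq x r a b.1 hab.symm,
      heq _ r a b.1 hab.symm]
    have e : u a.1 (x + s • Pi.single b 1 + r • Pi.single a 1) = u a.1 (x + r • Pi.single a 1) := by
      rw [add_right_comm, heq _ s b a.1 hab]
    rw [e]
    have k1 := hadd x r a a.1 hr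
    have k2 := hadd x s b b.1 hs
    have k3 : 0 ≤ ∏ i ∈ (Finset.univ.erase a.1).erase b.1, u i x :=
      Finset.prod_nonneg fun i _ => (hu i x).1
    nlinarith [mul_nonneg (mul_nonneg (sub_nonneg.2 k1) (sub_nonneg.2 k2)) k3]
  have hX' := hX.add_prod (steinVec_gaussianReal one_ne_zero v)
  have key := hX'.integral_le hY hf fun a b x => by
    by_cases hab : a.1 = b.1
    · obtain ⟨i, j⟩ := a
      obtain ⟨i', l⟩ := b
      obtain rfl : i = i' := hab
      have := h2 i j l
      rw [show S (i, j) (i, l) + ((1 : ℝ≥0) : ℝ) * (v (i, j) * v (i, l)) - S' (i, j) (i, l) = 0 by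
        push_cast; linarith]
      simp
    · refine mul_nonneg ?_ (hmix a b hab x)
      have := h1 a b
      push_cast
      linarith
  set Q := P.prod (gaussianReal 0 1)
  have hm := hX'.meas
  set X' : Ω × ℝ → I × J → ℝ := fun ω a => X ω.1 a + ω.2 * v a
  have mX' : MeasurableSet {ω | ∃ i, ∀ j, X' ω (i, j) ≤ t (i, j)} := by
    have : {ω | ∃ i, ∀ j, X' ω (i, j) ≤ t (i, j)} = ⋃ i, ⋂ j, {ω | X' ω (i, j) ≤ t (i, j)} := by
      ext; simp
    rw [this]
    exact MeasurableSet.iUnion fun i => MeasurableSet.iInter fun j =>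
      measurableSet_le ((measurable_pi_apply _).comp hm) measurable_const
  have mY : MeasurableSet {ω | ∃ i, ∀ j, Y ω (i, j) < t (i, j) + η} := by
    have : {ω | ∃ i, ∀ j, Y ω (i, j) < t (i, j) + η}
        = ⋃ i, ⋂ j, {ω | Y ω (i, j) < t (i, j) + η} := by
      ext; simp
    rw [this]
    exact MeasurableSet.iUnion fun i => MeasurableSet.iInter fun j =>
      measurableSet_lt ((measurable_pi_apply _).comp hY.meas) measurable_const
  have b1 : Q.real {ω | ∃ i, ∀ j, X' ω (i, j) ≤ t (i, j)} ≤ ∫ ω, (1 - f (X' ω)) ∂Q := by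
    rw [← integral_indicator_one mX']
    refine integral_mono ((integrable_const _).indicator mX')
      ((integrable_const _).sub (hf.1.integrable_comp hm)) fun ω => ?_
    by_cases hω : ω ∈ {ω | ∃ i, ∀ j, X' ω (i, j) ≤ t (i, j)}
    · rw [Set.indicator_of_mem hω]
      obtain ⟨i, hi⟩ := hω
      have : f (X' ω) = 0 := by
        refine Finset.prod_eq_zero (Finset.mem_univ i) ?_
        have : ∏ j, ψ (i, j) (X' ω) = 1 :=
          Finset.prod_eq_one fun j _ => cutoff_eq_one hη (hi j)
        simp only [u, this]; ring
      simp [this]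
    · rw [Set.indicator_of_notMem hω]
      have := (hf01 (X' ω)).2
      simp only; linarith
  have b2 : ∫ ω, (1 - f (Y ω)) ∂P' ≤ P'.real {ω | ∃ i, ∀ j, Y ω (i, j) < t (i, j) + η} := by
    rw [← integral_indicator_one mY]
    refine integral_mono ((integrable_const _).sub (hf.1.integrable_comp hY.meas))
      ((integrable_const _).indicator mY) fun ω => ?_
    by_cases hω : ω ∈ {ω | ∃ i, ∀ j, Y ω (i, j) < t (i, j) + η}
    · rw [Set.indicator_of_mem hω]
      have := (hf01 (Y ω)).1
      simp only [Pi.one_apply]; linarith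
    · rw [Set.indicator_of_notMem hω]
      have : f (Y ω) = 1 := by
        refine Finset.prod_eq_one fun i _ => ?_
        simp only [Set.mem_ofPred_eq, not_exists, not_forall, not_lt] at hω
        obtain ⟨j, hj⟩ := hω i
        have : ∏ j, ψ (i, j) (Y ω) = 0 :=
          Finset.prod_eq_zero (Finset.mem_univ j) (cutoff_eq_zero hη hj)
        simp only [u, this]; ring
      simp [this]
  have b3 : ∫ ω, (1 - f (X' ω)) ∂Q ≤ ∫ ω, (1 - f (Y ω)) ∂P' := by
    rw [integral_sub (integrable_const _) (hf.1.integrable_comp hm),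
      integral_sub (integrable_const _) (hf.1.integrable_comp hY.meas)]
    simp only [integral_const, probReal_univ, smul_eq_mul, one_mul]
    linarith
  have b4 : Q {ω | ∃ i, ∀ j, X' ω (i, j) ≤ t (i, j)}
      ≤ P' {ω | ∃ i, ∀ j, Y ω (i, j) < t (i, j) + η} := by
    rw [← ENNReal.toReal_le_toReal (measure_ne_top _ _) (measure_ne_top _ _)]
    exact b1.trans (b3.trans b2)
  have hhalf : (1 / 2 : ℝ≥0∞) ≤ gaussianReal 0 1 (Set.Iic 0) := by
    have hsym : gaussianReal 0 1 (Set.Ici 0) = gaussianReal 0 1 (Set.Iic 0) := by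
      have h := gaussianReal_map_neg (μ := 0) (v := 1)
      rw [neg_zero] at h
      conv_lhs => rw [← h]
      rw [Measure.map_apply measurable_neg measurableSet_Ici]
      congr 1; ext; simp
    have hc : (1 : ℝ≥0∞) ≤ gaussianReal 0 1 (Set.Iic 0) + gaussianReal 0 1 (Set.Iic 0) := by
      nth_rewrite 2 [← hsym]
      rw [← measure_univ (μ := gaussianReal 0 1), ← Set.Iic_union_Ici (a := (0 : ℝ))]
      exact measure_union_le _ _
    rw [← two_mul] at hc
    rw [ENNReal.div_le_iff (by norm_num) (by norm_num), mul_comm]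
    exact hc
  have b5 : P {ω | ∃ i, ∀ j, X ω (i, j) ≤ t (i, j)} * (1 / 2)
      ≤ Q {ω | ∃ i, ∀ j, X' ω (i, j) ≤ t (i, j)} := by
    refine (mul_le_mul_right hhalf _).trans ?_
    rw [← Measure.prod_prod]
    refine measure_mono fun ω hω => ?_
    obtain ⟨⟨i, hi⟩, h0⟩ := hω
    refine ⟨i, fun j => ?_⟩
    have h0 : ω.2 ≤ 0 := h0
    have := hi j
    have := hv (i, j)
    simp only [X']
    nlinarith
  have := b5.trans b4
  rw [mul_one_div, ENNReal.div_le_iff (by norm_num) (by norm_num), mul_comm] at this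
  exact this

/-- Euclidean norm of a coordinate vector. -/
def enorm2 {m : ℕ} (u : Fin m → ℝ) : ℝ := √(∑ i, u i ^ 2)

lemma enorm2_nonneg {m : ℕ} (u : Fin m → ℝ) : 0 ≤ enorm2 u := Real.sqrt_nonneg _

lemma enorm2_sq {m : ℕ} (u : Fin m → ℝ) : enorm2 u ^ 2 = ∑ i, u i ^ 2 :=
  Real.sq_sqrt (Finset.sum_nonneg fun _ _ => sq_nonneg _)

lemma sum_mul_le_enorm2 {m : ℕ} (u v : Fin m → ℝ) : ∑ i, u i * v i ≤ enorm2 u * enorm2 v :=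
  Real.sum_mul_le_sqrt_mul_sqrt _ _ _

/-- Effective noise level. -/
def effNoise (σ : ℝ) (n : ℕ) {N : ℕ} (w : Fin N → ℝ) : ℝ := √(σ ^ 2 + (∑ j, w j ^ 2) / n)

lemma effNoise_sq (σ : ℝ) (n : ℕ) {N : ℕ} (w : Fin N → ℝ) :
    effNoise σ n w ^ 2 = σ ^ 2 + (∑ j, w j ^ 2) / n :=
  Real.sq_sqrt (by positivity)

lemma effNoise_nonneg (σ : ℝ) (n : ℕ) {N : ℕ} (w : Fin N → ℝ) : 0 ≤ effNoise σ n w :=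
  Real.sqrt_nonneg _

/-- Residual vector at `θ⋆ + w`. -/
def resid {n N : ℕ} (σ : ℝ) (ω : (Fin n → Fin N → ℝ) × (Fin n → ℝ)) (w : Fin N → ℝ) :
    Fin n → ℝ := fun i => σ * ω.2 i - ∑ j, ω.1 i j * w j

/-- Bilinear form of the primary optimization. -/
def primForm {n N : ℕ} (σ : ℝ) (ω : (Fin n → Fin N → ℝ) × (Fin n → ℝ)) (w : Fin N → ℝ)
    (u : Fin n → ℝ) : ℝ := ∑ i, u i * resid σ ω w i

/-- Gaussian process of the auxiliary optimization. -/
def auxForm {n N : ℕ} (σ : ℝ) (ω : (Fin n → ℝ) × (Fin N → ℝ) × ℝ) (w : Fin N → ℝ)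
    (u : Fin n → ℝ) : ℝ :=
  effNoise σ n w * (∑ i, ω.1 i * u i) + enorm2 u * (σ * ω.2.2 - (∑ j, ω.2.1 j * w j) / √n)

/-- Law of the Gaussians of the auxiliary optimization. -/
def Paux (n N : ℕ) : Measure ((Fin n → ℝ) × (Fin N → ℝ) × ℝ) :=
  (Pz n).prod ((Pz N).prod stdG)

instance (n : ℕ) : IsProbabilityMeasure (Pz n) := by unfold Pz; infer_instance
instance : IsProbabilityMeasure stdG := by unfold stdG; infer_instance
instance (n N : ℕ) : IsProbabilityMeasure (PX n N) := by unfold PX; infer_instance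
instance (n N : ℕ) : IsProbabilityMeasure (Pmodel n N) := by unfold Pmodel; infer_instance
instance (n N : ℕ) : IsProbabilityMeasure (Paux n N) := by unfold Paux; infer_instance

section
variable {A : Type*} [Fintype A] [DecidableEq A] {n N : ℕ}

lemma SteinVec.congr {Ω : Type*} [MeasurableSpace Ω] {P : Measure Ω} {X Y : Ω → A → ℝ}
    {S S' : A → A → ℝ} (hX : SteinVec P X S) (h : ∀ ω a, X ω a = Y ω a)
    (h' : ∀ a b, S a b = S' a b) : SteinVec P Y S' := by
  obtain rfl : X = Y := funext fun ω => funext (h ω)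
  obtain rfl : S = S' := funext fun a => funext (h' a)
  exact hX

lemma steinVec_Pz (c : A → Fin n → ℝ) :
    SteinVec (Pz n) (fun z a => ∑ i, z i * c a i) (fun a b => ∑ i, c a i * c b i) :=
  (steinVec_pi _ _ _ fun i => steinVec_gaussianReal one_ne_zero fun a => c a i).congr
    (fun _ _ => rfl) (fun _ _ => by simp)

lemma steinVec_primForm (hn : n ≠ 0) (σ : ℝ) (w : A → Fin N → ℝ) (u : A → Fin n → ℝ) :
    SteinVec (Pmodel n N) (fun ω a => primForm σ ω (w a) (u a))
      (fun a b => (∑ i, u a i * u b i) * (σ ^ 2 + (∑ j, w a j * w b j) / n)) := by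
  have hn' : ((n : ℝ≥0))⁻¹ ≠ 0 := inv_ne_zero (by exact_mod_cast hn)
  have h1 : SteinVec (PX n N) (fun X a => ∑ i, ∑ j, X i j * (-(u a i * w a j)))
      (fun a b => ∑ i, ∑ j, ((n : ℝ≥0)⁻¹ : ℝ≥0) * (-(u a i * w a j) * -(u b i * w b j))) :=
    steinVec_pi _ _ _ fun i => steinVec_pi _ _ _ fun j =>
      steinVec_gaussianReal hn' fun a => -(u a i * w a j)
  refine (h1.add_prod (steinVec_Pz fun a i => σ * u a i)).congr (fun ω a => ?_) fun a b => ?_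
  · simp only [primForm, resid, mul_sub, Finset.mul_sum, ← Finset.sum_add_distrib,
      Finset.sum_sub_distrib]
    rw [← sub_eq_zero, ← Finset.sum_sub_distrib, ← Finset.sum_sub_distrib]
    refine Finset.sum_eq_zero fun i _ => ?_
    simp only [mul_neg, Finset.sum_neg_distrib]
    have : ∑ j, ω.1 i j * (u a i * w a j) = ∑ j, u a i * (ω.1 i j * w a j) :=
      Finset.sum_congr rfl fun j _ => by ring
    rw [this]; ring
  · rw [Finset.sum_mul, ← Finset.sum_add_distrib]
    refine Finset.sum_congr rfl fun i _ => ?_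
    have : ∑ j, (((n : ℝ≥0)⁻¹ : ℝ≥0) : ℝ) * (-(u a i * w a j) * -(u b i * w b j))
        = u a i * u b i * ((∑ j, w a j * w b j) / n) := by
      rw [Finset.sum_div, Finset.mul_sum]
      refine Finset.sum_congr rfl fun j _ => ?_
      push_cast
      ring
    rw [this]; ring

lemma steinVec_auxForm (σ : ℝ) (w : A → Fin N → ℝ) (u : A → Fin n → ℝ) :
    SteinVec (Paux n N) (fun ω a => auxForm σ ω (w a) (u a))
      (fun a b => effNoise σ n (w a) * effNoise σ n (w b) * (∑ i, u a i * u b i)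
        + enorm2 (u a) * enorm2 (u b) * (σ ^ 2 + (∑ j, w a j * w b j) / n)) := by
  have h1 := steinVec_Pz (n := n) fun a i => effNoise σ n (w a) * u a i
  have h2 := steinVec_Pz (n := N) fun a j => -(enorm2 (u a) * w a j / √n)
  have h3 := steinVec_gaussianReal one_ne_zero fun a => enorm2 (u a) * σ
  refine (h1.add_prod (h2.add_prod h3)).congr (fun ω a => ?_) fun a b => ?_
  · simp only [auxForm]
    have e1 : ∑ i, ω.1 i * (effNoise σ n (w a) * u a i)
        = effNoise σ n (w a) * ∑ i, ω.1 i * u a i := by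
      rw [Finset.mul_sum]; exact Finset.sum_congr rfl fun i _ => by ring
    have e2 : ∑ j, ω.2.1 j * -(enorm2 (u a) * w a j / √n)
        = -(enorm2 (u a) * ((∑ j, ω.2.1 j * w a j) / √n)) := by
      rw [Finset.sum_div, Finset.mul_sum, ← Finset.sum_neg_distrib]
      exact Finset.sum_congr rfl fun i _ => by ring
    rw [e1, e2]; ring
  · have e1 : ∑ i, effNoise σ n (w a) * u a i * (effNoise σ n (w b) * u b i)
        = effNoise σ n (w a) * effNoise σ n (w b) * ∑ i, u a i * u b i := by
      rw [Finset.mul_sum]; exact Finset.sum_congr rfl fun i _ => by ring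
    have e2 : ∑ j, -(enorm2 (u a) * w a j / √n) * -(enorm2 (u b) * w b j / √n)
        = enorm2 (u a) * enorm2 (u b) * ((∑ j, w a j * w b j) / n) := by
      rw [Finset.sum_div, Finset.mul_sum]
      refine Finset.sum_congr rfl fun i _ => ?_
      rw [neg_mul_neg, div_mul_div_comm, Real.mul_self_sqrt (Nat.cast_nonneg n)]
      ring
    rw [e1, e2]; push_cast; ring

end

lemma effNoise_mul_ge {n N : ℕ} (σ : ℝ) (w w' : Fin N → ℝ) :
    σ ^ 2 + (∑ j, w j * w' j) / n ≤ effNoise σ n w * effNoise σ n w' := by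
  rcases Nat.eq_zero_or_pos n with rfl | hn
  · have : effNoise σ 0 w * effNoise σ 0 w' = σ ^ 2 := by
      rw [effNoise, effNoise, Nat.cast_zero, div_zero, div_zero, add_zero,
        Real.mul_self_sqrt (sq_nonneg σ)]
    rw [this]; simp
  have hn' : (0 : ℝ) < n := by exact_mod_cast hn
  refine (le_abs_self _).trans (abs_le_of_sq_le_sq ?_
    (mul_nonneg (effNoise_nonneg _ _ _) (effNoise_nonneg _ _ _)))
  rw [mul_pow, effNoise_sq, effNoise_sq]
  have hcs : (∑ j, w j * w' j) ^ 2 ≤ (∑ j, w j ^ 2) * ∑ j, w' j ^ 2 :=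
    Finset.sum_mul_sq_le_sq_mul_sq _ _ _
  set a := ∑ j, w j ^ 2
  set b := ∑ j, w' j ^ 2
  set c := ∑ j, w j * w' j
  have ha : 0 ≤ a := Finset.sum_nonneg fun _ _ => sq_nonneg _
  have hb : 0 ≤ b := Finset.sum_nonneg fun _ _ => sq_nonneg _
  have h2 : 2 * c ≤ a + b := by
    have : 0 ≤ ∑ j, (w j - w' j) ^ 2 := Finset.sum_nonneg fun _ _ => sq_nonneg _
    simp only [sub_sq, Finset.sum_add_distrib, Finset.sum_sub_distrib, mul_assoc,
      ← Finset.mul_sum] at this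
    linarith
  have h3 : (c / n) ^ 2 ≤ (a / n) * (b / n) := by
    rw [div_pow, div_mul_div_comm, ← sq]; gcongr
  have h4 : 2 * (c / n) ≤ a / n + b / n := by
    rw [← add_div, ← mul_div_assoc]; gcongr
  nlinarith [mul_le_mul_of_nonneg_left h4 (sq_nonneg σ)]

lemma gordon_gap {n N : ℕ} (σ : ℝ) (w w' : Fin N → ℝ) (u u' : Fin n → ℝ) :
    effNoise σ n w * effNoise σ n w' * (∑ i, u i * u' i)
        + enorm2 u * enorm2 u' * (σ ^ 2 + (∑ j, w j * w' j) / n)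
      ≤ (∑ i, u i * u' i) * (σ ^ 2 + (∑ j, w j * w' j) / n)
        + (enorm2 u * effNoise σ n w) * (enorm2 u' * effNoise σ n w') := by
  nlinarith [mul_nonneg (sub_nonneg.2 (sum_mul_le_enorm2 u u'))
    (sub_nonneg.2 (effNoise_mul_ge (n := n) σ w w'))]

/-- Lower comparison of the primary process with the auxiliary one. -/
theorem primForm_le_auxForm {K L : Type*} [Fintype K] [Fintype L]
    {n N : ℕ} (hn : n ≠ 0) (σ : ℝ) (w : K → Fin N → ℝ) (u : L → Fin n → ℝ) (t : K → L → ℝ)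
    {η : ℝ} (hη : 0 < η) :
    Pmodel n N {ω | ∃ k, ∀ l, primForm σ ω (w k) (u l) ≤ t k l}
      ≤ 2 * Paux n N {ω | ∃ k, ∀ l, auxForm σ ω (w k) (u l) < t k l + η} := by
  classical
  refine gordon_half (steinVec_primForm hn σ (fun a : K × L => w a.1) fun a => u a.2)
    (steinVec_auxForm σ (fun a : K × L => w a.1) fun a => u a.2)
    (fun a => enorm2 (u a.2) * effNoise σ n (w a.1))
    (fun a => mul_nonneg (enorm2_nonneg _) (effNoise_nonneg _ _ _))
    (fun a b => gordon_gap σ _ _ _ _) (fun k l l' => ?_) (fun a => t a.1 a.2) hη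
  have := effNoise_sq σ n (w k)
  simp only [← sq, ← this]
  ring

/-- Upper comparison of the primary process with the auxiliary one. -/
theorem le_primForm_le_auxForm {K L : Type*} [Fintype K] [Fintype L]
    {n N : ℕ} (hn : n ≠ 0) (σ : ℝ) (w : K → Fin N → ℝ) (u : L → Fin n → ℝ) (t : K → L → ℝ)
    {η : ℝ} (hη : 0 < η) :
    Pmodel n N {ω | ∃ l, ∀ k, t k l ≤ primForm σ ω (w k) (u l)}
      ≤ 2 * Paux n N {ω | ∃ l, ∀ k, t k l - η < auxForm σ ω (w k) (u l)} := by
  classical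
  have := gordon_half (steinVec_primForm hn σ (fun a : L × K => w a.2) fun a => u a.1).neg
    (steinVec_auxForm σ (fun a : L × K => w a.2) fun a => u a.1).neg
    (fun a => enorm2 (u a.1) * effNoise σ n (w a.2))
    (fun a => mul_nonneg (enorm2_nonneg _) (effNoise_nonneg _ _ _))
    (fun a b => gordon_gap σ _ _ _ _) (fun l k k' => ?_) (fun a => -t a.2 a.1) hη
  · refine (measure_mono ?_).trans (this.trans (mul_le_mul_right (measure_mono ?_) _))
    · rintro ω ⟨l, hl⟩
      exact ⟨l, fun k => neg_le_neg (hl k)⟩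
    · rintro ω ⟨l, hl⟩
      refine ⟨l, fun k => ?_⟩
      have := hl k
      dsimp only at this
      linarith
  · have := enorm2_sq (u l)
    simp only [← sq, ← this]
    ring

/-- Penalized least-squares cost in the variable `w = θ - θ⋆`. -/
def primCost {n N : ℕ} (σ : ℝ) (ℓ : (Fin N → ℝ) → ℝ) (ω : (Fin n → Fin N → ℝ) × (Fin n → ℝ))
    (w : Fin N → ℝ) : ℝ := (∑ i, resid σ ω w i ^ 2) / (2 * n) + ℓ w

/-- The auxiliary functional. -/
def auxFun {n N : ℕ} (σ x : ℝ) (ω : (Fin n → ℝ) × (Fin N → ℝ) × ℝ) (w : Fin N → ℝ) : ℝ :=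
  x * (enorm2 ω.1 / √n) * effNoise σ n w + σ * ω.2.2 / √n - (∑ j, ω.2.1 j * w j) / n

lemma exists_sphere_net {n : ℕ} (hn : n ≠ 0) {x : ℝ} (hx : 0 < x) :
    ∃ T : Finset (Fin n → ℝ), (∀ u ∈ T, enorm2 u = 1) ∧
      ∀ h : Fin n → ℝ, ∃ u ∈ T, (1 - x) * enorm2 h ≤ ∑ i, h i * u i := by
  let S : Set (Fin n → ℝ) := {u | ∑ i, u i ^ 2 = 1}
  have hSc : IsCompact S := by
    refine (isCompact_Icc (a := fun _ => (-1 : ℝ)) (b := fun _ => 1)).of_isClosed_subset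
      (isClosed_eq (by fun_prop) continuous_const) fun u hu => ?_
    have : ∀ i, u i ^ 2 ≤ 1 := fun i => by
      rw [← show ∑ i, u i ^ 2 = 1 from hu]
      exact Finset.single_le_sum (f := fun i => u i ^ 2) (fun _ _ => sq_nonneg _)
        (Finset.mem_univ i)
    exact ⟨fun i => (abs_le.1 ((sq_le_one_iff_abs_le_one _).1 (this i))).1,
      fun i => (abs_le.1 ((sq_le_one_iff_abs_le_one _).1 (this i))).2⟩
  obtain ⟨T, hTS, hT⟩ := hSc.elim_nhds_subcover (fun v => {u | 1 - x < ∑ i, u i * v i})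
    fun v hv => by
      refine (isOpen_lt continuous_const (by fun_prop)).mem_nhds ?_
      have hv : ∑ i, v i ^ 2 = 1 := hv
      have : ∑ i, v i * v i = 1 := by simpa [← sq] using hv
      change 1 - x < ∑ i, v i * v i
      linarith
  have key : ∀ h : Fin n → ℝ, enorm2 h ≠ 0 →
      ∃ u ∈ T, (1 - x) * enorm2 h ≤ ∑ i, h i * u i := by
    intro h hh
    have hpos : 0 < enorm2 h := lt_of_le_of_ne (enorm2_nonneg h) (Ne.symm hh)
    have hS : (fun i => h i / enorm2 h) ∈ S := by
      change ∑ i, (h i / enorm2 h) ^ 2 = 1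
      simp only [div_pow, ← Finset.sum_div]
      rw [← enorm2_sq, div_self (by positivity)]
    obtain ⟨v, hv, h1⟩ := Set.mem_iUnion₂.1 (hT hS)
    refine ⟨v, hv, ?_⟩
    have h1 : 1 - x < ∑ i, h i / enorm2 h * v i := h1
    have : ∑ i, h i / enorm2 h * v i = (∑ i, h i * v i) / enorm2 h := by
      rw [Finset.sum_div]; exact Finset.sum_congr rfl fun i _ => by ring
    rw [this, lt_div_iff₀ hpos] at h1
    exact h1.le
  refine ⟨T, fun u hu => ?_, fun h => ?_⟩
  · rw [enorm2, show ∑ i, u i ^ 2 = 1 from hTS u hu, Real.sqrt_one]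
  · by_cases hh : enorm2 h = 0
    · have h1 : enorm2 (fun _ : Fin n => (1 : ℝ)) ≠ 0 := by
        simp [enorm2, hn]
      obtain ⟨v, hv, -⟩ := key _ h1
      refine ⟨v, hv, ?_⟩
      have h0 : ∑ i, h i ^ 2 = 0 := by rw [← enorm2_sq, hh]; norm_num
      have h2 : ∀ i, h i = 0 := fun i => by
        have := (Finset.sum_eq_zero_iff_of_nonneg fun i _ => sq_nonneg (h i)).1 h0 i
          (Finset.mem_univ i)
        simpa using this
      simp [hh, h2]
    · exact key h hh

lemma continuous_primCost {n N : ℕ} (σ : ℝ) {ℓ : (Fin N → ℝ) → ℝ} (hℓ : Continuous ℓ)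
    (ω : (Fin n → Fin N → ℝ) × (Fin n → ℝ)) : Continuous (primCost σ ℓ ω) := by
  unfold primCost resid; fun_prop

lemma continuous_effNoise {N : ℕ} (σ : ℝ) (n : ℕ) :
    Continuous (effNoise σ n : (Fin N → ℝ) → ℝ) := by
  unfold effNoise; fun_prop

lemma continuous_auxFun {n N : ℕ} (σ x : ℝ) (ω : (Fin n → ℝ) × (Fin N → ℝ) × ℝ) :
    Continuous (auxFun σ x ω) := by
  have := continuous_effNoise (N := N) σ n
  unfold auxFun; fun_prop

lemma continuous_auxFun_left {n N : ℕ} (σ x : ℝ) (w : Fin N → ℝ) :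
    Continuous fun ω : (Fin n → ℝ) × (Fin N → ℝ) × ℝ => auxFun σ x ω w := by
  unfold auxFun enorm2; fun_prop

lemma auxFun_mul_sqrt {n N : ℕ} (hn : n ≠ 0) (σ x : ℝ) (ω : (Fin n → ℝ) × (Fin N → ℝ) × ℝ)
    (w : Fin N → ℝ) : √n * auxFun σ x ω w
      = x * enorm2 ω.1 * effNoise σ n w + σ * ω.2.2 - (∑ j, ω.2.1 j * w j) / √n := by
  have hn' : (0 : ℝ) < n := by exact_mod_cast Nat.pos_of_ne_zero hn
  have hs : 0 < √(n : ℝ) := Real.sqrt_pos.2 hn'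
  have : (n : ℝ) = √n * √n := (Real.mul_self_sqrt hn'.le).symm
  unfold auxFun
  rw [show (∑ j, ω.2.1 j * w j) / (n : ℝ) = (∑ j, ω.2.1 j * w j) / (√n * √n) by rw [← this]]
  field_simp

/-- Small values of the primary cost on a set are controlled by the auxiliary functional. -/
theorem primCost_lt_le {n N : ℕ} (hn : n ≠ 0) (σ : ℝ) (B : Set (Fin N → ℝ))
    {ℓ : (Fin N → ℝ) → ℝ} (hℓ : Continuous ℓ) (L : ℝ) {x η : ℝ} (hx : 0 < x) (hη : 0 < η) :
    Pmodel n N {ω | ∃ w ∈ B, primCost σ ℓ ω w < L}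
      ≤ 2 * Paux n N {ω | ∃ w ∈ B, ℓ w ≤ L ∧ auxFun σ (1 - x) ω w ≤ √(2 * (L - ℓ w)) + η} := by
  classical
  have hn' : (0 : ℝ) < n := by exact_mod_cast Nat.pos_of_ne_zero hn
  have hs : 0 < √(n : ℝ) := Real.sqrt_pos.2 hn'
  rcases B.eq_empty_or_nonempty with rfl | hB
  · simp
  have : Nonempty B := hB.to_subtype
  let d : ℕ → B := TopologicalSpace.denseSeq B
  have hd : DenseRange d := TopologicalSpace.denseRange_denseSeq B
  obtain ⟨T, hT1, hT⟩ := exists_sphere_net hn hx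
  have hsub : {ω : (Fin n → Fin N → ℝ) × (Fin n → ℝ) | ∃ w ∈ B, primCost σ ℓ ω w < L}
      ⊆ ⋃ m : ℕ, {ω | ∃ k < m, primCost σ ℓ ω (d k) < L} := by
    rintro ω ⟨w, hw, hlt⟩
    have ho : IsOpen {b : B | primCost σ ℓ ω b < L} :=
      isOpen_lt ((continuous_primCost σ hℓ ω).comp continuous_subtype_val) continuous_const
    obtain ⟨k, hk⟩ := hd.exists_mem_open ho ⟨⟨w, hw⟩, hlt⟩
    exact Set.mem_iUnion.2 ⟨k + 1, k, Nat.lt_succ_self k, hk⟩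
  refine (measure_mono hsub).trans ?_
  rw [Monotone.measure_iUnion]
  swap
  · rintro m m' hm ω ⟨k, hk, h⟩
    exact ⟨k, hk.trans_le hm, h⟩
  refine iSup_le fun m => ?_
  let K := {k : Fin m // ℓ (d k) ≤ L}
  have h1 := primForm_le_auxForm hn σ (fun k : K => (d k.1 : Fin N → ℝ)) (fun u : T => u.1)
    (fun k _ => √n * √(2 * (L - ℓ (d k.1)))) (η := √n * η) (by positivity)
  refine (measure_mono ?_).trans (h1.trans (mul_le_mul_right (measure_mono ?_) _))
  · rintro ω ⟨k, hk, h⟩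
    have hnn : 0 ≤ (∑ i, resid σ ω (d k) i ^ 2) / (2 * n) := by positivity
    have h : (∑ i, resid σ ω (d k) i ^ 2) / (2 * n) + ℓ (d k) < L := h
    have hk' : ℓ (d k) ≤ L := by linarith
    refine ⟨⟨⟨k, hk⟩, hk'⟩, fun u => ?_⟩
    refine (sum_mul_le_enorm2 _ _).trans ?_
    rw [hT1 _ u.2, one_mul, ← Real.sqrt_mul hn'.le]
    refine Real.sqrt_le_sqrt ?_
    have h2 : (∑ i, resid σ ω (d k) i ^ 2) / (2 * n) < L - ℓ (d k) := by linarith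
    rw [div_lt_iff₀ (by positivity)] at h2
    dsimp only
    linarith
  · rintro ω ⟨k, hk⟩
    refine ⟨d k.1, (d k.1).2, k.2, ?_⟩
    obtain ⟨u, hu, h2⟩ := hT ω.1
    have h3 := hk ⟨u, hu⟩
    simp only [auxForm, hT1 u hu, one_mul] at h3
    have h4 := auxFun_mul_sqrt hn σ (1 - x) ω (d k.1)
    have h5 := mul_le_mul_of_nonneg_left h2 (effNoise_nonneg σ n (d k.1 : Fin N → ℝ))
    refine le_of_mul_le_mul_left ?_ hs
    rw [h4]
    linarith

lemma nonneg_of_add_mul {a b : ℝ} (h : ∀ t : ℝ, 0 < t → t ≤ 1 → 0 ≤ a + t * b) : 0 ≤ a := by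
  have h1 : Filter.Tendsto (fun t : ℝ => a + t * b) (nhdsWithin 0 (Set.Ioi 0)) (nhds (a + 0 * b)) :=
    ((continuous_const.add (continuous_id.mul continuous_const)).tendsto 0).mono_left
      nhdsWithin_le_nhds
  rw [zero_mul, add_zero] at h1
  refine ge_of_tendsto h1 ?_
  filter_upwards [Ioc_mem_nhdsGT (zero_lt_one' ℝ)] with t ht using h t ht.1 ht.2

/-- First-order optimality of a minimizer, tested against the residual. -/
lemma le_primForm_of_isMin {n N : ℕ} (hn : n ≠ 0) {σ : ℝ} {ℓ : (Fin N → ℝ) → ℝ}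
    (hconv : ConvexOn ℝ Set.univ ℓ) {ω : (Fin n → Fin N → ℝ) × (Fin n → ℝ)} {v : Fin N → ℝ}
    (hv : ∀ w, primCost σ ℓ ω v ≤ primCost σ ℓ ω w) (w : Fin N → ℝ) :
    n * (primCost σ ℓ ω v - ℓ w) + (∑ i, resid σ ω v i ^ 2) / 2
      ≤ primForm σ ω w (resid σ ω v) := by
  have hn' : (0 : ℝ) < n := by exact_mod_cast Nat.pos_of_ne_zero hn
  set r := resid σ ω v
  let b : Fin n → ℝ := fun i => resid σ ω w i - r i
  have hline : ∀ t : ℝ, ∀ i, resid σ ω (v + t • (w - v)) i = r i + t * b i := by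
    intro t i
    have : ∑ j, ω.1 i j * (v + t • (w - v)) j
        = ∑ j, ω.1 i j * v j + t * (∑ j, ω.1 i j * w j - ∑ j, ω.1 i j * v j) := by
      rw [← Finset.sum_sub_distrib, Finset.mul_sum, ← Finset.sum_add_distrib]
      refine Finset.sum_congr rfl fun j _ => ?_
      simp only [Pi.add_apply, Pi.smul_apply, Pi.sub_apply, smul_eq_mul]; ring
    simp only [b, r, resid, this]; ring
  have hF : primForm σ ω w r = ∑ i, r i ^ 2 + ∑ i, r i * b i := by
    rw [primForm, ← Finset.sum_add_distrib]
    exact Finset.sum_congr rfl fun i _ => by simp only [b]; ring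
  have key : 0 ≤ ((∑ i, r i * b i) + n * (ℓ w - ℓ v)) := by
    refine nonneg_of_add_mul (b := (∑ i, b i ^ 2) / 2) fun t ht ht1 => ?_
    have h1 := hv (v + t • (w - v))
    have h2 : ℓ (v + t • (w - v)) ≤ (1 - t) * ℓ v + t * ℓ w := by
      have := hconv.2 (Set.mem_univ v) (Set.mem_univ w) (by linarith : 0 ≤ 1 - t) ht.le (by ring)
      rw [show v + t • (w - v) = (1 - t) • v + t • w by rw [smul_sub, sub_smul, one_smul]; abel]
      exact this
    have h3 : ∑ i, resid σ ω (v + t • (w - v)) i ^ 2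
        = ∑ i, r i ^ 2 + 2 * t * (∑ i, r i * b i) + t ^ 2 * ∑ i, b i ^ 2 := by
      simp only [hline, Finset.mul_sum, ← Finset.sum_add_distrib]
      exact Finset.sum_congr rfl fun i _ => by ring
    simp only [primCost] at h1
    rw [h3] at h1
    have h4 : (∑ i, r i ^ 2) / (2 * n) + ℓ v ≤ (∑ i, r i ^ 2 + 2 * t * (∑ i, r i * b i)
        + t ^ 2 * ∑ i, b i ^ 2) / (2 * n) + ((1 - t) * ℓ v + t * ℓ w) := by linarith
    have h5 := mul_le_mul_of_nonneg_left h4 hn'.le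
    have e1 : ∀ y z : ℝ, (n : ℝ) * (y / (2 * n) + z) = y / 2 + n * z := by
      intro y z; field_simp
    rw [e1, e1] at h5
    nlinarith
  rw [hF]
  simp only [primCost]
  have : (n : ℝ) * ((∑ i, r i ^ 2) / (2 * n) + ℓ v - ℓ w) = (∑ i, r i ^ 2) / 2 + n * (ℓ v - ℓ w) := by
    field_simp
    ring
  rw [show resid σ ω v = r from rfl, this]
  linarith

/-- Large minimal values of the primary cost are controlled by the auxiliary functional. -/
theorem lt_primCost_le {n N : ℕ} (hn : n ≠ 0) (σ : ℝ)
    {ℓ : (Fin N → ℝ) → ℝ} (hℓ : Continuous ℓ) (hconv : ConvexOn ℝ Set.univ ℓ)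
    (hmin : ∀ ω : (Fin n → Fin N → ℝ) × (Fin n → ℝ), ∃ v, ∀ w,
      primCost σ ℓ ω v ≤ primCost σ ℓ ω w) (L : ℝ) {η : ℝ} (hη : 0 < η) :
    Pmodel n N {ω | ∀ w, L < primCost σ ℓ ω w}
      ≤ 2 * Paux n N {ω | ∀ w, L - η ≤ max (auxFun σ 1 ω w) 0 ^ 2 / 2 + ℓ w} := by
  have hn' : (0 : ℝ) < n := by exact_mod_cast Nat.pos_of_ne_zero hn
  have hs : 0 < √(n : ℝ) := Real.sqrt_pos.2 hn'
  let d : ℕ → Fin N → ℝ := TopologicalSpace.denseSeq _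
  have hd : DenseRange d := TopologicalSpace.denseRange_denseSeq _
  let e : ℕ → Fin n → ℝ := TopologicalSpace.denseSeq _
  have he : DenseRange e := TopologicalSpace.denseRange_denseSeq _
  let S : ℕ → Set ((Fin n → ℝ) × (Fin N → ℝ) × ℝ) := fun m =>
    {ω | ∀ k : Fin m, L - η ≤ max (auxFun σ 1 ω (d k)) 0 ^ 2 / 2 + ℓ (d k)}
  have hSm : ∀ m, MeasurableSet (S m) := by
    intro m
    have : S m = ⋂ k : Fin m, {ω | L - η ≤ max (auxFun σ 1 ω (d k)) 0 ^ 2 / 2 + ℓ (d k)} := by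
      ext; simp [S]
    rw [this]
    refine MeasurableSet.iInter fun k => (isClosed_le continuous_const ?_).measurableSet
    exact ((((continuous_auxFun_left σ 1 (d k)).max continuous_const).pow 2).div_const 2).add
      continuous_const
  have hbound : ∀ m, Pmodel n N {ω | ∀ w, L < primCost σ ℓ ω w} ≤ 2 * Paux n N (S m) := by
    intro m
    have hsub : {ω : (Fin n → Fin N → ℝ) × (Fin n → ℝ) | ∀ w, L < primCost σ ℓ ω w}
        ⊆ ⋃ M : ℕ, {ω | ∃ l : Fin M, ∀ k : Fin m,
          n * (L - ℓ (d k)) + (∑ i, e l i ^ 2) / 2 ≤ primForm σ ω (d k) (e l)} := by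
      intro ω hω
      obtain ⟨v, hv⟩ := hmin ω
      have ho : IsOpen {u : Fin n → ℝ | ∀ k : Fin m,
          n * (L - ℓ (d k)) + (∑ i, u i ^ 2) / 2 < primForm σ ω (d k) u} := by
        have : {u : Fin n → ℝ | ∀ k : Fin m,
            n * (L - ℓ (d k)) + (∑ i, u i ^ 2) / 2 < primForm σ ω (d k) u} = ⋂ k : Fin m,
            {u | n * (L - ℓ (d k)) + (∑ i, u i ^ 2) / 2 < primForm σ ω (d k) u} := by
          ext; simp
        rw [this]
        refine isOpen_iInter_of_finite fun k => isOpen_lt (by fun_prop) ?_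
        unfold primForm; fun_prop
      obtain ⟨l, hl⟩ := he.exists_mem_open ho ⟨resid σ ω v, fun k => by
        have h1 := le_primForm_of_isMin hn hconv hv (d k)
        have h2 := mul_lt_mul_of_pos_left (sub_lt_sub_right (hω v) (ℓ (d k))) hn'
        linarith⟩
      exact Set.mem_iUnion.2 ⟨l + 1, ⟨l, Nat.lt_succ_self l⟩, fun k => (hl k).le⟩
    refine (measure_mono hsub).trans ?_
    rw [Monotone.measure_iUnion]
    swap
    · rintro M M' hM ω ⟨l, h⟩
      exact ⟨⟨l, l.2.trans_le hM⟩, h⟩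
    refine iSup_le fun M => ?_
    have h1 := le_primForm_le_auxForm hn σ (fun k : Fin m => d k) (fun l : Fin M => e l)
      (fun k l => n * (L - ℓ (d k)) + (∑ i, e l i ^ 2) / 2) (η := n * η) (by positivity)
    refine h1.trans (mul_le_mul_right (measure_mono ?_) _)
    rintro ω ⟨l, hl⟩ k
    have h2 := hl k
    have h3 := auxFun_mul_sqrt hn σ 1 ω (d k)
    set a := auxFun σ 1 ω (d k)
    have h4 : auxForm σ ω (d k) (e l) ≤ enorm2 (e l) * (√n * a) := by
      rw [h3, auxForm]
      have h5 := sum_mul_le_enorm2 ω.1 (e l)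
      have := mul_le_mul_of_nonneg_left h5 (effNoise_nonneg σ n (d k))
      linarith
    rw [← enorm2_sq] at h2
    set q := enorm2 (e l)
    have hq : 0 ≤ q := enorm2_nonneg _
    have h6 : q * (√n * a) ≤ q * (√n * max a 0) := by
      gcongr; exact le_max_left _ _
    have h7 : q * (√n * max a 0) ≤ q ^ 2 / 2 + n * (max a 0 ^ 2 / 2) := by
      have := sq_nonneg (q - √n * max a 0)
      have h8 : √(n : ℝ) ^ 2 = n := Real.sq_sqrt hn'.le
      nlinarith
    have h9 : (n : ℝ) * (L - η) ≤ n * (max a 0 ^ 2 / 2 + ℓ (d k)) := by nlinarith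
    exact le_of_mul_le_mul_left h9 hn'
  have hlim : Filter.Tendsto (fun m => 2 * Paux n N (S m)) Filter.atTop
      (nhds (2 * Paux n N (⋂ m, S m))) := by
    refine ENNReal.Tendsto.const_mul ?_ (Or.inr (by norm_num))
    refine tendsto_measure_iInter_atTop (fun m => (hSm m).nullMeasurableSet) ?_
      ⟨0, measure_ne_top _ _⟩
    intro m m' hm ω hω k
    exact hω ⟨k, k.2.trans_le hm⟩
  refine (ge_of_tendsto' hlim hbound).trans (mul_le_mul_right (measure_mono fun ω hω w => ?_) _)
  have hcl : IsClosed {w : Fin N → ℝ | L - η ≤ max (auxFun σ 1 ω w) 0 ^ 2 / 2 + ℓ w} := by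
    refine isClosed_le continuous_const ?_
    exact ((((continuous_auxFun σ 1 ω).max continuous_const).pow 2).div_const 2).add hℓ
  have hall : ∀ k, d k ∈ {w : Fin N → ℝ | L - η ≤ max (auxFun σ 1 ω w) 0 ^ 2 / 2 + ℓ w} := by
    intro k
    have := Set.mem_iInter.1 hω (k + 1)
    exact this ⟨k, Nat.lt_succ_self k⟩
  exact hd.induction_on (p := fun w => L - η ≤ max (auxFun σ 1 ω w) 0 ^ 2 / 2 + ℓ w) w hcl hall

lemma exp_le_one_add_add_sq_mul_exp_abs (x : ℝ) :
    Real.exp x ≤ 1 + x + x ^ 2 * Real.exp |x| := by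
  rcases le_or_gt |x| 1 with h | h
  · have h1 := (abs_le.1 (Real.abs_exp_sub_one_sub_id_le h)).2
    have h2 : 1 ≤ Real.exp |x| := Real.one_le_exp (abs_nonneg x)
    nlinarith [sq_nonneg x]
  · have h3 : 1 ≤ x ^ 2 := by rw [← sq_abs]; nlinarith
    rcases le_total 0 x with h0 | h0
    · rw [abs_of_nonneg h0]
      nlinarith [Real.exp_pos x]
    · rw [abs_of_nonpos h0] at *
      have h4 : Real.exp x ≤ 1 := Real.exp_le_one_iff.2 h0
      have h5 : 1 ≤ Real.exp (-x) := Real.one_le_exp (by linarith)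
      nlinarith

lemma integral_exp_sq_div_four_stdG : ∫ x, Real.exp (x ^ 2 / 4) ∂stdG = √2 := by
  unfold stdG
  rw [integral_gaussianReal_eq_integral_smul (by norm_num)]
  have h : ∀ x : ℝ, gaussianPDFReal 0 1 x • Real.exp (x ^ 2 / 4)
      = (√(2 * Real.pi))⁻¹ * Real.exp (-(1 / 4) * x ^ 2) := by
    intro x
    simp only [gaussianPDFReal, smul_eq_mul, sub_zero, NNReal.coe_one, mul_one, mul_assoc]
    rw [← Real.exp_add]
    congr 2
    ring
  simp_rw [h]
  rw [integral_const_mul, integral_gaussian, ← Real.sqrt_inv, ← Real.sqrt_mul (by positivity)]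
  congr 1
  field_simp
  norm_num

lemma integrable_exp_sq_div_four_stdG : Integrable (fun x => Real.exp (x ^ 2 / 4)) stdG := by
  by_contra h
  have h1 := integral_exp_sq_div_four_stdG
  rw [integral_undef h] at h1
  have : 0 < √(2 : ℝ) := by positivity
  linarith

lemma sqrt_two_le : √(2 : ℝ) ≤ 3 / 2 := by
  rw [Real.sqrt_le_left (by norm_num)]; norm_num

lemma one_add_sq_le_exp (x : ℝ) : 1 + x ^ 2 ≤ 4 * Real.exp (x ^ 2 / 4) := by
  have := Real.add_one_le_exp (x ^ 2 / 4); linarith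

lemma integrable_stdG_of_le {f : ℝ → ℝ} (hf : Measurable f) {K : ℝ}
    (h : ∀ x, |f x| ≤ K * (1 + x ^ 2)) : Integrable f stdG := by
  have hK : 0 ≤ K := by
    have := (abs_nonneg _).trans (h 0); simpa using this
  refine (integrable_exp_sq_div_four_stdG.const_mul (K * 4)).mono' hf.aestronglyMeasurable
    (Filter.Eventually.of_forall fun x => ?_)
  rw [Real.norm_eq_abs, mul_assoc]
  exact (h x).trans (mul_le_mul_of_nonneg_left (one_add_sq_le_exp x) hK)

lemma integrable_sq_stdG : Integrable (fun x : ℝ => x ^ 2) stdG :=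
  integrable_stdG_of_le (K := 1) (by fun_prop) fun x => by
    rw [abs_of_nonneg (sq_nonneg x)]; nlinarith

lemma integral_sq_stdG : ∫ x, x ^ 2 ∂stdG = 1 := by
  have h := variance_fun_id_gaussianReal (μ := 0) (v := 1)
  rw [variance_eq_integral (by fun_prop)] at h
  simpa [stdG] using h

lemma integral_id_stdG : ∫ x, x ∂stdG = 0 := by
  simp [stdG]

lemma exp_mul_sub_mean_le {f : ℝ → ℝ} (hf : Measurable f) (hb : ∀ x, |f x| ≤ 1 + x ^ 2) {s : ℝ}
    (hs : 0 ≤ s) (hs' : s ≤ 1 / 8) :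
    Integrable (fun x => Real.exp (s * (f x - ∫ y, f y ∂stdG))) stdG ∧
      ∫ x, Real.exp (s * (f x - ∫ y, f y ∂stdG)) ∂stdG ≤ Real.exp (410 * s ^ 2) := by
  have hfi : Integrable f stdG := integrable_stdG_of_le (K := 1) hf (by simpa using hb)
  set m := ∫ y, f y ∂stdG with hm
  have hm2 : |m| ≤ 2 := by
    calc |m| ≤ ∫ y, |f y| ∂stdG := abs_integral_le_integral_abs
      _ ≤ ∫ y, (1 + y ^ 2) ∂stdG :=
        integral_mono hfi.abs ((integrable_const _).add integrable_sq_stdG) hb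
      _ = 2 := by
        rw [integral_add (integrable_const _) integrable_sq_stdG, integral_sq_stdG]
        simp; norm_num
  have hq : ∀ x, |f x - m| ≤ 3 + x ^ 2 := fun x => by
    have := abs_sub (f x) m
    linarith [hb x]
  have hpt : ∀ x, Real.exp (s * (f x - m)) ≤
      1 + s * (f x - m) + s ^ 2 * (128 * Real.exp (3 / 4) * Real.exp (x ^ 2 / 4)) := by
    intro x
    refine (exp_le_one_add_add_sq_mul_exp_abs _).trans (add_le_add le_rfl ?_)
    rw [abs_mul, abs_of_nonneg hs, mul_pow, mul_assoc (s ^ 2)]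
    refine mul_le_mul_of_nonneg_left ?_ (sq_nonneg s)
    have h1 : (f x - m) ^ 2 ≤ (3 + x ^ 2) ^ 2 := by
      rw [← sq_abs]; exact pow_le_pow_left₀ (abs_nonneg _) (hq x) 2
    have h2 : (3 + x ^ 2) ^ 2 ≤ 128 * Real.exp ((3 + x ^ 2) / 8) := by
      have := Real.quadratic_le_exp_of_nonneg (x := (3 + x ^ 2) / 8) (by positivity)
      nlinarith [sq_nonneg x]
    have h3 : s * |f x - m| ≤ (3 + x ^ 2) / 8 := by
      have := mul_le_mul hs' (hq x) (abs_nonneg _) (by norm_num)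
      linarith
    calc (f x - m) ^ 2 * Real.exp (s * |f x - m|)
        ≤ (128 * Real.exp ((3 + x ^ 2) / 8)) * Real.exp ((3 + x ^ 2) / 8) :=
          mul_le_mul (h1.trans h2) (Real.exp_le_exp.2 h3) (Real.exp_pos _).le (by positivity)
      _ = 128 * Real.exp (3 / 4) * Real.exp (x ^ 2 / 4) := by
        rw [mul_assoc, ← Real.exp_add, mul_assoc, ← Real.exp_add]; congr 2; ring
  have hI1 : Integrable (fun x => s * (f x - m)) stdG := (hfi.sub (integrable_const _)).const_mul _
  have hI2 : Integrable (fun x => s ^ 2 * (128 * Real.exp (3 / 4) * Real.exp (x ^ 2 / 4))) stdG :=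
    (integrable_exp_sq_div_four_stdG.const_mul _).const_mul _
  have hI3 : Integrable (fun x => 1 + s * (f x - m)) stdG := (integrable_const _).add hI1
  have hI : Integrable (fun x => Real.exp (s * (f x - m))) stdG := by
    refine (hI3.add hI2).mono' (by fun_prop) (Filter.Eventually.of_forall fun x => ?_)
    rw [Real.norm_eq_abs, abs_of_pos (Real.exp_pos _)]
    exact hpt x
  refine ⟨hI, ?_⟩
  calc ∫ x, Real.exp (s * (f x - m)) ∂stdG
      ≤ ∫ x, (1 + s * (f x - m) +
        s ^ 2 * (128 * Real.exp (3 / 4) * Real.exp (x ^ 2 / 4))) ∂stdG :=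
        integral_mono hI (hI3.add hI2) hpt
    _ = 1 + s ^ 2 * (128 * Real.exp (3 / 4) * √2) := by
        rw [integral_add hI3 hI2, integral_add (integrable_const _) hI1, integral_const_mul,
          integral_sub hfi (integrable_const _), integral_const_mul, integral_const_mul,
          integral_exp_sq_div_four_stdG, ← hm]
        simp
    _ ≤ 1 + 410 * s ^ 2 := by
        have h1 : Real.exp (3 / 4) ≤ 32 / 15 := by
          have h5 : Real.exp (3 / 4) ^ 4 = Real.exp 1 ^ 3 := by
            rw [← Real.exp_nat_mul, ← Real.exp_nat_mul]; norm_num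
          have h6 := Real.exp_one_lt_d9
          by_contra hc
          push Not at hc
          have h7 : (32 / 15 : ℝ) ^ 4 < Real.exp (3 / 4) ^ 4 :=
            pow_lt_pow_left₀ hc (by norm_num) (by norm_num)
          have h8 : Real.exp 1 ^ 3 ≤ 2.7182818286 ^ 3 :=
            pow_le_pow_left₀ (Real.exp_pos _).le h6.le 3
          rw [h5] at h7
          norm_num at h7 h8
          linarith
        have h2 : Real.exp (3 / 4) * √2 ≤ 32 / 15 * (3 / 2) :=
          mul_le_mul h1 sqrt_two_le (by positivity) (by norm_num)
        nlinarith [sq_nonneg s]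
    _ ≤ Real.exp (410 * s ^ 2) := by
        have := Real.add_one_le_exp (410 * s ^ 2); linarith

/-- One-sided Bernstein-type bound for sums of functions of at most quadratic growth of independent
standard Gaussians. -/
lemma Pz_sum_sub_mean_ge_le {N : ℕ} {f : Fin N → ℝ → ℝ} (hf : ∀ i, Measurable (f i)) {K : ℝ}
    (hK : 0 < K) (hb : ∀ i x, |f i x| ≤ K * (1 + x ^ 2)) {t : ℝ} (ht : 0 ≤ t) (ht' : t ≤ K) :
    (Pz N).real {g | N * t ≤ ∑ i, (f i (g i) - ∫ x, f i x ∂stdG)} ≤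
      Real.exp (-(N * t ^ 2) / (1640 * K ^ 2)) := by
  set s : ℝ := t / (820 * K) with hs
  have hs0 : 0 ≤ s := by positivity
  have hsK : s ≤ 1 / 8 := by
    rw [hs, div_le_div_iff₀ (by positivity) (by norm_num)]; nlinarith
  have h1 : ∀ i, Integrable (fun x => Real.exp (s * (f i x / K - ∫ y, f i y / K ∂stdG))) stdG ∧
      ∫ x, Real.exp (s * (f i x / K - ∫ y, f i y / K ∂stdG)) ∂stdG ≤ Real.exp (410 * s ^ 2) := by
    intro i
    refine exp_mul_sub_mean_le ((hf i).div_const _) (fun x => ?_) hs0 hsK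
    rw [abs_div, abs_of_pos hK, div_le_iff₀ hK, mul_comm]
    exact hb i x
  have hprod : ∀ g : Fin N → ℝ, Real.exp (s * ∑ i, (f i (g i) / K - ∫ y, f i y / K ∂stdG)) =
      ∏ i, Real.exp (s * (f i (g i) / K - ∫ y, f i y / K ∂stdG)) := fun g => by
    rw [Finset.mul_sum, Real.exp_sum]
  have hint : Integrable
      (fun g : Fin N → ℝ => Real.exp (s * ∑ i, (f i (g i) / K - ∫ y, f i y / K ∂stdG))) (Pz N) := by
    simp_rw [hprod]
    exact Integrable.fintype_prod (fun i => (h1 i).1)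
  have h2 := measure_ge_le_exp_mul_mgf (μ := Pz N) (N * (t / K)) hs0 hint
  have h3 : mgf (fun g : Fin N → ℝ => ∑ i, (f i (g i) / K - ∫ y, f i y / K ∂stdG)) (Pz N) s ≤
      Real.exp (N * (410 * s ^ 2)) := by
    unfold mgf
    simp_rw [hprod]
    unfold Pz
    rw [integral_fintype_prod_eq_prod (μ := fun _ => gaussianReal 0 1)
      (f := fun i x => Real.exp (s * (f i x / K - ∫ y, f i y / K ∂stdG)))]
    refine (Finset.prod_le_prod (fun i _ => integral_nonneg fun x => (Real.exp_pos _).le)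
      (fun i _ => (h1 i).2)).trans (le_of_eq ?_)
    rw [Finset.prod_const, ← Real.exp_nat_mul]
    simp
  have h4 : {g : Fin N → ℝ | N * t ≤ ∑ i, (f i (g i) - ∫ x, f i x ∂stdG)} =
      {g | N * (t / K) ≤ ∑ i, (f i (g i) / K - ∫ y, f i y / K ∂stdG)} := by
    ext g
    simp only [Set.mem_ofPred_eq, integral_div, ← sub_div, ← Finset.sum_div]
    rw [← mul_div_assoc, div_le_div_iff_of_pos_right hK]
  rw [h4]
  refine h2.trans ?_
  refine (mul_le_mul_of_nonneg_left h3 (Real.exp_pos _).le).trans (le_of_eq ?_)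
  rw [← Real.exp_add, hs]
  congr 1
  field_simp
  ring

lemma Pz_abs_sum_sub_mean_ge_le {N : ℕ} {f : Fin N → ℝ → ℝ} (hf : ∀ i, Measurable (f i)) {K : ℝ}
    (hK : 0 < K) (hb : ∀ i x, |f i x| ≤ K * (1 + x ^ 2)) {t : ℝ} (ht : 0 ≤ t) (ht' : t ≤ K) :
    (Pz N).real {g | N * t ≤ |∑ i, (f i (g i) - ∫ x, f i x ∂stdG)|} ≤
      2 * Real.exp (-(N * t ^ 2) / (1640 * K ^ 2)) := by
  have h1 := Pz_sum_sub_mean_ge_le hf hK hb ht ht'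
  have h2 := Pz_sum_sub_mean_ge_le (f := fun i x => -f i x) (fun i => (hf i).neg) hK
    (fun i x => by rw [abs_neg]; exact hb i x) ht ht'
  have h3 : {g : Fin N → ℝ | N * t ≤ |∑ i, (f i (g i) - ∫ x, f i x ∂stdG)|} ⊆
      {g | N * t ≤ ∑ i, (f i (g i) - ∫ x, f i x ∂stdG)} ∪
      {g | N * t ≤ ∑ i, (-f i (g i) - ∫ x, -f i x ∂stdG)} := by
    intro g hg
    rw [Set.mem_ofPred_eq] at hg
    rcases le_abs.1 hg with h | h
    · exact Or.inl h
    · right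
      simp only [Set.mem_ofPred_eq, integral_neg, sub_neg_eq_add]
      refine h.trans (le_of_eq ?_)
      rw [← Finset.sum_neg_distrib]
      exact Finset.sum_congr rfl fun i _ => by ring
  refine (measureReal_mono h3).trans ((measureReal_union_le _ _).trans ?_)
  linarith

lemma stdG_abs_ge_le {s : ℝ} (hs : 0 ≤ s) :
    stdG.real {x | s ≤ |x|} ≤ 3 / 2 * Real.exp (-s ^ 2 / 4) := by
  have h := mul_meas_ge_le_integral_of_nonneg (μ := stdG)
    (f := fun x => Real.exp (x ^ 2 / 4)) (Filter.Eventually.of_forall fun x => (Real.exp_pos _).le)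
    integrable_exp_sq_div_four_stdG (Real.exp (s ^ 2 / 4))
  rw [integral_exp_sq_div_four_stdG] at h
  have h1 : {x : ℝ | s ≤ |x|} ⊆ {x | Real.exp (s ^ 2 / 4) ≤ Real.exp (x ^ 2 / 4)} := by
    intro x hx
    simp only [Set.mem_ofPred_eq, Real.exp_le_exp] at *
    rw [← sq_abs x]
    have := pow_le_pow_left₀ hs hx 2
    linarith
  have h2 := measureReal_mono (μ := stdG) h1
  have h3 : Real.exp (-s ^ 2 / 4) * Real.exp (s ^ 2 / 4) = 1 := by
    rw [← Real.exp_add]; ring_nf; simp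
  have h4 := sqrt_two_le
  calc stdG.real {x | s ≤ |x|}
      ≤ stdG.real {x | Real.exp (s ^ 2 / 4) ≤ Real.exp (x ^ 2 / 4)} := h2
    _ = Real.exp (-s ^ 2 / 4) *
        (Real.exp (s ^ 2 / 4) * stdG.real {x | Real.exp (s ^ 2 / 4) ≤ Real.exp (x ^ 2 / 4)}) := by
        rw [← mul_assoc, h3, one_mul]
    _ ≤ Real.exp (-s ^ 2 / 4) * (3 / 2) :=
        mul_le_mul_of_nonneg_left (h.trans h4) (Real.exp_pos _).le
    _ = _ := by ring

/-- Truncated second moment of a standard Gaussian. -/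
lemma integral_posPart_abs_sub_sq_le {T : ℝ} (hT : 0 ≤ T) :
    ∫ x, (max (|x| - T) 0) ^ 2 ∂stdG ≤ 12 * Real.exp (-T ^ 2 / 8) := by
  have hpt : ∀ x : ℝ, (max (|x| - T) 0) ^ 2 ≤ 8 * Real.exp (-T ^ 2 / 8) * Real.exp (x ^ 2 / 4) := by
    intro x
    rcases le_total |x| T with h | h
    · rw [max_eq_right (by linarith)]
      have : 0 < 8 * Real.exp (-T ^ 2 / 8) * Real.exp (x ^ 2 / 4) := by positivity
      simpa using this.le
    · rw [max_eq_left (by linarith)]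
      have h0 : T ^ 2 ≤ x ^ 2 := by rw [← sq_abs x]; exact pow_le_pow_left₀ hT h 2
      have h1 : (|x| - T) ^ 2 ≤ x ^ 2 := by
        rw [← sq_abs x]; exact pow_le_pow_left₀ (by linarith) (by linarith) 2
      have h2 : x ^ 2 ≤ 8 * Real.exp (x ^ 2 / 8) := by
        have := Real.add_one_le_exp (x ^ 2 / 8); linarith
      have h3 : Real.exp (x ^ 2 / 8) ≤ Real.exp (-T ^ 2 / 8) * Real.exp (x ^ 2 / 4) := by
        rw [← Real.exp_add, Real.exp_le_exp]; linarith
      linarith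
  calc ∫ x, (max (|x| - T) 0) ^ 2 ∂stdG
      ≤ ∫ x, 8 * Real.exp (-T ^ 2 / 8) * Real.exp (x ^ 2 / 4) ∂stdG :=
        integral_mono_of_nonneg (Filter.Eventually.of_forall fun x => by positivity)
          (integrable_exp_sq_div_four_stdG.const_mul _) (Filter.Eventually.of_forall hpt)
    _ = 8 * Real.exp (-T ^ 2 / 8) * √2 := by
        rw [integral_const_mul, integral_exp_sq_div_four_stdG]
    _ ≤ 12 * Real.exp (-T ^ 2 / 8) := by nlinarith [sqrt_two_le, Real.exp_pos (-T ^ 2 / 8)]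

lemma eta_eq_posPart {x b : ℝ} (hb : 0 ≤ b) : eta x b = max (x - b) 0 - max (-x - b) 0 := by
  unfold eta
  rcases lt_trichotomy x 0 with h | rfl | h
  · rw [Real.sign_of_neg h, abs_of_neg h, max_eq_right (a := x - b) (by linarith)]; ring
  · simp
  · rw [Real.sign_of_pos h, abs_of_pos h, max_eq_right (a := -x - b) (by linarith)]; ring

lemma abs_sub_eta_le {x b : ℝ} (hb : 0 ≤ b) : |x - eta x b| ≤ b := by
  rw [eta_eq_posPart hb, abs_le]
  rcases max_cases (x - b) 0 with h | h <;> rcases max_cases (-x - b) 0 with h' | h' <;>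
    constructor <;> linarith

lemma sub_eta_mul_eta {x b : ℝ} (hb : 0 ≤ b) : (x - eta x b) * eta x b = b * |eta x b| := by
  rw [eta_eq_posPart hb]
  rcases max_cases (x - b) 0 with h | h <;> rcases max_cases (-x - b) 0 with h' | h' <;>
    rw [h.1, h'.1]
  · have : b = 0 := by linarith
    have : x = 0 := by linarith
    simp [*]
  · rw [sub_zero, abs_of_nonneg h.2]; ring
  · rw [abs_of_nonpos (by linarith)]; ring
  · simp

/-- Optimality of soft thresholding as a proximal map. -/
lemma eta_prox {x b : ℝ} (hb : 0 ≤ b) (y : ℝ) :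
    (x - eta x b) * (y - eta x b) ≤ b * (|y| - |eta x b|) := by
  have h1 := sub_eta_mul_eta (x := x) hb
  have h2 : (x - eta x b) * y ≤ b * |y| := by
    refine (le_abs_self _).trans ?_
    rw [abs_mul]
    exact mul_le_mul_of_nonneg_right (abs_sub_eta_le hb) (abs_nonneg _)
  linarith

lemma abs_eta_sub_eta_le {x y b : ℝ} (hb : 0 ≤ b) : |eta x b - eta y b| ≤ |x - y| := by
  rw [← sq_le_sq]
  nlinarith [eta_prox (x := x) hb (eta y b), eta_prox (x := y) hb (eta x b),
    sq_nonneg ((x - y) - (eta x b - eta y b))]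

lemma continuous_eta {b : ℝ} (hb : 0 ≤ b) : Continuous (fun x => eta x b) := by
  have : (fun x => eta x b) = fun x => max (x - b) 0 - max (-x - b) 0 :=
    funext fun x => eta_eq_posPart hb
  rw [this]
  fun_prop

lemma abs_eta_sub_le {a τ z b : ℝ} (hτ : 0 ≤ τ) (hb : 0 ≤ b) :
    |eta (a + τ * z) b - a| ≤ τ * |z| + b := by
  have h1 := abs_sub_eta_le (x := a + τ * z) hb
  have h2 : |eta (a + τ * z) b - a| ≤ |a + τ * z - eta (a + τ * z) b| + |τ * z| := by
    rw [show eta (a + τ * z) b - a = τ * z - (a + τ * z - eta (a + τ * z) b) by ring]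
    have := abs_sub (τ * z) (a + τ * z - eta (a + τ * z) b)
    linarith
  rw [abs_mul, abs_of_nonneg hτ] at h2
  linarith

lemma hasDerivAt_gaussianPDFReal (x : ℝ) :
    HasDerivAt (gaussianPDFReal 0 1) (-x * gaussianPDFReal 0 1 x) x := by
  have h1 : gaussianPDFReal 0 1 =
      fun x : ℝ => (√(2 * Real.pi))⁻¹ * Real.exp (-(x ^ 2) / 2) := by
    ext x; simp [gaussianPDFReal]
  rw [h1]
  have h2 : HasDerivAt (fun x : ℝ => -(x ^ 2) / 2) (-(2 * x) / 2) x := by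
    simpa using ((hasDerivAt_pow 2 x).neg.div_const 2)
  exact (h2.exp.const_mul _).congr_deriv (by ring)

lemma integral_mul_posPart_stdG (c : ℝ) :
    ∫ z, z * max (z - c) 0 ∂stdG = stdG.real (Set.Ioi c) := by
  have hg : ∀ z : ℝ, HasDerivAt (fun z => -((z - c) * gaussianPDFReal 0 1 z))
      (z * (z - c) * gaussianPDFReal 0 1 z - gaussianPDFReal 0 1 z) z := fun z =>
    (((hasDerivAt_id z).sub_const c).mul (hasDerivAt_gaussianPDFReal z)).neg.congr_deriv
      (by simp; ring)
  have hint : ∀ k : ℝ → ℝ, Measurable k → Integrable k stdG →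
      Integrable (fun z => k z * gaussianPDFReal 0 1 z) volume := by
    intro k hk hi
    unfold stdG at hi
    rw [gaussianReal_of_var_ne_zero 0 (by norm_num),
      integrable_withDensity_iff (by fun_prop) (by simp [gaussianPDF])] at hi
    refine hi.congr (Filter.Eventually.of_forall fun z => ?_)
    simp [gaussianPDF, ENNReal.toReal_ofReal (gaussianPDFReal_nonneg 0 1 z)]
  have hpoly : Integrable (fun z : ℝ => z * (z - c)) stdG := by
    refine integrable_stdG_of_le (K := 2 + |c|) (by fun_prop) fun z => ?_
    rw [abs_mul]
    have h1 := abs_sub z c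
    have h2 := sq_abs z
    have h3 : |z| * |z - c| ≤ |z| * (|z| + |c|) := mul_le_mul_of_nonneg_left h1 (abs_nonneg _)
    nlinarith [sq_nonneg (|z| - 1), abs_nonneg c, abs_nonneg z,
      mul_nonneg (abs_nonneg c) (sq_nonneg (|z| - 1))]
  have hi1 := hint _ (by fun_prop) hpoly
  have hi2 : Integrable (gaussianPDFReal 0 1) volume := integrable_gaussianPDFReal 0 1
  have htend : Filter.Tendsto (fun z => -((z - c) * gaussianPDFReal 0 1 z)) Filter.atTop
      (nhds 0) := by
    have h0 : ∀ s : ℝ, Filter.Tendsto (fun z : ℝ => |z| ^ s * Real.exp (-(1 / 2) * z ^ 2))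
        Filter.atTop (nhds 0) := fun s =>
      (tendsto_rpow_abs_mul_exp_neg_mul_sq_cocompact (by norm_num) s).mono_left
        atTop_le_cocompact
    have h1 := ((h0 1).sub ((h0 0).const_mul c)).const_mul (-(√(2 * Real.pi))⁻¹)
    simp only [mul_zero, sub_zero] at h1
    refine h1.congr' ?_
    filter_upwards [Filter.eventually_ge_atTop 0] with z hz
    simp only [Real.rpow_one, Real.rpow_zero, one_mul, abs_of_nonneg hz, gaussianPDFReal]
    simp only [NNReal.coe_one, mul_one, sub_zero]
    rw [show -z ^ 2 / 2 = -(1 / 2) * z ^ 2 by ring]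
    ring
  have hftc := integral_Ioi_of_hasDerivAt_of_tendsto (a := c) (hg c).continuousAt.continuousWithinAt
    (fun z _ => hg z) (hi1.sub hi2).integrableOn htend
  rw [integral_sub hi1.integrableOn hi2.integrableOn] at hftc
  simp only [sub_self, zero_mul, neg_zero] at hftc
  have e1 : ∫ z, z * max (z - c) 0 ∂stdG =
      ∫ z in Set.Ioi c, z * (z - c) * gaussianPDFReal 0 1 z := by
    unfold stdG
    rw [integral_gaussianReal_eq_integral_smul (by norm_num), ← integral_indicator
      measurableSet_Ioi]
    refine integral_congr_ae (Filter.Eventually.of_forall fun z => ?_)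
    by_cases hz : c < z
    · rw [Set.indicator_of_mem (by exact Set.mem_Ioi.2 hz)]
      simp only [smul_eq_mul]
      rw [max_eq_left (by linarith)]; ring
    · rw [Set.indicator_of_notMem (by simpa using hz)]
      simp only [smul_eq_mul]
      rw [max_eq_right (by linarith)]; simp
  have e2 : stdG.real (Set.Ioi c) = ∫ z in Set.Ioi c, gaussianPDFReal 0 1 z := by
    unfold stdG Measure.real
    rw [gaussianReal_apply_eq_integral 0 (by norm_num), ENNReal.toReal_ofReal]
    exact integral_nonneg fun z => gaussianPDFReal_nonneg 0 1 z
  rw [e1, e2]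
  linarith

lemma stdG_map_neg : stdG.map (fun x => -x) = stdG := by
  unfold stdG
  rw [gaussianReal_map_neg, neg_zero]

/-- Stein's identity for soft thresholding. -/
lemma integral_mul_eta_stdG {a τ b : ℝ} (hτ : 0 < τ) (hb : 0 ≤ b) :
    ∫ z, z * eta (a + τ * z) b ∂stdG = τ * stdG.real {z | b < |a + τ * z|} := by
  set a₁ := (b - a) / τ with ha₁
  set a₂ := (b + a) / τ with ha₂
  have hmax : ∀ c z : ℝ, |max (z - c) 0| ≤ |z| + |c| := fun c z => by
    have := abs_sub z c
    rcases max_cases (z - c) 0 with h | h <;> rw [h.1]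
    · exact this
    · simp; positivity
  have hI : ∀ c : ℝ, Integrable (fun z : ℝ => z * max (z - c) 0) stdG := fun c => by
    refine integrable_stdG_of_le (K := 2 + |c|) (by fun_prop) fun z => ?_
    rw [abs_mul]
    have h2 := sq_abs z
    have h3 := mul_le_mul_of_nonneg_left (hmax c z) (abs_nonneg z)
    nlinarith [sq_nonneg (|z| - 1), abs_nonneg c, abs_nonneg z,
      mul_nonneg (abs_nonneg c) (sq_nonneg (|z| - 1))]
  have hI' : Integrable (fun z : ℝ => z * max (-z - a₂) 0) stdG := by
    have h := hI a₂
    rw [← stdG_map_neg, integrable_map_measure (by fun_prop) (by fun_prop)] at h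
    refine h.neg.congr (Filter.Eventually.of_forall fun z => ?_)
    simp
  have hneg : ∫ z, z * max (-z - a₂) 0 ∂stdG = -stdG.real (Set.Ioi a₂) := by
    rw [← integral_mul_posPart_stdG a₂]
    conv_rhs => rw [← stdG_map_neg, integral_map (by fun_prop) (by fun_prop)]
    rw [← integral_neg]
    simp
  have hsplit : ∀ z : ℝ, z * eta (a + τ * z) b =
      τ * (z * max (z - a₁) 0) - τ * (z * max (-z - a₂) 0) := fun z => by
    rw [eta_eq_posPart hb]
    have h1 : max (a + τ * z - b) 0 = τ * max (z - a₁) 0 := by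
      rw [mul_max_of_nonneg _ _ hτ.le, mul_zero, ha₁, mul_sub, mul_div_cancel₀ _ hτ.ne']
      ring_nf
    have h2 : max (-(a + τ * z) - b) 0 = τ * max (-z - a₂) 0 := by
      rw [mul_max_of_nonneg _ _ hτ.le, mul_zero, ha₂, mul_sub, mul_div_cancel₀ _ hτ.ne']
      ring_nf
    rw [h1, h2]; ring
  simp_rw [hsplit]
  rw [integral_sub ((hI _).const_mul _) (hI'.const_mul _), integral_const_mul, integral_const_mul,
    hneg, integral_mul_posPart_stdG, mul_neg, sub_neg_eq_add, ← mul_add]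
  congr 1
  have hIio : stdG.real (Set.Ioi a₂) = stdG.real (Set.Iio (-a₂)) := by
    conv_lhs => rw [← stdG_map_neg]
    rw [map_measureReal_apply (by fun_prop) measurableSet_Ioi]
    congr 1
    ext z
    simp only [Set.mem_preimage, Set.mem_Ioi, Set.mem_Iio]
    constructor <;> intro h <;> linarith
  have hset : {z : ℝ | b < |a + τ * z|} = Set.Ioi a₁ ∪ Set.Iio (-a₂) := by
    ext z
    simp only [Set.mem_ofPred_eq, lt_abs, Set.mem_union, Set.mem_Ioi, Set.mem_Iio, ha₁, ha₂]
    rw [div_lt_iff₀ hτ, ← neg_div, lt_div_iff₀ hτ, lt_neg]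
    constructor <;> rintro (h | h)
    · left; linarith
    · right; linarith
    · left; linarith
    · right; linarith
  rw [hIio, hset, measureReal_union _ measurableSet_Iio]
  rw [Set.disjoint_left]
  intro z hz hz'
  simp only [Set.mem_Ioi, Set.mem_Iio, ha₁, ha₂] at hz hz'
  rw [div_lt_iff₀ hτ] at hz
  rw [lt_neg, div_lt_iff₀ hτ] at hz'
  linarith

/-- Integration against the empirical distribution times the Gaussian. -/
lemma integral_empDist_prod_stdG {N : ℕ} (θ : Fin N → ℝ) {F : ℝ × ℝ → ℝ} (hF : Measurable F)
    (hi : ∀ i, Integrable (fun z => F (θ i, z)) stdG) :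
    ∫ q, F q ∂((empDist θ).prod stdG) = (∑ i, ∫ z, F (θ i, z) ∂stdG) / N := by
  have h1 : (empDist θ).prod stdG =
      (N : ℝ≥0∞)⁻¹ • ∑ i : Fin N, (Measure.dirac (θ i)).prod stdG := by
    unfold empDist
    rw [Measure.prod_smul_left]
    congr 1
    rw [← Measure.sum_fintype, Measure.prod_sum_left, Measure.sum_fintype]
  rw [h1, integral_smul_measure, integral_finsetSum_measure]
  · simp only [ENNReal.toReal_inv, ENNReal.toReal_natCast, smul_eq_mul]
    rw [div_eq_inv_mul]
    congr 1
    refine Finset.sum_congr rfl fun i _ => ?_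
    rw [Measure.dirac_prod, integral_map (by fun_prop) hF.aestronglyMeasurable]
  · intro i _
    rw [Measure.dirac_prod, integrable_map_measure hF.aestronglyMeasurable (by fun_prop)]
    exact hi i

/-- Error of the soft-thresholding estimate of `θ i` from the scalar Gaussian observation. -/
def seErr {N : ℕ} (θ : Fin N → ℝ) (τ b : ℝ) (i : Fin N) (z : ℝ) : ℝ := eta (θ i + τ * z) b - θ i

section
variable {N : ℕ} {θ : Fin N → ℝ} {τ b : ℝ}

lemma continuous_seErr (hb : 0 ≤ b) (i : Fin N) : Continuous (seErr θ τ b i) :=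
  ((continuous_eta hb).comp (by fun_prop : Continuous fun z => θ i + τ * z)).sub continuous_const

lemma abs_seErr_le (hτ : 0 ≤ τ) (hb : 0 ≤ b) (i : Fin N) (z : ℝ) :
    |seErr θ τ b i z| ≤ τ * |z| + b := abs_eta_sub_le hτ hb

lemma seErr_sq_le (hτ : 0 ≤ τ) (hb : 0 ≤ b) (i : Fin N) (z : ℝ) :
    seErr θ τ b i z ^ 2 ≤ 2 * (τ ^ 2 + b ^ 2) * (1 + z ^ 2) := by
  have h := pow_le_pow_left₀ (abs_nonneg _) (abs_seErr_le (θ := θ) hτ hb i z) 2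
  rw [sq_abs] at h
  nlinarith [sq_nonneg (τ * |z| - b), sq_abs z, sq_nonneg τ, mul_nonneg (sq_nonneg b) (sq_nonneg z)]

lemma abs_mul_seErr_le (hτ : 0 ≤ τ) (hb : 0 ≤ b) (i : Fin N) (z : ℝ) :
    |z * seErr θ τ b i z| ≤ (τ + b) * (1 + z ^ 2) := by
  rw [abs_mul]
  have h := mul_le_mul_of_nonneg_left (abs_seErr_le (θ := θ) hτ hb i z) (abs_nonneg z)
  nlinarith [sq_nonneg (|z| - 1), sq_abs z, abs_nonneg z, mul_nonneg hb (sq_nonneg (|z| - 1)),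
    mul_nonneg hb (sq_nonneg z)]

lemma integrable_seErr_sq (hτ : 0 ≤ τ) (hb : 0 ≤ b) (i : Fin N) :
    Integrable (fun z => seErr θ τ b i z ^ 2) stdG :=
  integrable_stdG_of_le ((continuous_seErr hb i).pow 2).measurable fun z => by
    rw [abs_of_nonneg (sq_nonneg _)]; exact seErr_sq_le hτ hb i z

lemma integrable_mul_seErr (hτ : 0 ≤ τ) (hb : 0 ≤ b) (i : Fin N) :
    Integrable (fun z => z * seErr θ τ b i z) stdG :=
  integrable_stdG_of_le (continuous_id.mul (continuous_seErr hb i)).measurable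
    (abs_mul_seErr_le hτ hb i)

lemma integral_mul_seErr (hτ : 0 < τ) (hb : 0 ≤ b) (i : Fin N) :
    ∫ z, z * seErr θ τ b i z ∂stdG = τ * stdG.real {z | b < |θ i + τ * z|} := by
  rw [← integral_mul_eta_stdG hτ hb]
  have h1 : Integrable (fun z : ℝ => z * θ i) stdG :=
    (integrable_stdG_of_le (K := 1) measurable_id fun z => by
      rw [id]; nlinarith [sq_nonneg (|z| - 1), sq_abs z, sq_nonneg z]).mul_const _
  have h2 : ∀ z, z * seErr θ τ b i z + z * θ i = z * eta (θ i + τ * z) b := fun z => by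
    unfold seErr; ring
  rw [← integral_congr_ae (Filter.Eventually.of_forall h2),
    integral_add (integrable_mul_seErr hτ.le hb i) h1, integral_mul_const, integral_id_stdG]
  simp

lemma card_abs_gt_le {p ξ t : ℝ} (hN : 0 < N) (hp : 0 < p) (hξ : 0 < ξ) (ht : 0 < t)
    (hθ : θ ∈ Fball N p ξ) :
    ((Finset.univ.filter fun i => t < |θ i|).card : ℝ) ≤ N * (ξ / t) ^ p := by
  unfold Fball at hθ
  rw [Set.mem_ofPred_eq, one_div, inv_mul_le_iff₀ (by positivity)] at hθ
  rw [Real.div_rpow hξ.le ht.le, ← mul_div_assoc, le_div_iff₀ (Real.rpow_pos_of_pos ht p)]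
  refine le_trans ?_ hθ
  rw [← nsmul_eq_mul, ← Finset.sum_const]
  refine (Finset.sum_le_sum fun i hi => ?_).trans
    (Finset.sum_le_sum_of_subset_of_nonneg (Finset.filter_subset (fun i => t < |θ i|) _)
      fun i _ _ => Real.rpow_nonneg (abs_nonneg (θ i)) p)
  exact Real.rpow_le_rpow ht.le (Finset.mem_filter.1 hi).2.le hp.le

end

/-- The state evolution equations written as coordinate sums. -/
structure SEPoint (δ σ : ℝ) {N : ℕ} (θ : Fin N → ℝ) (β τ b : ℝ) : Prop where
  beta_pos : 0 < β
  sigma_le : σ ≤ τ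
  beta_le : β ≤ τ
  sum_sq : ∑ i, ∫ z, seErr θ τ b i z ^ 2 ∂stdG = N * (δ * (τ ^ 2 - σ ^ 2))
  sum_mul : ∑ i, ∫ z, z * seErr θ τ b i z ∂stdG = N * (δ * (τ - β))

section
variable {N : ℕ} {θ : Fin N → ℝ} {δ σ lam β τ : ℝ}

lemma StateEvo.beta_eq (hN : 0 < N) (hδ : 0 < δ)
    (h : StateEvo δ σ (empDist θ) lam β τ) :
    N * (δ * (τ - β)) = τ * ∑ i, stdG.real {z | τ * lam / β < |θ i + τ * z|} := by
  obtain ⟨hβ, hτ, -, h2⟩ := h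
  have hm : MeasurableSet {x : ℝ | τ * lam / β < |x|} :=
    measurableSet_lt measurable_const measurable_norm
  have hmi : ∀ i, MeasurableSet {z : ℝ | τ * lam / β < |θ i + τ * z|} := fun i =>
    measurableSet_lt measurable_const (by fun_prop)
  have he : ∀ i, (fun z => eta' (θ i + τ * z) (τ * lam / β)) =
      Set.indicator {z : ℝ | τ * lam / β < |θ i + τ * z|} 1 := fun i => by
    ext z; simp [eta', Set.indicator_apply]
  rw [integral_empDist_prod_stdG (F := fun q => eta' (q.1 + τ * q.2) (τ * lam / β)) θ
    (Measurable.ite (measurableSet_lt measurable_const (by fun_prop)) measurable_const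
      measurable_const)] at h2
  · simp only [he] at h2
    simp_rw [fun i => integral_indicator_one (μ := stdG) (hmi i)] at h2
    have hN' : (N : ℝ) ≠ 0 := by positivity
    generalize (∑ i, stdG.real {z | τ * lam / β < |θ i + τ * z|}) = S at h2 ⊢
    rw [h2]
    field_simp
    ring
  · intro i
    simp only [he]
    exact (integrable_const (1 : ℝ)).indicator (hmi i)

lemma StateEvo.sePoint (hN : 0 < N) (hδ : 0 < δ) (hlam : 0 ≤ lam)
    (h : StateEvo δ σ (empDist θ) lam β τ) : SEPoint δ σ θ β τ (τ * lam / β) := by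
  have hβτ := h.beta_eq hN hδ
  obtain ⟨hβ, hτ, h1, -⟩ := h
  have hb : 0 ≤ τ * lam / β := by positivity
  have hN' : (0 : ℝ) < N := by positivity
  have hsum : ∑ i, ∫ z, seErr θ τ (τ * lam / β) i z ^ 2 ∂stdG = N * (δ * (τ ^ 2 - σ ^ 2)) := by
    rw [integral_empDist_prod_stdG
      (F := fun q => (eta (q.1 + τ * q.2) (τ * lam / β) - q.1) ^ 2) θ] at h1
    · rw [h1]
      unfold seErr
      field_simp
      ring
    · exact ((((continuous_eta hb).comp (by fun_prop :
        Continuous fun q : ℝ × ℝ => q.1 + τ * q.2)).sub continuous_fst).pow 2).measurable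
    · exact fun i => integrable_seErr_sq hτ.le hb i
  refine ⟨hβ, ?_, ?_, hsum, ?_⟩
  · have h0 : 0 ≤ ∑ i, ∫ z, seErr θ τ (τ * lam / β) i z ^ 2 ∂stdG :=
      Finset.sum_nonneg fun i _ => integral_nonneg fun z => sq_nonneg _
    rw [hsum] at h0
    have h3 : 0 ≤ τ ^ 2 - σ ^ 2 := by
      by_contra hc
      push Not at hc
      have := mul_neg_of_pos_of_neg hN' (mul_neg_of_pos_of_neg hδ hc)
      linarith
    exact le_of_sq_le_sq (by linarith) hτ.le
  · have h0 : 0 ≤ N * (δ * (τ - β)) := by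
      rw [hβτ]
      exact mul_nonneg hτ.le (Finset.sum_nonneg fun i _ => measureReal_nonneg)
    by_contra hc
    push Not at hc
    have := mul_neg_of_pos_of_neg hN' (mul_neg_of_pos_of_neg hδ (sub_neg.2 hc))
    linarith
  · rw [hβτ, Finset.mul_sum]
    exact Finset.sum_congr rfl fun i _ => integral_mul_seErr hτ hb i

end

lemma integral_posPart_abs_sub_pos (A : ℝ) : 0 < ∫ z, max (|z| - A) 0 ∂stdG := by
  refine (integral_pos_iff_support_of_nonneg (f := fun z => max (|z| - A) 0)
    (fun z => le_max_right _ _) ?_).2 ?_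
  rotate_left
  · have h1 : Set.Ioi (max A 0) ⊆ Function.support fun z : ℝ => max (|z| - A) 0 := by
      intro z hz
      rw [Set.mem_Ioi, max_lt_iff] at hz
      rw [Function.mem_support, abs_of_pos hz.2, max_eq_left (by linarith)]
      linarith
    refine lt_of_lt_of_le ?_ (measure_mono h1)
    rw [pos_iff_ne_zero]
    intro h0
    have := gaussianReal_absolutelyContinuous' 0 (v := 1) (by norm_num) h0
    simp at this
  · refine integrable_stdG_of_le (K := 1 + |A|) (by fun_prop) fun z => ?_
    rw [abs_of_nonneg (le_max_right _ _)]
    refine max_le ?_ (by positivity)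
    nlinarith [neg_abs_le A, abs_nonneg A, sq_abs z, sq_nonneg (|z| - 1),
      mul_nonneg (abs_nonneg A) (sq_nonneg z)]

lemma integrable_abs_stdG : Integrable (fun z : ℝ => |z|) stdG :=
  integrable_stdG_of_le (K := 1) (by fun_prop) fun z => by
    rw [abs_abs]; nlinarith [sq_nonneg (|z| - 1), sq_abs z, sq_nonneg z]

lemma integral_abs_stdG_le : ∫ z, |z| ∂stdG ≤ 1 := by
  have h : ∫ z, |z| ∂stdG ≤ ∫ z : ℝ, (1 + z ^ 2) / 2 ∂stdG :=
    integral_mono integrable_abs_stdG (((integrable_const _).add integrable_sq_stdG).div_const _)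
      fun z => by
        have := sq_nonneg (|z| - 1); have := sq_abs z
        simp only; linarith
  rw [integral_div, integral_add (integrable_const _) integrable_sq_stdG, integral_sq_stdG] at h
  simp at h
  linarith

/-- Uniform bounds on the state evolution parameters. -/
lemma exists_stateEvo_bounds {δ σ lmin lmax p ξ : ℝ} (hδ : 0 < δ) (hσ : 0 < σ) (hl : 0 < lmin)
    (hp : 0 < p) (hξ : 0 < ξ) :
    ∃ A T : ℝ, 0 < A ∧ 0 < T ∧ ∀ (N : ℕ), 0 < N → ∀ θ ∈ Fball N p ξ, ∀ lam ∈ Set.Icc lmin lmax,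
      ∀ β τ, StateEvo δ σ (empDist θ) lam β τ → lam / β ≤ A ∧ τ ≤ T := by
  have htail : ∀ a : ℝ, 0 < a → Filter.Tendsto (fun x : ℝ => (a / x) ^ p) Filter.atTop (nhds 0) := by
    intro a _
    have h1 : Filter.Tendsto (fun x : ℝ => a / x) Filter.atTop (nhds 0) :=
      tendsto_const_nhds.div_atTop Filter.tendsto_id
    have h2 := h1.rpow_const (p := p) (Or.inr hp.le)
    rwa [Real.zero_rpow hp.ne'] at h2
  obtain ⟨A₀, hA₀, hA₀'⟩ : ∃ A₀ : ℝ, 0 < A₀ ∧ ∀ x ≥ A₀,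
      (2 * ξ / σ / x) ^ p + 3 / 2 * Real.exp (-(x / 2) ^ 2 / 4) < δ / 2 := by
    have h1 : Filter.Tendsto (fun x : ℝ => Real.exp (-(x / 2) ^ 2 / 4)) Filter.atTop (nhds 0) := by
      refine Real.tendsto_exp_atBot.comp ?_
      have : (fun x : ℝ => -(x / 2) ^ 2 / 4) = fun x => (-1 / 16) * x ^ 2 := by ext x; ring
      rw [this]
      exact (Filter.tendsto_pow_atTop two_ne_zero).const_mul_atTop_of_neg (by norm_num)
    have h2 := (htail (2 * ξ / σ) (by positivity)).add (h1.const_mul (3 / 2))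
    rw [mul_zero, add_zero] at h2
    obtain ⟨a, ha⟩ := Filter.eventually_atTop.1
      ((tendsto_order.1 h2).2 (δ / 2) (by positivity))
    exact ⟨max a 1, by positivity, fun x hx => ha x ((le_max_left _ _).trans hx)⟩
  set A := max A₀ (2 * lmax / σ) with hA
  have hA0 : 0 < A := lt_max_of_lt_left hA₀
  set c₀ := ∫ z, max (|z| - A) 0 ∂stdG with hc₀
  have hc₀0 : 0 < c₀ := integral_posPart_abs_sub_pos A
  obtain ⟨T₀, hT₀, hT₀'⟩ : ∃ T₀ : ℝ, 0 < T₀ ∧ ∀ x ≥ T₀,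
      (2 + A) * (4 * ξ / c₀ / x) ^ p < c₀ / 2 := by
    have h2 := (htail (4 * ξ / c₀) (by positivity)).const_mul (2 + A)
    rw [mul_zero] at h2
    obtain ⟨a, ha⟩ := Filter.eventually_atTop.1
      ((tendsto_order.1 h2).2 (c₀ / 2) (by positivity))
    exact ⟨max a 1, by positivity, fun x hx => ha x ((le_max_left _ _).trans hx)⟩
  refine ⟨A, max T₀ (σ ^ 2 * A / lmin), hA0, lt_max_of_lt_left hT₀, ?_⟩
  intro N hN θ hθ lam hlam β τ hSE
  have hlam0 : 0 < lam := hl.trans_le hlam.1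
  have hN' : (0 : ℝ) < N := by positivity
  have hpt := hSE.sePoint hN hδ hlam0.le
  have hβ := hpt.beta_pos
  have hτ : 0 < τ := hσ.trans_le hpt.sigma_le
  set α := lam / β with hα
  have hα0 : 0 < α := by positivity
  have hbα : τ * lam / β = τ * α := by rw [hα]; ring
  have hαA : α ≤ A := by
    by_contra hc
    push Not at hc
    have hαA₀ : A₀ ≤ α := (le_max_left _ _).trans hc.le
    have h1 : ∀ i, stdG.real {z | τ * lam / β < |θ i + τ * z|} ≤
        (if σ * α / 2 < |θ i| then 1 else 0) + 3 / 2 * Real.exp (-(α / 2) ^ 2 / 4) := by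
      intro i
      split_ifs with hi
      · have : 0 < 3 / 2 * Real.exp (-(α / 2) ^ 2 / 4) := by positivity
        have : stdG.real {z | τ * lam / β < |θ i + τ * z|} ≤ 1 := measureReal_le_one
        linarith
      · rw [zero_add]
        refine le_trans (measureReal_mono ?_) (stdG_abs_ge_le (by positivity))
        intro z hz
        rw [Set.mem_ofPred_eq] at *
        have h2 := abs_add_le (θ i) (τ * z)
        rw [abs_mul, abs_of_pos hτ] at h2
        rw [hbα] at hz
        push Not at hi
        have h3 : σ * α ≤ τ * α := mul_le_mul_of_nonneg_right hpt.sigma_le hα0.le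
        by_contra hcc
        push Not at hcc
        have := mul_lt_mul_of_pos_left hcc hτ
        linarith
    have h2 : ∑ i, stdG.real {z | τ * lam / β < |θ i + τ * z|} ≤ N * (δ / 2) := by
      refine (Finset.sum_le_sum fun i _ => h1 i).trans ?_
      rw [Finset.sum_add_distrib, Finset.sum_const, Finset.sum_boole]
      have h3 := card_abs_gt_le hN hp hξ (t := σ * α / 2) (by positivity) hθ
      have h4 : ξ / (σ * α / 2) = 2 * ξ / σ / α := by field_simp
      rw [h4] at h3
      have h5 := mul_le_mul_of_nonneg_left (hA₀' α hαA₀).le hN'.le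
      simp only [Finset.card_univ, Fintype.card_fin, nsmul_eq_mul]
      linarith
    have h3 := hSE.beta_eq hN hδ
    have h4 : N * (δ * (τ - β)) ≤ τ * (N * (δ / 2)) := by
      rw [h3]; exact mul_le_mul_of_nonneg_left h2 hτ.le
    have h5 : τ - β ≤ τ / 2 := by
      have : (N * δ) * (τ - β) ≤ (N * δ) * (τ / 2) := by linarith
      exact le_of_mul_le_mul_left this (by positivity)
    have h6 : α ≤ 2 * lmax / σ := by
      rw [hα, div_le_div_iff₀ hβ hσ]
      have := hpt.sigma_le
      have h7 := mul_le_mul hlam.2 (by linarith : σ ≤ 2 * β) hσ.le (hlam0.le.trans hlam.2)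
      linarith
    exact absurd (h6.trans (le_max_right A₀ _)) (not_le.2 hc)
  refine ⟨hαA, ?_⟩
  by_contra hc
  push Not at hc
  have hτT₀ : T₀ ≤ τ := (le_max_left _ _).trans hc.le
  have hb : 0 ≤ τ * lam / β := by positivity
  set b := τ * lam / β with hbdef
  have hidz : Integrable (fun z : ℝ => z) stdG := by
    simpa using (integrable_abs_stdG.mono' (f := fun z : ℝ => z) (by fun_prop)
      (Filter.Eventually.of_forall fun z => le_rfl))
  have hcont : Integrable (fun z : ℝ => max (|z| - A) 0) stdG :=
    integrable_stdG_of_le (K := 1) (by fun_prop) fun z => by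
      rw [abs_of_nonneg (le_max_right _ _)]
      refine max_le ?_ (by positivity)
      nlinarith [sq_abs z, sq_nonneg (|z| - 1)]
  have hmain : ∀ i, b * τ * (c₀ / 2 - (if c₀ / 4 * τ < |θ i| then (2 + A) else 0)) ≤
      τ * (∫ z, z * seErr θ τ b i z ∂stdG) - ∫ z, seErr θ τ b i z ^ 2 ∂stdG := by
    intro i
    have hval : ∀ z, τ * (z * seErr θ τ b i z) - seErr θ τ b i z ^ 2 =
        (θ i + τ * z - eta (θ i + τ * z) b) * seErr θ τ b i z := fun z => by
      unfold seErr; ring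
    have hRint : Integrable (fun z => τ * (z * seErr θ τ b i z) - seErr θ τ b i z ^ 2) stdG :=
      ((integrable_mul_seErr hτ.le hb i).const_mul τ).sub (integrable_seErr_sq hτ.le hb i)
    rw [← integral_const_mul, ← integral_sub ((integrable_mul_seErr hτ.le hb i).const_mul τ)
      (integrable_seErr_sq hτ.le hb i)]
    split_ifs with hi
    · have hpt2 : ∀ z : ℝ, b * τ * (max (|z| - A) 0 - 2 * |z| - A) ≤
          τ * (z * seErr θ τ b i z) - seErr θ τ b i z ^ 2 := by
        intro z
        rw [hval]
        have h1 := abs_sub_eta_le (x := θ i + τ * z) hb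
        set r := θ i + τ * z - eta (θ i + τ * z) b with hr
        have h2 : seErr θ τ b i z = τ * z - r := by unfold seErr; rw [hr]; ring
        rw [h2]
        have h3 : r ^ 2 ≤ b * b := by rw [← sq_abs, sq]; exact mul_le_mul h1 h1 (abs_nonneg _) hb
        have h4 : -(b * |z|) ≤ r * z := by
          have := neg_abs_le (r * z)
          rw [abs_mul] at this
          have := mul_le_mul_of_nonneg_right h1 (abs_nonneg z)
          linarith
        have h5 : b = τ * α := hbα
        have h6 : max (|z| - A) 0 ≤ |z| := max_le (by linarith) (abs_nonneg z)
        have h7 : b * b ≤ b * τ * A := by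
          rw [mul_assoc]
          refine mul_le_mul_of_nonneg_left ?_ hb
          rw [h5]; exact mul_le_mul_of_nonneg_left hαA hτ.le
        have h8 := mul_le_mul_of_nonneg_left h4 hτ.le
        have h9 := mul_le_mul_of_nonneg_left h6 (mul_nonneg hb hτ.le)
        nlinarith
      have h := integral_mono (((hcont.sub (integrable_abs_stdG.const_mul 2)).sub
        (integrable_const A)).const_mul (b * τ)) hRint hpt2
      refine le_trans ?_ h
      rw [integral_const_mul]
      refine mul_le_mul_of_nonneg_left ?_ (mul_nonneg hb hτ.le)
      rw [integral_sub' (hcont.sub (integrable_abs_stdG.const_mul 2)) (integrable_const A),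
        integral_sub' hcont (integrable_abs_stdG.const_mul 2), integral_const_mul, ← hc₀]
      have := integral_abs_stdG_le
      simp
      linarith
    · push Not at hi
      have hpt2 : ∀ z : ℝ, b * τ * (max (|z| - A) 0 - c₀ / 2) ≤
          τ * (z * seErr θ τ b i z) - seErr θ τ b i z ^ 2 := by
        intro z
        rw [hval]
        have h1 := eta_prox (x := θ i + τ * z) hb (θ i)
        have h2 := abs_eta_sub_eta_le (x := τ * z) (y := θ i + τ * z) hb
        have h3 := abs_sub_eta_le (x := τ * z) hb
        have h4 : τ * max (|z| - A) 0 ≤ |eta (τ * z) b| := by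
          rw [mul_max_of_nonneg _ _ hτ.le, mul_zero]
          refine max_le ?_ (abs_nonneg _)
          have h5 := abs_sub_abs_le_abs_sub (τ * z) (eta (τ * z) b)
          rw [abs_mul, abs_of_pos hτ] at h5
          have h6 : b ≤ τ * A := by rw [hbα]; exact mul_le_mul_of_nonneg_left hαA hτ.le
          linarith
        have h5 : |eta (τ * z) b| - |eta (θ i + τ * z) b| ≤ |θ i| := by
          refine (abs_sub_abs_le_abs_sub _ _).trans (h2.trans (le_of_eq ?_))
          rw [show τ * z - (θ i + τ * z) = -θ i by ring, abs_neg]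
        have h6 : b * (|eta (θ i + τ * z) b| - |θ i|) ≥ b * (τ * (max (|z| - A) 0 - c₀ / 2)) :=
          mul_le_mul_of_nonneg_left (by linarith) hb
        unfold seErr
        linarith
      have h := integral_mono ((hcont.sub (integrable_const (c₀ / 2))).const_mul (b * τ)) hRint hpt2
      refine le_trans ?_ h
      rw [integral_const_mul]
      refine mul_le_mul_of_nonneg_left ?_ (mul_nonneg hb hτ.le)
      rw [integral_sub' hcont (integrable_const (c₀ / 2)), ← hc₀]
      simp
      linarith
  have hsum := Finset.sum_le_sum fun i (_ : i ∈ Finset.univ) => hmain i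
  rw [Finset.sum_sub_distrib, ← Finset.mul_sum, ← Finset.mul_sum, hpt.sum_mul, hpt.sum_sq,
    Finset.sum_sub_distrib, ← Finset.sum_filter, Finset.sum_const, Finset.sum_const] at hsum
  simp only [Finset.card_univ, Fintype.card_fin, nsmul_eq_mul] at hsum
  have h3 := card_abs_gt_le hN hp hξ (t := c₀ / 4 * τ) (by positivity) hθ
  have h4 : ξ / (c₀ / 4 * τ) = 4 * ξ / c₀ / τ := by field_simp
  rw [h4] at h3
  have h5 := hT₀' τ hτT₀
  have h6 : 0 ≤ N * (c₀ / 2) -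
      ((Finset.univ.filter fun i => c₀ / 4 * τ < |θ i|).card : ℝ) * (2 + A) := by
    have h7 := mul_le_mul_of_nonneg_right h3 (by positivity : (0 : ℝ) ≤ 2 + A)
    have h8 := mul_le_mul_of_nonneg_left h5.le hN'.le
    linarith
  have h7 := (mul_nonneg (mul_nonneg hb hτ.le) h6).trans hsum
  have h8 : 0 ≤ (N * δ) * (σ ^ 2 - τ * β) := by linarith
  have h9 : τ * β ≤ σ ^ 2 := by
    have := nonneg_of_mul_nonneg_right h8 (by positivity)
    linarith
  have h10 : lmin ≤ A * β := by
    have : lam ≤ A * β := by rw [hα, div_le_iff₀ hβ] at hαA; exact hαA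
    linarith [hlam.1]
  have h11 : τ ≤ σ ^ 2 * A / lmin := by
    rw [le_div_iff₀ hl]
    calc τ * lmin ≤ τ * (A * β) := mul_le_mul_of_nonneg_left h10 hτ.le
      _ = A * (τ * β) := by ring
      _ ≤ A * σ ^ 2 := mul_le_mul_of_nonneg_left h9 hA0.le
      _ = σ ^ 2 * A := by ring
  exact absurd (h11.trans (le_max_right T₀ _)) (not_le.2 hc)

instance : NullSingletonClass stdG := by
  unfold stdG; exact nullSingletonClass_gaussianReal one_ne_zero

lemma stdG_pos_of_isOpen {s : Set ℝ} (hs : IsOpen s) (hne : s.Nonempty) : 0 < stdG.real s := by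
  rw [measureReal_def]
  refine ENNReal.toReal_pos (fun h0 => ?_) (measure_ne_top _ _)
  exact (hs.measure_pos volume hne).ne'
    (gaussianReal_absolutelyContinuous' 0 (v := 1) (by norm_num) h0)

lemma strictMono_stdG_Iic : StrictMono fun z => stdG.real (Set.Iic z) := by
  intro a b hab
  have h1 : Set.Iic b = Set.Iic a ∪ Set.Ioc a b := (Set.Iic_union_Ioc_eq_Iic hab.le).symm
  have h2 : 0 < stdG.real (Set.Ioc a b) :=
    (stdG_pos_of_isOpen isOpen_Ioo (Set.nonempty_Ioo.2 hab)).trans_le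
      (measureReal_mono Set.Ioo_subset_Ioc_self)
  simp only
  rw [h1, measureReal_union _ measurableSet_Ioc]
  · linarith
  · rw [Set.disjoint_left]
    intro x hx hx'
    exact absurd hx'.1 (not_lt.2 hx)

lemma stdG_Iic_lt_one (z : ℝ) : stdG.real (Set.Iic z) < 1 :=
  (strictMono_stdG_Iic (lt_add_one z)).trans_le measureReal_le_one

lemma continuous_stdG_Iic : Continuous fun z => stdG.real (Set.Iic z) := by
  have h1 : (fun z => stdG.real (Set.Iic z)) = cdf stdG := funext fun z => (cdf_eq_real _ z).symm
  rw [h1, continuous_iff_continuousAt]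
  intro a
  rw [(cdf stdG).mono.continuousAt_iff_leftLim_eq_rightLim, StieltjesFunction.rightLim_eq]
  have h2 := (cdf stdG).measure_singleton a
  rw [measure_cdf, measure_singleton, eq_comm, ENNReal.ofReal_eq_zero] at h2
  exact le_antisymm ((cdf stdG).mono.leftLim_le le_rfl) (by linarith)

/-- The Gaussian distribution function transports the Gaussian to the uniform law. -/
lemma stdG_setOf_Iic_lt {u : ℝ} (hu : 0 ≤ u) (hu' : u ≤ 1) :
    stdG.real {z | stdG.real (Set.Iic z) < u} = u := by
  rcases hu.eq_or_lt with rfl | h0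
  · have : {z | stdG.real (Set.Iic z) < 0} = ∅ := by
      ext z; simp
    rw [this]; simp
  rcases hu'.eq_or_lt with rfl | h1
  · have : {z | stdG.real (Set.Iic z) < 1} = Set.univ := by
      ext z; simp [stdG_Iic_lt_one z]
    rw [this]; simp
  have ha : ∃ a, stdG.real (Set.Iic a) ≤ u := by
    have h := (tendsto_order.1 (tendsto_cdf_atBot stdG)).2 u h0
    obtain ⟨a, ha⟩ := h.exists
    exact ⟨a, by rw [← cdf_eq_real]; exact ha.le⟩
  have hb : ∃ a, u ≤ stdG.real (Set.Iic a) := by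
    have h := (tendsto_order.1 (tendsto_cdf_atTop stdG)).1 u h1
    obtain ⟨a, ha⟩ := h.exists
    exact ⟨a, by rw [← cdf_eq_real]; exact ha.le⟩
  obtain ⟨c, hc⟩ := mem_range_of_exists_le_of_exists_ge continuous_stdG_Iic ha hb
  simp only at hc
  have : {z | stdG.real (Set.Iic z) < u} = Set.Iio c := by
    ext z
    rw [Set.mem_ofPred_eq, ← hc, Set.mem_Iio]
    exact strictMono_stdG_Iic.lt_iff_lt
  rw [this, ← hc]
  exact measureReal_congr Iio_ae_eq_Iic

lemma measureReal_symmDiff_of_isLowerSet {A B : Set ℝ} (hA : IsLowerSet A) (hB : IsLowerSet B)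
    (hAm : MeasurableSet A) (hBm : MeasurableSet B) :
    stdG.real {z | ¬(z ∈ A ↔ z ∈ B)} = |stdG.real A - stdG.real B| := by
  rcases hA.total hB with h | h
  · have h1 : {z | ¬(z ∈ A ↔ z ∈ B)} = B \ A := by
      ext z
      have := @h z
      simp only [Set.mem_ofPred_eq, Set.mem_sdiff]; tauto
    rw [h1, measureReal_sdiff h hAm, abs_sub_comm, abs_of_nonneg (sub_nonneg.2 (measureReal_mono h))]
  · have h1 : {z | ¬(z ∈ A ↔ z ∈ B)} = A \ B := by
      ext z
      have := @h z
      simp only [Set.mem_ofPred_eq, Set.mem_sdiff]; tauto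
    rw [h1, measureReal_sdiff h hBm, abs_of_nonneg (sub_nonneg.2 (measureReal_mono h))]

/-- Monotone rearrangement coupling of the uniform law on `S` with the Gaussian. -/
lemma exists_monotone_coupling {N : ℕ} (S : Finset (Fin N)) (hS : S.Nonempty) (g : Fin N → ℝ) :
    ∃ ρ : ℝ → Fin N, Measurable ρ ∧ (∀ z, ρ z ∈ S) ∧
      (∀ i ∈ S, stdG.real (ρ ⁻¹' {i}) = 1 / S.card) ∧ Monotone fun z => g (ρ z) := by
  set m := S.card with hm
  have hm0 : 0 < m := Finset.card_pos.2 hS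
  have hm0' : (0 : ℝ) < m := by positivity
  set o := S.orderEmbOfFin hm.symm with ho
  set π := Tuple.sort (g ∘ o) with hπ
  have hmono : Monotone ((g ∘ o) ∘ π) := Tuple.monotone_sort _
  set e : Fin m → Fin N := fun r => o (π r) with he
  have hinj : Function.Injective e := o.injective.comp π.injective
  have hfl : ∀ z, ⌊m * stdG.real (Set.Iic z)⌋₊ < m := fun z => by
    rw [Nat.floor_lt (by positivity)]
    have := mul_lt_mul_of_pos_left (stdG_Iic_lt_one z) hm0'
    linarith
  set E : ℕ → Fin N := fun k => if h : k < m then e ⟨k, h⟩ else e ⟨0, hm0⟩ with hE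
  have hEr : ∀ z, E ⌊m * stdG.real (Set.Iic z)⌋₊ = e ⟨_, hfl z⟩ := fun z => by
    simp only [hE]; rw [dif_pos (hfl z)]
  refine ⟨fun z => E ⌊m * stdG.real (Set.Iic z)⌋₊, ?_, ?_, ?_, ?_⟩
  · exact (measurable_of_countable E).comp
      (Nat.measurable_floor.comp ((continuous_stdG_Iic.const_mul _).measurable))
  · intro z
    simp only [hEr]
    exact Finset.orderEmbOfFin_mem S hm.symm _
  · intro i hi
    have hir : i ∈ Set.range o := by rw [ho, Finset.range_orderEmbOfFin]; exact hi
    obtain ⟨r₀, hr₀⟩ := hir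
    obtain ⟨r, rfl⟩ := π.surjective r₀
    have hset : (fun z => E ⌊m * stdG.real (Set.Iic z)⌋₊) ⁻¹' {i} =
        {z | stdG.real (Set.Iic z) < ((r : ℕ) + 1 : ℝ) / m} \
          {z | stdG.real (Set.Iic z) < ((r : ℕ) : ℝ) / m} := by
      ext z
      simp only [Set.mem_preimage, Set.mem_singleton_iff, hEr, Set.mem_sdiff, Set.mem_ofPred_eq,
        not_lt]
      rw [← hr₀, lt_div_iff₀ hm0', div_le_iff₀ hm0']
      change e _ = e r ↔ _
      rw [hinj.eq_iff, Fin.ext_iff, Nat.floor_eq_iff (by positivity), mul_comm, and_comm]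
    have hr1 : ((r : ℕ) : ℝ) + 1 ≤ m := by exact_mod_cast r.2
    rw [hset, measureReal_sdiff]
    · rw [stdG_setOf_Iic_lt (by positivity) ((div_le_one hm0').2 hr1),
        stdG_setOf_Iic_lt (by positivity) ((div_le_one hm0').2 (by linarith))]
      ring
    · intro z hz
      rw [Set.mem_ofPred_eq] at *
      exact hz.trans_le (div_le_div_of_nonneg_right (by linarith) hm0'.le)
    · exact measurableSet_lt continuous_stdG_Iic.measurable measurable_const
  · intro a b hab
    simp only [hEr]
    refine hmono ?_
    rw [Fin.le_def]
    exact Nat.floor_le_floor (mul_le_mul_of_nonneg_left (strictMono_stdG_Iic.monotone hab) hm0'.le)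

/-- Maps coupling the uniform law on indices with the product of itself and the Gaussian. -/
def IsPlan {N : ℕ} (ι : Fin N → ℝ → Fin N) : Prop :=
  (∀ j, Measurable (ι j)) ∧ ∀ i, ∑ j, stdG.real (ι j ⁻¹' {i}) = 1

/-- Quadratic cost of a plan. -/
def planCost {N : ℕ} (θ w : Fin N → ℝ) (e : Fin N → ℝ → ℝ) (ι : Fin N → ℝ → Fin N) : ℝ :=
  (∑ j, ∫ z, ((θ (ι j z) + w (ι j z) - (θ j + e j z)) ^ 2 + (θ (ι j z) - θ j) ^ 2) ∂stdG) / N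

section
variable {N : ℕ} {ι : Fin N → ℝ → Fin N}

lemma measurable_comp_plan (hι : IsPlan ι) {E : Type*} [MeasurableSpace E] (φ : Fin N → E)
    (j : Fin N) : Measurable fun z => φ (ι j z) :=
  (measurable_of_countable φ).comp (hι.1 j)

lemma integrable_comp_plan (hι : IsPlan ι) (φ : Fin N → ℝ) (j : Fin N) :
    Integrable (fun z => φ (ι j z)) stdG := by
  refine (integrable_const (∑ i, |φ i|)).mono' (measurable_comp_plan hι φ j).aestronglyMeasurable
    (Filter.Eventually.of_forall fun z => ?_)
  exact Finset.single_le_sum (f := fun i => |φ i|) (fun i _ => abs_nonneg _) (Finset.mem_univ _)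

lemma integral_comp_eq_sum {ρ : ℝ → Fin N} (hρ : Measurable ρ) (φ : Fin N → ℝ) :
    ∫ z, φ (ρ z) ∂stdG = ∑ i, stdG.real (ρ ⁻¹' {i}) * φ i := by
  have h : ∀ z, φ (ρ z) = ∑ i, (ρ ⁻¹' {i}).indicator (fun _ => φ i) z := fun z => by
    rw [Finset.sum_eq_single (ρ z)]
    · rw [Set.indicator_of_mem (by simp)]
    · exact fun i _ hi => Set.indicator_of_notMem (fun hz => hi hz.symm) _
    · exact fun hi => absurd (Finset.mem_univ _) hi
  simp_rw [h]
  rw [integral_finsetSum]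
  · refine Finset.sum_congr rfl fun i _ => ?_
    rw [integral_indicator_const _ (hρ (measurableSet_singleton i)), smul_eq_mul]
  · exact fun i _ => (integrable_const _).indicator (hρ (measurableSet_singleton i))

lemma IsPlan.sum_integral_comp (hι : IsPlan ι) (φ : Fin N → ℝ) :
    ∑ j, ∫ z, φ (ι j z) ∂stdG = ∑ i, φ i := by
  simp_rw [integral_comp_eq_sum (hι.1 _)]
  rw [Finset.sum_comm]
  refine Finset.sum_congr rfl fun i _ => ?_
  rw [← Finset.sum_mul, hι.2, one_mul]

lemma IsPlan.sum_measure_preimage (hι : IsPlan ι) (s : Set (Fin N)) :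
    ∑ j, stdG (ι j ⁻¹' s) = ∑ i, s.indicator 1 i := by
  have h1 : ∀ j, stdG.real (ι j ⁻¹' s) = ∫ z, s.indicator 1 (ι j z) ∂stdG := fun j => by
    have := integral_indicator_one (μ := stdG) ((hι.1 j) s.toFinite.measurableSet)
    rw [← this]
    rfl
  have h2 : (∑ j, stdG (ι j ⁻¹' s)).toReal = (∑ i, s.indicator (1 : Fin N → ℝ≥0∞) i).toReal := by
    rw [ENNReal.toReal_sum fun j _ => measure_ne_top _ _, ENNReal.toReal_sum]
    · calc ∑ j, (stdG (ι j ⁻¹' s)).toReal = ∑ j, ∫ z, s.indicator 1 (ι j z) ∂stdG :=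
            Finset.sum_congr rfl fun j _ => h1 j
        _ = ∑ i, s.indicator 1 i := hι.sum_integral_comp _
        _ = _ := Finset.sum_congr rfl fun i _ => by
            by_cases hi : i ∈ s <;> simp [hi]
    · intro i _
      by_cases hi : i ∈ s <;> simp [hi]
  refine (ENNReal.toReal_eq_toReal_iff' ?_ ?_).1 h2
  · exact ENNReal.sum_ne_top.2 fun j _ => measure_ne_top _ _
  · refine ENNReal.sum_ne_top.2 fun i _ => ?_
    by_cases hi : i ∈ s <;> simp [hi]

/-- The Wasserstein distance is bounded by the cost of any plan. -/
lemma W2sq_le_planCost (hι : IsPlan ι) (θ u : Fin N → ℝ) {τ α : ℝ} (hτ : 0 ≤ τ) (hα : 0 ≤ α) :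
    W2sq (empDist2 u θ) (muStar (empDist θ) τ α) ≤
      planCost θ (fun i => u i - θ i) (seErr θ τ (α * τ)) ι := by
  have hb : 0 ≤ α * τ := mul_nonneg hα hτ
  have hce : ∀ j : Fin N, Continuous fun z => eta (θ j + τ * z) (α * τ) := fun j =>
    (continuous_eta hb).comp (by fun_prop)
  have hceq : Continuous fun q : ℝ × ℝ => (eta (q.1 + τ * q.2) (α * τ), q.1) :=
    ((continuous_eta hb).comp
      (by fun_prop : Continuous fun q : ℝ × ℝ => q.1 + τ * q.2)).prodMk continuous_fst
  set G : Fin N → ℝ → (ℝ × ℝ) × (ℝ × ℝ) := fun j z =>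
    ((u (ι j z), θ (ι j z)), (eta (θ j + τ * z) (α * τ), θ j)) with hG
  have hGm : ∀ j, Measurable (G j) := fun j =>
    (measurable_comp_plan hι (fun i => (u i, θ i)) j).prodMk
      ((hce j).measurable.prodMk measurable_const)
  set γ : Measure ((ℝ × ℝ) × (ℝ × ℝ)) := (N : ℝ≥0∞)⁻¹ • ∑ j, stdG.map (G j) with hγ
  refine csInf_le ⟨0, ?_⟩ ⟨γ, ?_, ?_, ?_⟩
  · rintro r ⟨γ', -, -, rfl⟩
    exact integral_nonneg fun q => by positivity
  · ext s hs
    rw [Measure.map_apply measurable_fst hs, hγ]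
    unfold empDist2
    simp only [Measure.smul_apply, Measure.finsetSum_apply, smul_eq_mul]
    congr 1
    have h1 : ∀ j, stdG.map (G j) (Prod.fst ⁻¹' s) = stdG (ι j ⁻¹' {i | (u i, θ i) ∈ s}) :=
      fun j => by
        rw [Measure.map_apply (hGm j) (measurable_fst hs)]
        rfl
    simp_rw [h1]
    rw [hι.sum_measure_preimage]
    refine Finset.sum_congr rfl fun i _ => ?_
    rw [Measure.dirac_apply' _ hs]
    by_cases hi : (u i, θ i) ∈ s <;> simp [hi]
  · ext s hs
    rw [Measure.map_apply measurable_snd hs, hγ]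
    unfold muStar empDist
    rw [Measure.map_apply hceq.measurable hs, Measure.prod_smul_left, ← Measure.sum_fintype,
      ← Measure.sum_fintype, Measure.prod_sum_left, Measure.smul_apply, Measure.smul_apply,
      Measure.sum_fintype, Measure.sum_fintype]
    simp only [Measure.finsetSum_apply]
    congr 1
    refine Finset.sum_congr rfl fun j _ => ?_
    rw [Measure.map_apply (hGm j) (measurable_snd hs), Measure.dirac_prod,
      Measure.map_apply (by fun_prop) (hceq.measurable hs)]
    rfl
  · have hF : Continuous fun q : (ℝ × ℝ) × (ℝ × ℝ) =>
        (q.1.1 - q.2.1) ^ 2 + (q.1.2 - q.2.2) ^ 2 := by fun_prop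
    have hint : ∀ j, Integrable (fun z => (u (ι j z) - eta (θ j + τ * z) (α * τ)) ^ 2 +
        (θ (ι j z) - θ j) ^ 2) stdG := by
      intro j
      refine Integrable.add ?_ (integrable_comp_plan hι (fun i => (θ i - θ j) ^ 2) j)
      refine ((integrable_comp_plan hι (fun i => 2 * (u i - θ j) ^ 2) j).add
        ((integrable_seErr_sq (θ := θ) hτ hb j).const_mul 2)).mono'
        ((((measurable_comp_plan hι u j).sub (hce j).measurable).pow_const 2).aestronglyMeasurable)
        (Filter.Eventually.of_forall fun z => ?_)
      rw [Real.norm_eq_abs, abs_of_nonneg (sq_nonneg _)]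
      simp only [seErr, Pi.add_apply]
      nlinarith [sq_nonneg ((u (ι j z) - θ j) + (eta (θ j + τ * z) (α * τ) - θ j))]
    rw [hγ, integral_smul_measure, integral_finsetSum_measure]
    · unfold planCost
      simp only [ENNReal.toReal_inv, ENNReal.toReal_natCast, smul_eq_mul]
      rw [div_eq_inv_mul]
      congr 1
      refine Finset.sum_congr rfl fun j _ => ?_
      rw [integral_map (hGm j).aemeasurable hF.aestronglyMeasurable]
      refine integral_congr_ae (Filter.Eventually.of_forall fun z => ?_)
      simp [hG, seErr]
    · intro j _
      rw [integrable_map_measure hF.aestronglyMeasurable (hGm j).aemeasurable]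
      exact hint j

end

/-- Threshold counts approximate clipped values up to the mesh size. -/
lemma sum_threshold_bounds (a x : ℝ) {h : ℝ} (hh : 0 < h) (J : ℕ) :
    (0 ≤ h * ∑ l ∈ Finset.range J, (if x ≤ a + l * h then (1 : ℝ) else 0)) ∧
    h * ∑ l ∈ Finset.range J, (if x ≤ a + l * h then (1 : ℝ) else 0) ≤
      max 0 (min (J * h) (a + J * h - x)) ∧
    max 0 (min (J * h) (a + J * h - x)) ≤
      h * ∑ l ∈ Finset.range J, (if x ≤ a + l * h then (1 : ℝ) else 0) + h := by
  refine ⟨mul_nonneg hh.le (Finset.sum_nonneg fun l _ => by split_ifs <;> norm_num), ?_⟩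
  induction J with
  | zero => simp [hh.le]
  | succ J ih =>
    obtain ⟨ih1, ih2⟩ := ih
    have h0 : 0 ≤ h * ∑ l ∈ Finset.range J, (if x ≤ a + l * h then (1 : ℝ) else 0) :=
      mul_nonneg hh.le (Finset.sum_nonneg fun l _ => by split_ifs <;> norm_num)
    rw [Finset.sum_range_succ, mul_add]
    push_cast
    have hJ : (0 : ℝ) ≤ J * h := by positivity
    split_ifs with hx
    · have e1 : max 0 (min ((J + 1 : ℝ) * h) (a + (J + 1) * h - x)) =
          max 0 (min (J * h) (a + J * h - x)) + h := by
        rw [max_eq_right, max_eq_right, ← min_add_add_right]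
        · congr 1 <;> ring
        · exact le_min hJ (by linarith)
        · exact le_min (by linarith) (by linarith)
      rw [e1]; constructor <;> linarith
    · push Not at hx
      have e1 : max 0 (min (J * h) (a + J * h - x)) = 0 :=
        max_eq_left ((min_le_right _ _).trans (by linarith))
      rw [e1] at ih1 ih2
      constructor
      · rw [mul_zero, add_zero]
        exact ih1.trans (le_max_left _ _)
      · refine max_le (by linarith) ((min_le_right _ _).trans ?_)
        linarith

lemma sq_sub_le_threshold (x y : ℝ) {T h : ℝ} (hT : 0 ≤ T) (hh : 0 < h) {J : ℕ}
    (hJ : J * h = 2 * T) :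
    (x - y) ^ 2 ≤ 3 * max (|x| - T) 0 ^ 2 + 3 * max (|y| - T) 0 ^ 2 + 6 * T * h +
      6 * T * h * ∑ l ∈ Finset.range J, |(if x ≤ -T + l * h then (1 : ℝ) else 0) -
        (if y ≤ -T + l * h then (1 : ℝ) else 0)| := by
  have key : ∀ x : ℝ, |x - (T - max 0 (min (2 * T) (T - x)))| = max (|x| - T) 0 := by
    intro x
    rcases le_total x T with h1 | h1
    · rcases le_total (-T) x with h2 | h2
      · rw [min_eq_right (by linarith), max_eq_right (by linarith),
          max_eq_right (by rw [sub_nonpos, abs_le]; exact ⟨h2, h1⟩)]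
        simp
      · rw [min_eq_left (by linarith), max_eq_right (by linarith),
          abs_of_nonpos (show x ≤ 0 by linarith), max_eq_left (by linarith), abs_of_nonpos]
        · ring
        · linarith
    · rw [min_eq_right (by linarith), max_eq_left (by linarith),
          abs_of_nonneg (show 0 ≤ x by linarith), max_eq_left (by linarith), abs_of_nonneg]
      · ring
      · linarith
  obtain ⟨-, a1, a2⟩ := sum_threshold_bounds (-T) x hh J
  obtain ⟨-, b1, b2⟩ := sum_threshold_bounds (-T) y hh J
  have hTT : -T + 2 * T = T := by ring
  simp only [hJ, hTT] at a1 a2 b1 b2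
  have hS : |h * ∑ l ∈ Finset.range J, (if x ≤ -T + l * h then (1 : ℝ) else 0) -
      h * ∑ l ∈ Finset.range J, (if y ≤ -T + l * h then (1 : ℝ) else 0)| ≤
      h * ∑ l ∈ Finset.range J, |(if x ≤ -T + l * h then (1 : ℝ) else 0) -
        (if y ≤ -T + l * h then (1 : ℝ) else 0)| := by
    rw [← mul_sub, ← Finset.sum_sub_distrib, abs_mul, abs_of_pos hh]
    exact mul_le_mul_of_nonneg_left (Finset.abs_sum_le_sum_abs _ _) hh.le
  have kx := key x
  have ky := key y
  set u := max 0 (min (2 * T) (T - x)) with hu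
  set v := max 0 (min (2 * T) (T - y)) with hv
  set D := ∑ l ∈ Finset.range J, |(if x ≤ -T + l * h then (1 : ℝ) else 0) -
        (if y ≤ -T + l * h then (1 : ℝ) else 0)|
  have hu0 : 0 ≤ u := le_max_left _ _
  have hv0 : 0 ≤ v := le_max_left _ _
  have hu1 : u ≤ 2 * T := max_le (by linarith) (min_le_left _ _)
  have hv1 : v ≤ 2 * T := max_le (by linarith) (min_le_left _ _)
  have huv : |u - v| ≤ h * D + h := by
    rw [abs_le] at hS ⊢
    constructor <;> linarith [hS.1, hS.2]
  have huv2 : |u - v| ≤ 2 * T := by rw [abs_le]; constructor <;> linarith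
  have hsq : (u - v) ^ 2 ≤ 2 * T * (h * D + h) := by
    rw [← sq_abs, sq]
    exact mul_le_mul huv2 huv (abs_nonneg _) (by linarith)
  have e1 : max (|x| - T) 0 ^ 2 = (x - (T - u)) ^ 2 := by rw [← kx, sq_abs]
  have e2 : max (|y| - T) 0 ^ 2 = (y - (T - v)) ^ 2 := by rw [← ky, sq_abs]
  rw [e1, e2]
  set p := x - (T - u)
  set q := y - (T - v)
  have e3 : x - y = p - q - (u - v) := by simp only [p, q]; ring
  rw [e3]
  nlinarith [sq_nonneg (p + q), sq_nonneg (p + (u - v)), sq_nonneg (q - (u - v))]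

lemma sum_option_fiberwise {N K : ℕ} (bin : Fin N → Option (Fin K)) (f : Fin N → ℝ) :
    ∑ j, f j = ∑ j with bin j = none, f j + ∑ k, ∑ j with bin j = some k, f j := by
  rw [← Finset.sum_fiberwise Finset.univ bin f, Fintype.sum_option]

/-- The plan that sorts each bin of indices against the Gaussian. -/
lemma exists_bin_plan {N K : ℕ} (hN : 0 < N) (g : Fin N → ℝ) (bin : Fin N → Option (Fin K)) :
    ∃ ι : Fin N → ℝ → Fin N, IsPlan ι ∧ (∀ j, bin j = none → ∀ z, ι j z = j) ∧
      (∀ j z, bin (ι j z) = bin j) ∧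
      ∀ k t, ∑ j with bin j = some k,
        ∫ z, |(if g (ι j z) ≤ t then (1 : ℝ) else 0) - (if z ≤ t then (1 : ℝ) else 0)| ∂stdG =
        |∑ i with bin i = some k, ((if g i ≤ t then (1 : ℝ) else 0) - stdG.real (Set.Iic t))| := by
  set S : Fin K → Finset (Fin N) := fun k => Finset.univ.filter fun j => bin j = some k with hS
  have hex : ∀ k, ∃ ρ : ℝ → Fin N, (S k).Nonempty → Measurable ρ ∧ (∀ z, ρ z ∈ S k) ∧
      (∀ i ∈ S k, stdG.real (ρ ⁻¹' {i}) = 1 / (S k).card) ∧ Monotone fun z => g (ρ z) := by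
    intro k
    by_cases h : (S k).Nonempty
    · obtain ⟨ρ, hρ⟩ := exists_monotone_coupling (S k) h g
      exact ⟨ρ, fun _ => hρ⟩
    · exact ⟨fun _ => ⟨0, hN⟩, fun h' => absurd h' h⟩
  choose ρ hρ using hex
  set ι : Fin N → ℝ → Fin N := fun j => (bin j).elim (fun _ => j) ρ with hι
  have hn : ∀ j, bin j = none → ι j = fun _ => j := fun j hj => by simp [hι, hj]
  have hs : ∀ j k, bin j = some k → ι j = ρ k := fun j k hj => by simp [hι, hj]
  have hne : ∀ j k, bin j = some k → (S k).Nonempty := fun j k hj => ⟨j, by simp [hS, hj]⟩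
  have hbin : ∀ j z, bin (ι j z) = bin j := by
    intro j z
    rcases hj : bin j with _ | k
    · rw [hn j hj, hj]
    · rw [hs j k hj]
      have := (hρ k (hne j k hj)).2.1 z
      simpa [hS] using this
  have h0 : ∀ i j, bin i ≠ bin j → stdG.real (ι j ⁻¹' {i}) = 0 := by
    intro i j hij
    have : ι j ⁻¹' {i} = ∅ := by
      ext z
      simp only [Set.mem_preimage, Set.mem_singleton_iff, Set.mem_empty_iff_false, iff_false]
      rintro rfl
      exact hij (hbin j z)
    rw [this]; simp
  refine ⟨ι, ⟨?_, ?_⟩, fun j hj z => by rw [hn j hj], hbin, ?_⟩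
  · intro j
    rcases hj : bin j with _ | k
    · rw [hn j hj]; exact measurable_const
    · rw [hs j k hj]; exact (hρ k (hne j k hj)).1
  · intro i
    rcases hi : bin i with _ | k
    · rw [Finset.sum_eq_single i, hn i hi]
      · simp
      · intro j _ hji
        rcases hj : bin j with _ | k
        · rw [hn j hj]
          have : (fun _ : ℝ => j) ⁻¹' {i} = ∅ := by ext z; simp [hji]
          rw [this]; simp
        · exact h0 i j (by rw [hi, hj]; simp)
      · exact fun h => absurd (Finset.mem_univ _) h
    · have h1 : ∀ j, stdG.real (ι j ⁻¹' {i}) = if bin j = some k then 1 / ((S k).card : ℝ) else 0 := by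
        intro j
        split_ifs with hj
        · rw [hs j k hj, (hρ k (hne j k hj)).2.2.1 i (by simp [hS, hi])]
        · exact h0 i j (by rw [hi]; exact fun h => hj h.symm)
      simp_rw [h1]
      rw [← Finset.sum_filter, Finset.sum_const, nsmul_eq_mul]
      exact mul_one_div_cancel (Nat.cast_ne_zero.2 (Finset.card_pos.2 (hne i k hi)).ne')
  · intro k t
    by_cases hk : (S k).Nonempty
    · obtain ⟨hm, hmem, hmass, hmono⟩ := hρ k hk
      have hc : ((S k).card : ℝ) ≠ 0 := Nat.cast_ne_zero.2 (Finset.card_pos.2 hk).ne'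
      have h1 : ∀ j ∈ S k, ∫ z, |(if g (ι j z) ≤ t then (1 : ℝ) else 0) -
          (if z ≤ t then (1 : ℝ) else 0)| ∂stdG =
          |stdG.real {z | g (ρ k z) ≤ t} - stdG.real (Set.Iic t)| := by
        intro j hj
        have hjk : bin j = some k := by simpa [hS] using hj
        have hA : IsLowerSet {z | g (ρ k z) ≤ t} := fun a c hca ha => by
          rw [Set.mem_ofPred_eq] at ha ⊢
          exact (hmono hca).trans ha
        have hAm : MeasurableSet {z | g (ρ k z) ≤ t} :=
          measurableSet_le ((measurable_of_countable g).comp hm) measurable_const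
        rw [hs j k hjk, ← measureReal_symmDiff_of_isLowerSet hA (isLowerSet_Iic t) hAm
          measurableSet_Iic]
        have hm2 : MeasurableSet {z | ¬(z ∈ {z | g (ρ k z) ≤ t} ↔ z ∈ Set.Iic t)} :=
          ((hAm.mem.iff measurableSet_Iic.mem).not).setOf
        rw [← integral_indicator_one hm2]
        refine integral_congr_ae (Filter.Eventually.of_forall fun z => ?_)
        simp only [Set.indicator, Set.mem_ofPred_eq, Set.mem_Iic, Pi.one_apply]
        by_cases ha : g (ρ k z) ≤ t <;> by_cases hb : z ≤ t <;> simp [ha, hb]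
      have h2 : stdG.real {z | g (ρ k z) ≤ t} =
          (∑ i ∈ S k, (if g i ≤ t then (1 : ℝ) else 0)) / (S k).card := by
        have hAm : MeasurableSet {z | g (ρ k z) ≤ t} :=
          measurableSet_le ((measurable_of_countable g).comp hm) measurable_const
        have e1 : stdG.real {z | g (ρ k z) ≤ t} =
            ∫ z, (fun i => if g i ≤ t then (1 : ℝ) else 0) (ρ k z) ∂stdG := by
          rw [← integral_indicator_one hAm]
          refine integral_congr_ae (Filter.Eventually.of_forall fun z => ?_)
          simp only [Set.indicator, Set.mem_ofPred_eq, Pi.one_apply]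
        rw [e1, integral_comp_eq_sum hm fun i => if g i ≤ t then (1 : ℝ) else 0, Finset.sum_div]
        rw [← Finset.sum_subset (Finset.subset_univ (S k))]
        · refine Finset.sum_congr rfl fun i hi => ?_
          rw [hmass i hi]; ring
        · intro i _ hi
          have : ρ k ⁻¹' {i} = ∅ := by
            ext z
            simp only [Set.mem_preimage, Set.mem_singleton_iff, Set.mem_empty_iff_false, iff_false]
            rintro rfl
            exact hi (hmem z)
          rw [this]; simp
      rw [Finset.sum_congr rfl h1, Finset.sum_const, nsmul_eq_mul, h2, Finset.sum_sub_distrib,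
        Finset.sum_const, nsmul_eq_mul]
      change ((S k).card : ℝ) * _ = |_ - ((S k).card : ℝ) * _|
      rw [← abs_of_nonneg (Nat.cast_nonneg (α := ℝ) (S k).card), ← abs_mul, abs_of_nonneg
        (Nat.cast_nonneg (α := ℝ) (S k).card)]
      congr 1
      field_simp
      rfl
    · have : S k = ∅ := Finset.not_nonempty_iff_eq_empty.1 hk
      change ∑ j ∈ S k, _ = |∑ i ∈ S k, _|
      rw [this]; simp

/-- Cost of the binned plan in terms of the empirical fluctuations of `g`. -/
lemma exists_plan_cost_le {N K : ℕ} (hN : 0 < N) (θ g : Fin N → ℝ)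
    (bin : Fin N → Option (Fin K)) {τ b ω T h : ℝ} (hτ : 0 ≤ τ) (hb : 0 ≤ b) (hω : 0 ≤ ω)
    (hbin : ∀ i j k, bin i = some k → bin j = some k → |θ i - θ j| ≤ ω)
    (hT : 0 ≤ T) (hh : 0 < h) {J : ℕ} (hJ : J * h = 2 * T) :
    ∃ ι, IsPlan ι ∧ N * planCost θ (fun i => seErr θ τ b i (g i)) (seErr θ τ b) ι ≤
      3 * ω ^ 2 * N + 2 * τ ^ 2 * (3 * ∑ i, max (|g i| - T) 0 ^ 2 +
        3 * N * ∫ z, max (|z| - T) 0 ^ 2 ∂stdG + 6 * T * h * N +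
        6 * T * h * ∑ l ∈ Finset.range J, ∑ k, |∑ i with bin i = some k,
          ((if g i ≤ -T + l * h then (1 : ℝ) else 0) - stdG.real (Set.Iic (-T + l * h)))| +
        ∑ i with bin i = none, (2 * g i ^ 2 + 2)) := by
  obtain ⟨ι, hι, hnone, hbi, hsome⟩ := exists_bin_plan hN g bin
  refine ⟨ι, hι, ?_⟩
  have hN' : (N : ℝ) ≠ 0 := Nat.cast_ne_zero.2 hN.ne'
  have hce : ∀ a : ℝ, Continuous fun z => eta (a + τ * z) b := fun a =>
    (continuous_eta hb).comp (by fun_prop)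
  have hg := measurable_comp_plan hι g
  have hmax : Integrable (fun z => max (|z| - T) 0 ^ 2) stdG := by
    refine integrable_stdG_of_le (K := 1) (by fun_prop) fun x => ?_
    have h1 : max (|x| - T) 0 ≤ |x| := max_le (by linarith) (abs_nonneg _)
    rw [abs_of_nonneg (sq_nonneg _)]
    have := pow_le_pow_left₀ (le_max_right _ _) h1 2
    rw [sq_abs] at this
    linarith
  have hsqi : ∀ j, Integrable (fun z => (g (ι j z) - z) ^ 2) stdG := by
    intro j
    refine ((integrable_comp_plan hι (fun i => 2 * g i ^ 2) j).add
      (integrable_sq_stdG.const_mul 2)).mono'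
      (((hg j).sub measurable_id).pow_const 2).aestronglyMeasurable
      (Filter.Eventually.of_forall fun z => ?_)
    rw [Real.norm_eq_abs, abs_of_nonneg (sq_nonneg _)]
    simp only [Pi.add_apply]
    nlinarith [sq_nonneg (g (ι j z) + z)]
  have hindi : ∀ j t, Integrable (fun z => |(if g (ι j z) ≤ t then (1 : ℝ) else 0) -
      (if z ≤ t then (1 : ℝ) else 0)|) stdG := by
    intro j t
    refine (integrable_const (1 : ℝ)).mono' ?_ (Filter.Eventually.of_forall fun z => ?_)
    · exact (((Measurable.ite (measurableSet_le (hg j) measurable_const) measurable_const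
        measurable_const).sub (Measurable.ite measurableSet_Iic measurable_const
        measurable_const)).abs).aestronglyMeasurable
    · split_ifs <;> simp
  set D : Fin N → ℝ → ℝ := fun j z => ∑ l ∈ Finset.range J,
    |(if g (ι j z) ≤ -T + l * h then (1 : ℝ) else 0) - (if z ≤ -T + l * h then (1 : ℝ) else 0)|
    with hD
  have hDi : ∀ j, Integrable (D j) stdG := fun j => integrable_finsetSum _ fun l _ => hindi j _
  have hcost : N * planCost θ (fun i => seErr θ τ b i (g i)) (seErr θ τ b) ι ≤
      ∑ j, (3 * ω ^ 2 + 2 * τ ^ 2 * ∫ z, (g (ι j z) - z) ^ 2 ∂stdG) := by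
    unfold planCost
    rw [mul_div_cancel₀ _ hN']
    refine Finset.sum_le_sum fun j _ => ?_
    have e1 : 3 * ω ^ 2 + 2 * τ ^ 2 * ∫ z, (g (ι j z) - z) ^ 2 ∂stdG =
        ∫ z, (3 * ω ^ 2 + 2 * τ ^ 2 * (g (ι j z) - z) ^ 2) ∂stdG := by
      rw [integral_add (integrable_const _) ((hsqi j).const_mul _)]
      simp [integral_const_mul]
    rw [e1]
    refine integral_mono_of_nonneg (Filter.Eventually.of_forall fun z => by positivity)
      ((integrable_const _).add ((hsqi j).const_mul _)) (Filter.Eventually.of_forall fun z => ?_)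
    simp only
    have hω' : |θ (ι j z) - θ j| ≤ ω := by
      rcases hj : bin j with _ | k
      · rw [hnone j hj]; simpa using hω
      · exact hbin _ _ k (by rw [hbi, hj]) hj
    have e2 := abs_eta_sub_eta_le hb (x := θ (ι j z) + τ * g (ι j z)) (y := θ j + τ * z)
    have e3 : seErr θ τ b (ι j z) (g (ι j z)) = eta (θ (ι j z) + τ * g (ι j z)) b - θ (ι j z) := rfl
    have e4 : seErr θ τ b j z = eta (θ j + τ * z) b - θ j := rfl
    rw [e3, e4]
    have e5 := sq_le_sq' (abs_le.1 hω').1 (abs_le.1 hω').2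
    have e6 := pow_le_pow_left₀ (abs_nonneg _) e2 2
    rw [sq_abs, sq_abs] at e6
    nlinarith [sq_nonneg ((θ (ι j z) - θ j) - τ * (g (ι j z) - z))]
  have hpt : ∀ j z, (g (ι j z) - z) ^ 2 ≤ 3 * max (|g (ι j z)| - T) 0 ^ 2 +
      3 * max (|z| - T) 0 ^ 2 + 6 * T * h + 6 * T * h * D j z := fun j z =>
    sq_sub_le_threshold _ _ hT hh hJ
  have hint : ∀ j, ∫ z, (g (ι j z) - z) ^ 2 ∂stdG ≤
      3 * ∫ z, max (|g (ι j z)| - T) 0 ^ 2 ∂stdG + 3 * ∫ z, max (|z| - T) 0 ^ 2 ∂stdG +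
        6 * T * h + 6 * T * h * ∫ z, D j z ∂stdG := by
    intro j
    have i1 := (integrable_comp_plan hι (fun i => max (|g i| - T) 0 ^ 2) j).const_mul 3
    have i2 := hmax.const_mul 3
    have i3 := (hDi j).const_mul (6 * T * h)
    have i12 : Integrable (fun z => 3 * max (|g (ι j z)| - T) 0 ^ 2 +
      3 * max (|z| - T) 0 ^ 2) stdG := i1.add i2
    have i4 : Integrable (fun z => 3 * max (|g (ι j z)| - T) 0 ^ 2 +
      3 * max (|z| - T) 0 ^ 2 + 6 * T * h) stdG := i12.add (integrable_const (6 * T * h))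
    refine (integral_mono (hsqi j) (i4.add i3) (hpt j)).trans (le_of_eq ?_)
    simp only [Pi.add_apply]
    rw [integral_add i4 i3, integral_add i12 (integrable_const _), integral_add i1 i2]
    simp [integral_const_mul]
  have hDs : ∑ j with ¬ bin j = none, ∫ z, D j z ∂stdG = ∑ l ∈ Finset.range J, ∑ k,
      |∑ i with bin i = some k,
          ((if g i ≤ -T + l * h then (1 : ℝ) else 0) - stdG.real (Set.Iic (-T + l * h)))| := by
    have e1 : ∑ j with ¬ bin j = none, ∫ z, D j z ∂stdG =
        ∑ k, ∑ j with bin j = some k, ∫ z, D j z ∂stdG := by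
      have a1 := sum_option_fiberwise bin fun j => ∫ z, D j z ∂stdG
      have a2 := Finset.sum_filter_add_sum_filter_not Finset.univ (fun j => bin j = none)
        fun j => ∫ z, D j z ∂stdG
      linarith
    rw [e1, Finset.sum_comm]
    refine Finset.sum_congr rfl fun k _ => ?_
    simp_rw [← hsome k, hD]
    rw [Finset.sum_comm]
    exact Finset.sum_congr rfl fun j _ => integral_finsetSum _ fun l _ => hindi j _
  have htail : ∀ j, bin j = none → ∫ z, (g (ι j z) - z) ^ 2 ∂stdG ≤ 2 * g j ^ 2 + 2 := by
    intro j hj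
    have e1 : ∫ z, (2 * g j ^ 2 + 2 * z ^ 2) ∂stdG = 2 * g j ^ 2 + 2 := by
      rw [integral_add (integrable_const _) (integrable_sq_stdG.const_mul 2)]
      simp [integral_const_mul, integral_sq_stdG]
    rw [← e1]
    refine integral_mono (hsqi j) ((integrable_const _).add (integrable_sq_stdG.const_mul 2))
      fun z => ?_
    simp only [hnone j hj]
    nlinarith [sq_nonneg (g j + z)]
  have hsplit : ∑ j, ∫ z, (g (ι j z) - z) ^ 2 ∂stdG ≤
      3 * ∑ i, max (|g i| - T) 0 ^ 2 + 3 * N * ∫ z, max (|z| - T) 0 ^ 2 ∂stdG + 6 * T * h * N +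
        6 * T * h * ∑ j with ¬ bin j = none, ∫ z, D j z ∂stdG +
        ∑ i with bin i = none, (2 * g i ^ 2 + 2) := by
    have hTh : 0 ≤ T * h := mul_nonneg hT hh.le
    rw [← Finset.sum_filter_add_sum_filter_not Finset.univ (fun j => bin j = none), add_comm]
    refine add_le_add ?_ (Finset.sum_le_sum fun j hj => htail j (by simpa using hj))
    refine (Finset.sum_le_sum fun j _ => hint j).trans ?_
    rw [Finset.sum_add_distrib, ← Finset.mul_sum]
    refine add_le_add ?_ le_rfl
    have hI : 0 ≤ ∫ z, max (|z| - T) 0 ^ 2 ∂stdG := integral_nonneg fun z => sq_nonneg _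
    refine (Finset.sum_le_sum_of_subset_of_nonneg (Finset.filter_subset _ _) fun j _ _ => ?_).trans
      (le_of_eq ?_)
    · have : 0 ≤ ∫ z, max (|g (ι j z)| - T) 0 ^ 2 ∂stdG := integral_nonneg fun z => sq_nonneg _
      nlinarith
    · rw [Finset.sum_add_distrib, Finset.sum_add_distrib, ← Finset.mul_sum,
        hι.sum_integral_comp fun i => max (|g i| - T) 0 ^ 2]
      simp only [Finset.sum_const, Finset.card_univ, Fintype.card_fin, nsmul_eq_mul]
      ring
  rw [Finset.sum_add_distrib] at hcost
  simp only [Finset.sum_const, Finset.card_univ, Fintype.card_fin, nsmul_eq_mul] at hcost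
  rw [← Finset.mul_sum] at hcost
  rw [hDs] at hsplit
  have := mul_le_mul_of_nonneg_left hsplit (by positivity : 0 ≤ 2 * τ ^ 2)
  linarith

lemma measureReal_le_sum_of_subset {Ω ι : Type*} [MeasurableSpace Ω] {μ : Measure Ω}
    [IsFiniteMeasure μ] (s : Finset ι) {A : Set Ω} {B : ι → Set Ω} (h : A ⊆ ⋃ i ∈ s, B i) :
    μ.real A ≤ ∑ i ∈ s, μ.real (B i) :=
  (measureReal_mono h (measure_ne_top _ _)).trans (measureReal_biUnion_finset_le s B)

/-- Fluctuations of the empirical distribution functions over the bins. -/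
lemma Pz_sum_abs_bin_ge_le {N K : ℕ} (bin : Fin N → Option (Fin K)) (u : ℝ) {t : ℝ}
    (ht : 0 ≤ t) (ht' : t ≤ 1) :
    (Pz N).real {g | N * t ≤ ∑ k, |∑ i with bin i = some k,
        ((if g i ≤ u then (1 : ℝ) else 0) - stdG.real (Set.Iic u))|} ≤
      2 ^ K * Real.exp (-(N * t ^ 2) / 1640) := by
  set f : (Fin K → Bool) → Fin N → ℝ → ℝ := fun s i x =>
    (bin i).elim 0 (fun k => (if s k then 1 else -1) *
      ((if x ≤ u then (1 : ℝ) else 0) - stdG.real (Set.Iic u))) with hf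
  have hF0 : 0 ≤ stdG.real (Set.Iic u) := measureReal_nonneg
  have hF1 : stdG.real (Set.Iic u) ≤ 1 := measureReal_le_one
  have hbm : Measurable fun x : ℝ => (if x ≤ u then (1 : ℝ) else 0) :=
    Measurable.ite measurableSet_Iic measurable_const measurable_const
  have hb : Integrable (fun x : ℝ => (if x ≤ u then (1 : ℝ) else 0)) stdG :=
    (integrable_const (1 : ℝ)).mono' hbm.aestronglyMeasurable
      (Filter.Eventually.of_forall fun z => by split_ifs <;> simp)
  have hmean0 : ∫ x, ((if x ≤ u then (1 : ℝ) else 0) - stdG.real (Set.Iic u)) ∂stdG = 0 := by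
    rw [integral_sub hb (integrable_const _), ← integral_indicator_one measurableSet_Iic]
    simp [Set.indicator]
  have hmean : ∀ s i, ∫ x, f s i x ∂stdG = 0 := by
    intro s i
    simp only [hf]
    rcases bin i with _ | k
    · simp
    · simp only [Option.elim_some]
      rw [integral_const_mul, hmean0, mul_zero]
  have hmeas : ∀ s i, Measurable (f s i) := by
    intro s i
    simp only [hf]
    rcases bin i with _ | k
    · exact measurable_const
    · exact (hbm.sub_const _).const_mul _
  have hbd : ∀ s i x, |f s i x| ≤ 1 * (1 + x ^ 2) := by
    intro s i x
    refine le_trans ?_ (show (1 : ℝ) ≤ 1 * (1 + x ^ 2) by nlinarith [sq_nonneg x])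
    simp only [hf]
    rcases bin i with _ | k
    · simp
    · simp only [Option.elim_some]
      rw [abs_mul]
      have h1 : |(if s k then (1 : ℝ) else -1)| = 1 := by split_ifs <;> simp
      rw [h1, one_mul, abs_le]
      split_ifs <;> constructor <;> linarith
  have hsub : {g : Fin N → ℝ | N * t ≤ ∑ k, |∑ i with bin i = some k,
        ((if g i ≤ u then (1 : ℝ) else 0) - stdG.real (Set.Iic u))|} ⊆
      ⋃ s ∈ (Finset.univ : Finset (Fin K → Bool)),
        {g | N * t ≤ ∑ i, (f s i (g i) - ∫ x, f s i x ∂stdG)} := by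
    intro g hg
    rw [Set.mem_ofPred_eq] at hg
    simp only [Set.mem_iUnion, Finset.mem_univ, exists_true_left]
    set Y : Fin K → ℝ := fun k => ∑ i with bin i = some k,
        ((if g i ≤ u then (1 : ℝ) else 0) - stdG.real (Set.Iic u)) with hY
    refine ⟨fun k => decide (0 ≤ Y k), ?_⟩
    rw [Set.mem_ofPred_eq]
    refine hg.trans (le_of_eq ?_)
    simp only [hmean, sub_zero]
    have hzero : ∑ j with bin j = none, f (fun k => decide (0 ≤ Y k)) j (g j) = 0 := by
      refine Finset.sum_eq_zero fun i hi => ?_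
      have hi' : bin i = none := by simpa using hi
      simp [hf, hi']
    rw [sum_option_fiberwise bin, hzero, zero_add]
    · refine Finset.sum_congr rfl fun k _ => ?_
      have e1 : ∑ j with bin j = some k, f (fun k => decide (0 ≤ Y k)) j (g j) =
          (if 0 ≤ Y k then 1 else -1) * Y k := by
        rw [hY, Finset.mul_sum]
        refine Finset.sum_congr rfl fun j hj => ?_
        have hj' : bin j = some k := by simpa using hj
        simp [hf, hj']
      rw [e1]
      change |Y k| = _
      split_ifs with h0
      · rw [abs_of_nonneg h0, one_mul]
      · rw [abs_of_neg (not_le.1 h0), neg_one_mul]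
  refine (measureReal_le_sum_of_subset _ hsub).trans ?_
  refine (Finset.sum_le_sum fun s _ => Pz_sum_sub_mean_ge_le (hmeas s) one_pos (hbd s) ht
    ht').trans ?_
  rw [Finset.sum_const, nsmul_eq_mul, Finset.card_univ]
  simp

/-- With high probability the plan sorting each bin is cheap. -/
lemma Pz_not_exists_plan_le {N K J : ℕ} (hN : 0 < N) (θ : Fin N → ℝ)
    (bin : Fin N → Option (Fin K)) {τ b ω T h η t : ℝ} (hτ : 0 ≤ τ) (hb : 0 ≤ b) (hω : 0 ≤ ω)
    (hbin : ∀ i j k, bin i = some k → bin j = some k → |θ i - θ j| ≤ ω)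
    (hT : 0 ≤ T) (hh : 0 < h) (hJ : J * h = 2 * T) (hη : 0 ≤ η) (hη' : η ≤ 1)
    (hωη : ω ^ 2 ≤ η) (hTη : 12 * Real.exp (-T ^ 2 / 8) ≤ η) (hhη : 6 * T * h ≤ η)
    (ht : 0 ≤ t) (ht' : t ≤ 1) (htη : 12 * T ^ 2 * t ≤ η)
    (hcard : 4 * ((Finset.univ.filter fun i => bin i = none).card : ℝ) ≤ η * N) :
    (Pz N).real {g | ¬ ∃ ι, IsPlan ι ∧
        planCost θ (fun i => seErr θ τ b i (g i)) (seErr θ τ b) ι ≤ η * (3 + 26 * τ ^ 2)} ≤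
      Real.exp (-(N * η ^ 2) / 1640) + Real.exp (-(N * η ^ 2) / (1640 * 2 ^ 2)) +
        J * (2 ^ K * Real.exp (-(N * t ^ 2) / 1640)) := by
  have hN0 : (0 : ℝ) < N := by exact_mod_cast hN
  set E := ∫ x, max (|x| - T) 0 ^ 2 ∂stdG with hE
  have hE1 : E ≤ η := (integral_posPart_abs_sub_sq_le hT).trans hTη
  set f₂ : Fin N → ℝ → ℝ := fun i x => if bin i = none then 2 * x ^ 2 + 2 else 0 with hf₂
  set Y : ℕ → (Fin N → ℝ) → ℝ := fun l g => ∑ k, |∑ i with bin i = some k,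
    ((if g i ≤ -T + l * h then (1 : ℝ) else 0) - stdG.real (Set.Iic (-T + l * h)))| with hY
  set A₁ : Set (Fin N → ℝ) := {g | N * η ≤ ∑ i, (max (|g i| - T) 0 ^ 2 - E)} with hA₁
  set A₂ : Set (Fin N → ℝ) := {g | N * η ≤ ∑ i, (f₂ i (g i) - ∫ x, f₂ i x ∂stdG)} with hA₂
  set A₃ : ℕ → Set (Fin N → ℝ) := fun l => {g | N * t ≤ Y l g} with hA₃
  have hmean₂ : ∀ i, ∫ x, f₂ i x ∂stdG = if bin i = none then 4 else 0 := by
    intro i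
    simp only [hf₂]
    split_ifs
    · rw [integral_add (integrable_sq_stdG.const_mul 2) (integrable_const _), integral_const_mul,
        integral_sq_stdG]
      simp; norm_num
    · simp
  have hsub : {g | ¬ ∃ ι, IsPlan ι ∧
        planCost θ (fun i => seErr θ τ b i (g i)) (seErr θ τ b) ι ≤ η * (3 + 26 * τ ^ 2)} ⊆
      (A₁ ∪ A₂) ∪ ⋃ l ∈ Finset.range J, A₃ l := by
    intro g hg
    by_contra hcon
    simp only [Set.mem_union, Set.mem_iUnion, not_or, not_exists, hA₁, hA₂, hA₃,
      Set.mem_ofPred_eq, not_le, Finset.mem_range] at hcon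
    obtain ⟨⟨h1, h2⟩, h3⟩ := hcon
    refine hg ?_
    obtain ⟨ι, hι, hc⟩ := exists_plan_cost_le hN θ g bin hτ hb hω hbin hT hh hJ
    refine ⟨ι, hι, ?_⟩
    rw [Finset.sum_sub_distrib] at h1 h2
    simp only [hmean₂, Finset.sum_const, Finset.card_univ, Fintype.card_fin, nsmul_eq_mul] at h1 h2
    rw [← Finset.sum_filter, ← Finset.sum_filter, Finset.sum_const, nsmul_eq_mul] at h2
    have h4 : 6 * T * h * ∑ l ∈ Finset.range J, Y l g ≤ η * N := by
      have e1 : ∑ l ∈ Finset.range J, Y l g ≤ J * (N * t) := by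
        refine (Finset.sum_le_sum fun l hl => (h3 l (Finset.mem_range.1 hl)).le).trans ?_
        simp
      have e2 := mul_le_mul_of_nonneg_left e1 (by positivity : 0 ≤ 6 * T * h)
      have e3 : 6 * T * h * (J * (N * t)) = 12 * T ^ 2 * t * N := by
        have : 6 * T * h * (J * (N * t)) = 6 * T * (N * t) * (J * h) := by ring
        rw [this, hJ]; ring
      have e4 := mul_le_mul_of_nonneg_right htη hN0.le
      linarith
    have h5 := mul_le_mul_of_nonneg_right hhη hN0.le
    have h6 := mul_le_mul_of_nonneg_left hE1 hN0.le
    have h7 := mul_le_mul_of_nonneg_right hωη hN0.le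
    have h8 : 3 * ∑ i, max (|g i| - T) 0 ^ 2 + 3 * N * E + 6 * T * h * N +
        6 * T * h * ∑ l ∈ Finset.range J, Y l g + ∑ i with bin i = none, (2 * g i ^ 2 + 2) ≤
        13 * (η * N) := by
      nlinarith
    have h9 := mul_le_mul_of_nonneg_left h8 (by positivity : 0 ≤ 2 * τ ^ 2)
    refine le_of_mul_le_mul_left (hc.trans ?_) hN0
    calc _ ≤ 3 * ω ^ 2 * N + 2 * τ ^ 2 * (13 * (η * N)) := by linarith
      _ ≤ _ := by nlinarith
  refine (measureReal_mono hsub).trans ((measureReal_union_le _ _).trans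
    (add_le_add ((measureReal_union_le _ _).trans (add_le_add ?_ ?_)) ?_))
  · refine (Pz_sum_sub_mean_ge_le (f := fun _ x => max (|x| - T) 0 ^ 2) (fun i => by fun_prop)
      one_pos (fun i x => ?_) hη hη').trans (by simp)
    have h1 : max (|x| - T) 0 ≤ |x| := max_le (by linarith) (abs_nonneg _)
    rw [abs_of_nonneg (sq_nonneg _)]
    have := pow_le_pow_left₀ (le_max_right _ _) h1 2
    rw [sq_abs] at this
    linarith
  · refine Pz_sum_sub_mean_ge_le (fun i => ?_) two_pos (fun i x => ?_) hη (hη'.trans one_le_two)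
    · simp only [hf₂]
      split_ifs <;> fun_prop
    · simp only [hf₂]
      split_ifs
      · rw [abs_of_nonneg (by positivity)]; linarith
      · rw [abs_zero]; positivity
  · refine (measureReal_biUnion_finset_le _ _).trans ((Finset.sum_le_sum fun (l : ℕ) _ =>
      Pz_sum_abs_bin_ge_le bin (-T + l * h) ht ht').trans ?_)
    simp

/-- Exponent of the concentration rate. -/
def rate (p : ℝ) (N : ℕ) (ε : ℝ) : ℝ := N * ε ^ 2 * ε ^ (1 / 2 + 1 / p) / (Real.log ε) ^ 2

lemma rate_nonneg (p : ℝ) (N : ℕ) {ε : ℝ} (hε : 0 < ε) : 0 ≤ rate p N ε := by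
  unfold rate; positivity

lemma log_two_le_neg_log {ε : ℝ} (hε : 0 < ε) (hε' : ε ≤ 1 / 2) : Real.log 2 ≤ -Real.log ε := by
  rw [← Real.log_inv]
  exact Real.log_le_log two_pos (by rw [le_inv_comm₀ two_pos hε]; linarith)

lemma half_le_neg_log {ε : ℝ} (hε : 0 < ε) (hε' : ε ≤ 1 / 2) : 1 / 2 ≤ -Real.log ε :=
  le_trans (by linarith [Real.log_two_gt_d9]) (log_two_le_neg_log hε hε')

lemma exp_absorb {P M₂ M₃ c y X : ℝ} (hM₂ : 0 ≤ M₂) (hM₃ : 0 ≤ M₃) (hc : 0 < c) (hy : 1 ≤ y)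
    (hX : 0 ≤ X) (hP1 : P ≤ 1)
    (hP : P ≤ 2 * Real.exp (-(c * X)) + M₃ * y ^ 4 * Real.exp (M₂ * y) * Real.exp (-(c * X * y))) :
    P ≤ (2 + 24 * M₃ + Real.exp (M₂ + 1)) * Real.exp (-(c / 2 * X)) := by
  have hcX : 0 ≤ c * X := mul_nonneg hc.le hX
  rcases le_total (2 * (M₂ + 1)) (c * X) with h | h
  · have h1 : Real.exp (-(c * X)) ≤ Real.exp (-(c / 2 * X)) := Real.exp_le_exp.2 (by linarith)
    have h2 : Real.exp (M₂ * y) * Real.exp (-(c * X * y)) ≤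
        Real.exp (-y) * Real.exp (-(c / 2 * X)) := by
      rw [← Real.exp_add, ← Real.exp_add, Real.exp_le_exp]
      nlinarith
    have h3 : y ^ 4 * Real.exp (-y) ≤ 24 := by
      have := Real.pow_div_factorial_le_exp (x := y) (by linarith) 4
      rw [Real.exp_neg, ← div_eq_mul_inv, div_le_iff₀ (Real.exp_pos _)]
      rw [div_le_iff₀ (by positivity)] at this
      norm_num [Nat.factorial] at this
      linarith
    have h4 : M₃ * y ^ 4 * Real.exp (M₂ * y) * Real.exp (-(c * X * y)) ≤
        24 * M₃ * Real.exp (-(c / 2 * X)) := by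
      calc _ = M₃ * y ^ 4 * (Real.exp (M₂ * y) * Real.exp (-(c * X * y))) := by ring
        _ ≤ M₃ * y ^ 4 * (Real.exp (-y) * Real.exp (-(c / 2 * X))) :=
            mul_le_mul_of_nonneg_left h2 (by positivity)
        _ = M₃ * (y ^ 4 * Real.exp (-y)) * Real.exp (-(c / 2 * X)) := by ring
        _ ≤ M₃ * 24 * Real.exp (-(c / 2 * X)) := by gcongr
        _ = _ := by ring
    have h5 : 0 ≤ Real.exp (M₂ + 1) * Real.exp (-(c / 2 * X)) := by positivity
    linarith
  · refine hP1.trans ?_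
    have h1 : 1 ≤ Real.exp (M₂ + 1) * Real.exp (-(c / 2 * X)) := by
      rw [← Real.exp_add]
      exact Real.one_le_exp (by linarith)
    have h2 : 0 ≤ (2 + 24 * M₃) * Real.exp (-(c / 2 * X)) := by positivity
    linarith

/-- Bins of width `ω` covering `[-B, B]`. -/
lemma exists_bins {N : ℕ} (θ : Fin N → ℝ) {B ω : ℝ} (hB : 0 ≤ B) (hω : 0 < ω) :
    ∃ bin : Fin N → Option (Fin (⌊2 * B / ω⌋₊ + 1)),
      (∀ i j k, bin i = some k → bin j = some k → |θ i - θ j| ≤ ω) ∧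
      ∀ i, bin i = none → B < |θ i| := by
  have hlt : ∀ i, |θ i| ≤ B → ⌊(θ i + B) / ω⌋₊ < ⌊2 * B / ω⌋₊ + 1 := fun i hi => by
    rw [Nat.lt_succ_iff]
    refine Nat.floor_le_floor (div_le_div_of_nonneg_right ?_ hω.le)
    linarith [(abs_le.1 hi).2]
  refine ⟨fun i => if h : |θ i| ≤ B then some ⟨⌊(θ i + B) / ω⌋₊, hlt i h⟩ else none, ?_, ?_⟩
  · intro i j k hi hj
    simp only at hi hj
    split_ifs at hi hj with h1 h2
    have e : ⌊(θ i + B) / ω⌋₊ = ⌊(θ j + B) / ω⌋₊ := by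
      have := (Option.some.inj hi).trans (Option.some.inj hj).symm
      simpa using this
    have n1 : 0 ≤ (θ i + B) / ω := div_nonneg (by linarith [(abs_le.1 h1).1]) hω.le
    have n2 : 0 ≤ (θ j + B) / ω := div_nonneg (by linarith [(abs_le.1 h2).1]) hω.le
    have a1 := Nat.floor_le n1
    have a2 := Nat.lt_floor_add_one ((θ i + B) / ω)
    have b1 := Nat.floor_le n2
    have b2 := Nat.lt_floor_add_one ((θ j + B) / ω)
    rw [e] at a1 a2
    rw [le_div_iff₀ hω] at a1 b1
    rw [div_lt_iff₀ hω] at a2 b2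
    rw [abs_le]
    constructor <;> nlinarith
  · intro i hi
    simp only at hi
    split_ifs at hi with h1
    exact not_le.1 h1

set_option maxHeartbeats 800000 in
/-- With high probability some plan for the state evolution error costs at most `c₀ ε`. -/
lemma exists_plan_rate {p ξ T₀ c₀ : ℝ} (hp : 0 < p) (hξ : 0 < ξ) (hT₀ : 1 ≤ T₀) (hc₀ : 0 < c₀)
    (hc₀' : c₀ ≤ 1) :
    ∃ C c : ℝ, 0 < C ∧ 0 < c ∧ ∀ N : ℕ, 0 < N → ∀ θ ∈ Fball N p ξ, ∀ τ b : ℝ, 0 ≤ τ → τ ≤ T₀ →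
      0 ≤ b → ∀ ε : ℝ, 0 < ε → ε ≤ 1 / 2 →
      (Pz N).real {g | ¬ ∃ ι, IsPlan ι ∧
        planCost θ (fun i => seErr θ τ b i (g i)) (seErr θ τ b) ι ≤ c₀ * ε} ≤
      C * Real.exp (-(c * rate p N ε)) := by
  set a : ℝ := 1 / 2 + 1 / p with ha
  set κ : ℝ := c₀ / (30 * T₀ ^ 2) with hκ
  have hκ0 : 0 < κ := by positivity
  have hκ1 : κ ≤ 1 / 30 := by
    rw [hκ, div_le_div_iff₀ (by positivity) (by norm_num)]; nlinarith
  set M₁ : ℝ := 8 * (2 * Real.log (12 / κ) + 1) with hM₁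
  have hlogκ : 1 ≤ Real.log (12 / κ) := by
    rw [Real.le_log_iff_exp_le (by positivity), le_div_iff₀ hκ0]
    nlinarith [Real.exp_one_lt_d9, Real.exp_pos 1]
  have hM₁1 : 1 ≤ M₁ := by rw [hM₁]; linarith
  set M₂ : ℝ := 2 * ξ * (4 / κ) ^ (1 / p) / Real.sqrt κ + 1 with hM₂
  have hM₂0 : 0 ≤ M₂ := by positivity
  set M₃ : ℝ := 12 * M₁ / κ + 1 with hM₃
  have hM₃0 : 0 ≤ M₃ := by positivity
  set c₁ : ℝ := κ ^ 2 / (144 * 1640 * M₁ ^ 2) with hc₁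
  have hc₁0 : 0 < c₁ := by positivity
  clear_value a κ M₁ M₂ M₃ c₁
  refine ⟨2 + 24 * M₃ + Real.exp (M₂ + 1), c₁ / 2, by positivity, by positivity, ?_⟩
  intro N hN θ hθ τ b hτ hτT hb ε hε hε'
  have hN0 : (0 : ℝ) < N := by exact_mod_cast hN
  set L := -Real.log ε with hL
  have hL0 : 1 / 2 ≤ L := half_le_neg_log hε hε'
  have hL1 : L ≤ 1 / ε := by
    have h1 := Real.log_le_sub_one_of_pos (one_div_pos.2 hε)
    rw [one_div, Real.log_inv] at h1
    rw [hL, one_div]; linarith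
  set y : ℝ := ε ^ (-a) with hy
  have ha0 : 1 / 2 ≤ a := by rw [ha]; have : 0 < 1 / p := by positivity
                             linarith
  have hy2 : (1 / ε) ^ 2 ≤ y ^ 4 := by
    have e1 : (1 / ε) ^ 2 = (ε ^ (-(1 / 2) : ℝ)) ^ 4 := by
      rw [← Real.rpow_natCast, ← Real.rpow_natCast, ← Real.rpow_mul hε.le, one_div,
        ← Real.rpow_neg_one, ← Real.rpow_mul hε.le]
      norm_num
    rw [e1]
    refine pow_le_pow_left₀ (by positivity) ?_ 4
    exact Real.rpow_le_rpow_of_exponent_ge hε (by linarith) (by linarith)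
  have hy1 : 1 ≤ y := Real.one_le_rpow_of_pos_of_le_one_of_nonpos hε (by linarith) (by linarith)
  set η : ℝ := κ * ε with hη
  have hη0 : 0 < η := by positivity
  have hη1 : η ≤ 1 := by nlinarith
  set T : ℝ := Real.sqrt (8 * Real.log (12 / η)) with hT
  have hlog : Real.log (12 / η) = Real.log (12 / κ) + L := by
    rw [hη, ← div_div, Real.log_div (by positivity) hε.ne', hL]; ring
  have hT2 : T ^ 2 = 8 * (Real.log (12 / κ) + L) := by
    rw [hT, Real.sq_sqrt, hlog]; rw [hlog]; linarith
  have hT2' : T ^ 2 ≤ M₁ * L := by rw [hT2, hM₁]; nlinarith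
  have hT21 : 1 ≤ T ^ 2 := by rw [hT2]; linarith
  have hT0 : 0 < T := by
    rcases (Real.sqrt_nonneg (8 * Real.log (12 / η))).eq_or_lt with h | h
    · rw [hT, ← h] at hT21; norm_num at hT21
    · exact h
  set J : ℕ := ⌈12 * T ^ 2 / η⌉₊ with hJ
  have hJ1 : 12 * T ^ 2 / η ≤ J := Nat.le_ceil _
  have hJ0 : (0 : ℝ) < J := lt_of_lt_of_le (by positivity) hJ1
  have hJ2 : (J : ℝ) ≤ M₃ * (1 / ε) ^ 2 := by
    have h1 := (Nat.ceil_lt_add_one (by positivity : 0 ≤ 12 * T ^ 2 / η)).le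
    have h2 : 12 * T ^ 2 / η ≤ 12 * M₁ / κ * (1 / ε) ^ 2 := by
      have e1 : T ^ 2 ≤ M₁ * (1 / ε) := hT2'.trans (by gcongr)
      calc 12 * T ^ 2 / η ≤ 12 * (M₁ * (1 / ε)) / η := by gcongr
        _ = _ := by rw [hη]; field_simp
    have h3 : 1 ≤ (1 / ε) ^ 2 := by
      have : 1 ≤ 1 / ε := by rw [le_div_iff₀ hε]; linarith
      nlinarith
    rw [hM₃, add_mul, one_mul]
    exact h1.trans (add_le_add h2 h3)
  set h : ℝ := 2 * T / J with hh
  set t : ℝ := η / (12 * T ^ 2) with ht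
  set B : ℝ := ξ * (4 / η) ^ (1 / p) with hB
  have hB0 : 0 < B := by positivity
  set ω : ℝ := Real.sqrt η with hω
  have hω0 : 0 < ω := Real.sqrt_pos.2 hη0
  obtain ⟨bin, hbin, hnone⟩ := exists_bins θ hB0.le hω0
  have hK : ((⌊2 * B / ω⌋₊ + 1 : ℕ) : ℝ) ≤ M₂ * y := by
    push_cast
    have h1 := Nat.floor_le (by positivity : 0 ≤ 2 * B / ω)
    have h2 : 2 * B / ω = (2 * ξ * (4 / κ) ^ (1 / p) / Real.sqrt κ) * y := by
      have e1 : (4 / η) ^ (1 / p) = (4 / κ) ^ (1 / p) * ε ^ (-(1 / p)) := by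
        rw [hη, ← div_div, div_eq_mul_inv (4 / κ) ε, Real.mul_rpow (by positivity) (by positivity),
          Real.inv_rpow hε.le, Real.rpow_neg hε.le]
      have e2 : y = ε ^ (-(1 / p)) * ε ^ (-(1 / 2) : ℝ) := by
        rw [hy, ← Real.rpow_add hε, ha]; congr 1; ring
      have e3 : (Real.sqrt ε)⁻¹ = ε ^ (-(1 / 2) : ℝ) := by
        rw [Real.rpow_neg hε.le, ← Real.sqrt_eq_rpow]
      rw [hB, hω, hη, Real.sqrt_mul hκ0.le, ← hη, e1, e2, ← e3]
      field_simp
    rw [hM₂, add_mul, one_mul, ← h2]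
    linarith
  have hcard : 4 * ((Finset.univ.filter fun i => bin i = none).card : ℝ) ≤ η * N := by
    have h1 : ((Finset.univ.filter fun i => bin i = none).card : ℝ) ≤
        (Finset.univ.filter fun i => B < |θ i|).card := by
      exact_mod_cast Finset.card_le_card fun i hi => by
        simp only [Finset.mem_filter, Finset.mem_univ, true_and] at hi ⊢
        exact hnone i hi
    have h2 := card_abs_gt_le hN hp hξ hB0 hθ
    have h3 : (ξ / B) ^ p = η / 4 := by
      have : ξ / B = (η / 4) ^ (1 / p) := by
        rw [hB, ← div_div, div_self hξ.ne', ← inv_div 4 η, Real.inv_rpow (by positivity), one_div]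
      rw [this, ← Real.rpow_mul (by positivity), one_div_mul_cancel hp.ne', Real.rpow_one]
    rw [h3] at h2
    linarith
  have hmain := Pz_not_exists_plan_le hN θ bin hτ hb hω0.le hbin hT0.le
    (by positivity : 0 < h) (by rw [hh]; field_simp) hη0.le hη1 (Real.sq_sqrt hη0.le).le
    (by
      have : -T ^ 2 / 8 = -Real.log (12 / η) := by rw [hlog]; linarith
      rw [this, Real.exp_neg, Real.exp_log (by positivity)]
      exact le_of_eq (by field_simp))
    (by
      rw [hh]
      rw [div_le_iff₀ hη0] at hJ1
      rw [← mul_div_assoc, div_le_iff₀ hJ0]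
      linarith)
    (by positivity : 0 ≤ t)
    (by rw [ht, div_le_one (by positivity)]; linarith)
    (by rw [ht]; exact le_of_eq (by field_simp)) hcard
  refine exp_absorb hM₂0 hM₃0 hc₁0 hy1 (rate_nonneg p N hε) measureReal_le_one ?_
  refine (measureReal_mono ?_).trans (hmain.trans ?_)
  · intro g hg
    rw [Set.mem_ofPred_eq] at hg ⊢
    rintro ⟨ι, hι, hc⟩
    refine hg ⟨ι, hι, hc.trans ?_⟩
    have h1 : τ ^ 2 ≤ T₀ ^ 2 := pow_le_pow_left₀ hτ hτT 2
    have h2 : κ * (30 * T₀ ^ 2) = c₀ := by rw [hκ]; field_simp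
    have h3 : 1 ≤ T₀ ^ 2 := one_le_pow₀ hT₀
    have h4 : 3 + 26 * τ ^ 2 ≤ 30 * T₀ ^ 2 := by linarith
    have h5 := mul_le_mul_of_nonneg_left h4 hη0.le
    calc _ ≤ η * (30 * T₀ ^ 2) := by linarith
      _ = c₀ * ε := by rw [← h2, hη]; ring
  · have hyX : rate p N ε * y = N * ε ^ 2 / L ^ 2 := by
      unfold rate
      rw [hy, hL, neg_sq, ← ha, Real.rpow_neg hε.le]
      have : ε ^ a ≠ 0 := (Real.rpow_pos_of_pos hε a).ne'
      field_simp
    have hrX : rate p N ε ≤ N * ε ^ 2 / L ^ 2 := by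
      rw [← hyX]; exact le_mul_of_one_le_right (rate_nonneg p N hε) hy1
    have hLpos : 0 < L := by linarith
    have hr2 : c₁ * rate p N ε ≤ N * η ^ 2 / (1640 * 2 ^ 2) := by
      have e1 : N * ε ^ 2 / L ^ 2 ≤ 4 * (N * ε ^ 2) := by
        rw [div_le_iff₀ (by positivity)]
        have h1 : 1 / 4 ≤ L ^ 2 := by
          calc (1 / 4 : ℝ) = (1 / 2) ^ 2 := by norm_num
            _ ≤ L ^ 2 := pow_le_pow_left₀ (by norm_num) hL0 2
        have h2 : 0 ≤ N * ε ^ 2 := by positivity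
        have h3 := mul_le_mul_of_nonneg_left h1 h2
        linarith
      have e2 : c₁ ≤ κ ^ 2 / (144 * 1640) := by
        rw [hc₁]
        refine div_le_div_of_nonneg_left (by positivity) (by norm_num) ?_
        have : 1 ≤ M₁ ^ 2 := one_le_pow₀ hM₁1
        linarith
      calc c₁ * rate p N ε ≤ c₁ * (4 * (N * ε ^ 2)) :=
            mul_le_mul_of_nonneg_left (hrX.trans e1) hc₁0.le
        _ ≤ κ ^ 2 / (144 * 1640) * (4 * (N * ε ^ 2)) :=
            mul_le_mul_of_nonneg_right e2 (by positivity)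
        _ = N * η ^ 2 * (4 / (144 * 1640)) := by rw [hη]; ring
        _ ≤ N * η ^ 2 * (1 / (1640 * 2 ^ 2)) :=
            mul_le_mul_of_nonneg_left (by norm_num) (by positivity)
        _ = _ := by ring
    have hr3 : c₁ * rate p N ε * y ≤ N * t ^ 2 / 1640 := by
      rw [mul_assoc, hyX, ht, hc₁]
      have e1 : (T ^ 2) ^ 2 ≤ (M₁ * L) ^ 2 := pow_le_pow_left₀ (by positivity) hT2' 2
      have e2 : κ ^ 2 / (144 * 1640 * M₁ ^ 2) * (N * ε ^ 2 / L ^ 2) =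
          N * η ^ 2 / (144 * 1640 * (M₁ * L) ^ 2) := by rw [hη]; field_simp
      have e3 : N * (η / (12 * T ^ 2)) ^ 2 / 1640 = N * η ^ 2 / (144 * 1640 * (T ^ 2) ^ 2) := by
        field_simp; norm_num
      rw [e2, e3]
      gcongr
    have hN2 : 0 ≤ N * η ^ 2 := by positivity
    have p1 : Real.exp (-(N * η ^ 2) / 1640) ≤ Real.exp (-(c₁ * rate p N ε)) :=
      Real.exp_le_exp.2 (by rw [neg_div]; linarith)
    have p2 : Real.exp (-(N * η ^ 2) / (1640 * 2 ^ 2)) ≤ Real.exp (-(c₁ * rate p N ε)) :=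
      Real.exp_le_exp.2 (by rw [neg_div]; linarith)
    have p3 : Real.exp (-(N * t ^ 2) / 1640) ≤ Real.exp (-(c₁ * rate p N ε * y)) :=
      Real.exp_le_exp.2 (by rw [neg_div]; linarith)
    have p4 : (2 : ℝ) ^ (⌊2 * B / ω⌋₊ + 1) ≤ Real.exp (M₂ * y) := by
      calc (2 : ℝ) ^ (⌊2 * B / ω⌋₊ + 1) ≤ Real.exp 1 ^ (⌊2 * B / ω⌋₊ + 1) :=
            pow_le_pow_left₀ (by norm_num) (by linarith [Real.add_one_le_exp (1 : ℝ)]) _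
        _ = Real.exp ((⌊2 * B / ω⌋₊ + 1 : ℕ) : ℝ) := by rw [← Real.exp_nat_mul, mul_one]
        _ ≤ _ := Real.exp_le_exp.2 hK
    have p5 : (J : ℝ) ≤ M₃ * y ^ 4 := hJ2.trans (by gcongr)
    have p6 : (J : ℝ) * (2 ^ (⌊2 * B / ω⌋₊ + 1) * Real.exp (-(N * t ^ 2) / 1640)) ≤
        M₃ * y ^ 4 * (Real.exp (M₂ * y) * Real.exp (-(c₁ * rate p N ε * y))) := by
      gcongr
    linarith

lemma rate_le (p : ℝ) (N : ℕ) {ε : ℝ} (hp : 0 < p) (hε : 0 < ε) (hε' : ε ≤ 1 / 2) :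
    rate p N ε ≤ 4 * (N * ε ^ 2) := by
  unfold rate
  have h1 : 1 / 4 ≤ Real.log ε ^ 2 := by
    have := half_le_neg_log hε hε'
    rw [← neg_sq]
    calc (1 / 4 : ℝ) = (1 / 2) ^ 2 := by norm_num
      _ ≤ (-Real.log ε) ^ 2 := pow_le_pow_left₀ (by norm_num) this 2
  have h2 : ε ^ (1 / 2 + 1 / p) ≤ 1 := Real.rpow_le_one hε.le (by linarith) (by positivity)
  have h3 : 0 ≤ N * ε ^ 2 := by positivity
  rw [div_le_iff₀ (by linarith)]
  calc N * ε ^ 2 * ε ^ (1 / 2 + 1 / p) ≤ N * ε ^ 2 * 1 := mul_le_mul_of_nonneg_left h2 h3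
    _ ≤ 4 * (N * ε ^ 2) * Real.log ε ^ 2 := by
      have := mul_le_mul_of_nonneg_left h1 h3
      linarith

/-- Quadratic Chernoff bounds are dominated by the concentration rate. -/
lemma exp_neg_le_rate {p ε κ c : ℝ} {N : ℕ} (hp : 0 < p) (hε : 0 < ε) (hε' : ε ≤ 1 / 2)
    (hc : 0 ≤ c) (hcκ : 4 * c ≤ κ) :
    Real.exp (-(κ * (N * ε ^ 2))) ≤ Real.exp (-(c * rate p N ε)) := by
  refine Real.exp_le_exp.2 (neg_le_neg ?_)
  have h := mul_le_mul_of_nonneg_left (rate_le p N hp hε hε') hc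
  have h2 : 0 ≤ N * ε ^ 2 := by positivity
  have h3 := mul_le_mul_of_nonneg_right hcκ h2
  linarith

/-- The event on which the auxiliary Gaussian problem behaves as predicted by state evolution. -/
structure Typical {n N : ℕ} (θ : Fin N → ℝ) (τ b t q : ℝ)
    (ω : (Fin n → ℝ) × (Fin N → ℝ) × ℝ) : Prop where
  noise : |∑ i, (ω.1 i ^ 2 - 1)| ≤ n * t
  scalar : |ω.2.2| ≤ t * √n
  sq : |∑ i, (seErr θ τ b i (ω.2.1 i) ^ 2 - ∫ z, seErr θ τ b i z ^ 2 ∂stdG)| ≤ n * t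
  mul : |∑ i, (ω.2.1 i * seErr θ τ b i (ω.2.1 i) - ∫ z, z * seErr θ τ b i z ∂stdG)| ≤ n * t
  abs : |∑ i, ((|θ i + seErr θ τ b i (ω.2.1 i)| - |θ i|) -
    ∫ z, (|θ i + seErr θ τ b i z| - |θ i|) ∂stdG)| ≤ n * t
  plan : ∃ ι, IsPlan ι ∧
    planCost θ (fun i => seErr θ τ b i (ω.2.1 i)) (seErr θ τ b) ι ≤ q

lemma Paux_real_fst (n N : ℕ) (S : Set (Fin n → ℝ)) :
    (Paux n N).real {ω | ω.1 ∈ S} = (Pz n).real S := by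
  have h : {ω : (Fin n → ℝ) × (Fin N → ℝ) × ℝ | ω.1 ∈ S} = S ×ˢ Set.univ := by
    ext; simp
  rw [h, Paux, measureReal_prod_prod]; simp

lemma Paux_real_snd_fst (n N : ℕ) (S : Set (Fin N → ℝ)) :
    (Paux n N).real {ω | ω.2.1 ∈ S} = (Pz N).real S := by
  have h : {ω : (Fin n → ℝ) × (Fin N → ℝ) × ℝ | ω.2.1 ∈ S} =
      Set.univ ×ˢ (S ×ˢ Set.univ) := by
    ext; simp
  rw [h, Paux, measureReal_prod_prod, measureReal_prod_prod]; simp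

lemma Paux_real_snd_snd (n N : ℕ) (S : Set ℝ) :
    (Paux n N).real {ω | ω.2.2 ∈ S} = stdG.real S := by
  have h : {ω : (Fin n → ℝ) × (Fin N → ℝ) × ℝ | ω.2.2 ∈ S} =
      Set.univ ×ˢ (Set.univ ×ˢ S) := by
    ext; simp
  rw [h, Paux, measureReal_prod_prod, measureReal_prod_prod]; simp

lemma abs_abs_seErr_le {N : ℕ} {θ : Fin N → ℝ} {τ b : ℝ} (hτ : 0 ≤ τ) (hb : 0 ≤ b) (i : Fin N)
    (z : ℝ) : |(|θ i + seErr θ τ b i z| - |θ i|)| ≤ (τ + b) * (1 + z ^ 2) := by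
  refine (abs_abs_sub_abs_le _ _).trans ?_
  rw [add_sub_cancel_left]
  refine (abs_seErr_le hτ hb i z).trans ?_
  nlinarith [sq_nonneg (|z| - 1), sq_abs z, mul_nonneg hτ (sq_nonneg (|z| - 1)),
      mul_nonneg hb (sq_nonneg z), mul_nonneg hτ (sq_nonneg z)]

lemma Pz_abs_sum_sub_mean_gt_rate {n N : ℕ} {f : Fin N → ℝ → ℝ} (hf : ∀ i, Measurable (f i))
    {K : ℝ} (hK : 0 < K) (hb : ∀ i x, |f i x| ≤ K * (1 + x ^ 2)) {p s ε δ : ℝ} (hp : 0 < p)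
    (hδ : 0 < δ) (hs : 0 < s) (hsK : δ * s ≤ K) (hn : (n : ℝ) = δ * N)
    (hε : 0 < ε) (hε' : ε ≤ 1 / 2) :
    (Pz N).real {g | n * (s * ε) < |∑ i, (f i (g i) - ∫ x, f i x ∂stdG)|} ≤
      2 * Real.exp (-((δ * s) ^ 2 / (6560 * K ^ 2) * rate p N ε)) := by
  have h := Pz_abs_sum_sub_mean_ge_le hf hK hb (by positivity : 0 ≤ δ * s * ε)
    (by nlinarith [mul_pos hδ hs])
  refine (measureReal_mono ?_).trans (h.trans ?_)
  · intro g hg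
    rw [Set.mem_ofPred_eq] at hg ⊢
    rw [hn] at hg
    linarith
  · refine mul_le_mul_of_nonneg_left ?_ (by norm_num)
    have e : -(N * (δ * s * ε) ^ 2) / (1640 * K ^ 2) =
        -((δ * s) ^ 2 / (1640 * K ^ 2) * (N * ε ^ 2)) := by ring
    rw [e]
    refine exp_neg_le_rate hp hε hε' (by positivity) (le_of_eq ?_)
    field_simp; norm_num

lemma exists_typical_rate {p ξ δ T₀ B₀ s c₀ : ℝ} (hp : 0 < p) (hξ : 0 < ξ) (hδ : 0 < δ)
    (hT₀ : 1 ≤ T₀) (hB₀ : 0 ≤ B₀) (hs : 0 < s) (hs1 : s ≤ 1) (hδs : δ * s ≤ 1)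
    (hc₀ : 0 < c₀) (hc₀' : c₀ ≤ 1) :
    ∃ C c : ℝ, 0 < C ∧ 0 < c ∧ ∀ n N : ℕ, 0 < N → (n : ℝ) = δ * N → ∀ θ ∈ Fball N p ξ,
      ∀ τ b : ℝ, 0 ≤ τ → τ ≤ T₀ → 0 ≤ b → b ≤ B₀ → ∀ ε : ℝ, 0 < ε → ε ≤ 1 / 2 →
      (Paux n N).real {ω | ¬ Typical θ τ b (s * ε) (c₀ * ε) ω} ≤
        C * Real.exp (-(c * rate p N ε)) := by
  obtain ⟨C₀, c₆, hC₀, hc₆, hplan⟩ := exists_plan_rate hp hξ hT₀ hc₀ hc₀'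
  set K : ℝ := 2 * (T₀ ^ 2 + B₀ ^ 2) + T₀ + B₀ with hK
  have hK1 : 1 ≤ K := by nlinarith
  have hK0 : 0 < K := by linarith
  set c₁ : ℝ := min (δ * s ^ 2 / 6560) ((δ * s) ^ 2 / (6560 * K ^ 2)) with hc₁
  have hc₁0 : 0 < c₁ := by positivity
  have hc₁1 : c₁ ≤ δ * s ^ 2 / 6560 := min_le_left _ _
  have hc₁2 : c₁ ≤ (δ * s) ^ 2 / (6560 * K ^ 2) := min_le_right _ _
  clear_value c₁
  refine ⟨C₀ + 10, min c₁ c₆, by positivity, by positivity, ?_⟩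
  intro n N hN hn θ hθ τ b hτ hτT hb hbB ε hε hε'
  have hr := rate_nonneg p N hε
  have hn0 : (0 : ℝ) < n := by rw [hn]; have : (0 : ℝ) < N := by exact_mod_cast hN
                               positivity
  have hKb : 2 * (τ ^ 2 + b ^ 2) ≤ K ∧ τ + b ≤ K := by
    have h1 := pow_le_pow_left₀ hτ hτT 2
    have h2 := pow_le_pow_left₀ hb hbB 2
    constructor <;> nlinarith [sq_nonneg T₀, sq_nonneg B₀]
  set E : ℝ := Real.exp (-(min c₁ c₆ * rate p N ε)) with hE
  have hle : ∀ {c : ℝ}, c₁ ≤ c → Real.exp (-(c * rate p N ε)) ≤ E := fun h =>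
    Real.exp_le_exp.2 (neg_le_neg (mul_le_mul_of_nonneg_right ((min_le_left _ _).trans h) hr))
  have hle6 : Real.exp (-(c₆ * rate p N ε)) ≤ E :=
    Real.exp_le_exp.2 (neg_le_neg (mul_le_mul_of_nonneg_right (min_le_right _ _) hr))
  have hgen : ∀ {f : Fin N → ℝ → ℝ}, (∀ i, Measurable (f i)) → (∀ i x, |f i x| ≤ K * (1 + x ^ 2)) →
      (Pz N).real {g | n * (s * ε) < |∑ i, (f i (g i) - ∫ x, f i x ∂stdG)|} ≤ 2 * E :=
    fun hf hb => (Pz_abs_sum_sub_mean_gt_rate hf hK0 hb hp hδ hs (hδs.trans hK1) hn hε hε').trans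
      (mul_le_mul_of_nonneg_left (hle hc₁2) (by norm_num))
  set S1 : Set (Fin n → ℝ) := {h | n * (s * ε) ≤ |∑ i, (h i ^ 2 - 1)|}
  set S2 : Set ℝ := {x | s * ε * √n ≤ |x|}
  set S3 : Set (Fin N → ℝ) := {g | n * (s * ε) <
    |∑ i, (seErr θ τ b i (g i) ^ 2 - ∫ z, seErr θ τ b i z ^ 2 ∂stdG)|}
  set S4 : Set (Fin N → ℝ) := {g | n * (s * ε) <
    |∑ i, (g i * seErr θ τ b i (g i) - ∫ z, z * seErr θ τ b i z ∂stdG)|}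
  set S5 : Set (Fin N → ℝ) := {g | n * (s * ε) < |∑ i, ((|θ i + seErr θ τ b i (g i)| - |θ i|) -
    ∫ z, (|θ i + seErr θ τ b i z| - |θ i|) ∂stdG)|}
  set S6 : Set (Fin N → ℝ) := {g | ¬ ∃ ι, IsPlan ι ∧
        planCost θ (fun i => seErr θ τ b i (g i)) (seErr θ τ b) ι ≤ c₀ * ε}
  have hc := fun i => continuous_seErr (θ := θ) (τ := τ) hb i
  have q1 : (Pz n).real S1 ≤ 2 * E := by
    have h := Pz_abs_sum_sub_mean_ge_le (N := n) (f := fun _ x => x ^ 2)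
      (fun _ => by fun_prop) one_pos
      (fun i x => by rw [abs_of_nonneg (sq_nonneg x)]; linarith) (by positivity : 0 ≤ s * ε)
      (by nlinarith)
    simp only [integral_sq_stdG] at h
    refine h.trans (mul_le_mul_of_nonneg_left (le_trans ?_ (hle hc₁1)) (by norm_num))
    have e : -(n * (s * ε) ^ 2) / (1640 * 1 ^ 2) = -(δ * s ^ 2 / 1640 * (N * ε ^ 2)) := by
      rw [hn]; ring
    rw [e]
    exact exp_neg_le_rate hp hε hε' (by positivity) (le_of_eq (by ring))
  have q2 : stdG.real S2 ≤ 2 * E := by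
    have h := stdG_abs_ge_le (by positivity : 0 ≤ s * ε * √n)
    have e : -(s * ε * √n) ^ 2 / 4 = -(δ * s ^ 2 / 4 * (N * ε ^ 2)) := by
      rw [mul_pow (s * ε), Real.sq_sqrt hn0.le, hn]; ring
    rw [e] at h
    have h2 : Real.exp (-(δ * s ^ 2 / 4 * (N * ε ^ 2))) ≤ E := by
      refine le_trans ?_ (hle hc₁1)
      refine exp_neg_le_rate hp hε hε' (by positivity) ?_
      have : 0 < δ * s ^ 2 := by positivity
      linarith
    have h3 : 0 < E := Real.exp_pos _
    linarith
  have q3 : (Pz N).real S3 ≤ 2 * E := hgen (f := fun i x => seErr θ τ b i x ^ 2)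
    (fun i => ((hc i).pow 2).measurable) fun i x => by
      rw [abs_of_nonneg (sq_nonneg _)]
      exact (seErr_sq_le hτ hb i x).trans (mul_le_mul_of_nonneg_right hKb.1 (by positivity))
  have q4 : (Pz N).real S4 ≤ 2 * E := hgen (f := fun i x => x * seErr θ τ b i x)
    (fun i => (continuous_id.mul (hc i)).measurable) fun i x =>
      (abs_mul_seErr_le hτ hb i x).trans (mul_le_mul_of_nonneg_right hKb.2 (by positivity))
  have q5 : (Pz N).real S5 ≤ 2 * E := hgen (f := fun i x => |θ i + seErr θ τ b i x| - |θ i|)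
    (fun i => ((continuous_const.add (hc i)).abs.sub continuous_const).measurable) fun i x =>
      (abs_abs_seErr_le hτ hb i x).trans (mul_le_mul_of_nonneg_right hKb.2 (by positivity))
  have q6 : (Pz N).real S6 ≤ C₀ * E := (hplan N hN θ hθ τ b hτ hτT hb ε hε hε').trans
    (mul_le_mul_of_nonneg_left hle6 hC₀.le)
  rw [← Paux_real_fst n N] at q1
  rw [← Paux_real_snd_snd n N] at q2
  rw [← Paux_real_snd_fst n N] at q3 q4 q5 q6
  have hsub : {ω : (Fin n → ℝ) × (Fin N → ℝ) × ℝ | ¬ Typical θ τ b (s * ε) (c₀ * ε) ω} ⊆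
      {ω | ω.1 ∈ S1} ∪ ({ω | ω.2.2 ∈ S2} ∪ ({ω | ω.2.1 ∈ S3} ∪ ({ω | ω.2.1 ∈ S4} ∪
        ({ω | ω.2.1 ∈ S5} ∪ {ω | ω.2.1 ∈ S6})))) := by
    intro ω hω
    by_contra hcon
    simp only [Set.mem_union, not_or] at hcon
    obtain ⟨k1, k2, k3, k4, k5, k6⟩ := hcon
    exact hω ⟨le_of_not_ge k1, le_of_not_ge k2, not_lt.1 k3, not_lt.1 k4, not_lt.1 k5,
      not_not.1 k6⟩
  have hfin := (measureReal_mono hsub (measure_ne_top (Paux n N) _)).trans (measureReal_union_le _ _)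
  have u2 := measureReal_union_le (μ := Paux n N) {ω | ω.2.2 ∈ S2} ({ω | ω.2.1 ∈ S3} ∪
    ({ω | ω.2.1 ∈ S4} ∪ ({ω | ω.2.1 ∈ S5} ∪ {ω | ω.2.1 ∈ S6})))
  have u3 := measureReal_union_le (μ := Paux n N) {ω | ω.2.1 ∈ S3}
    ({ω | ω.2.1 ∈ S4} ∪ ({ω | ω.2.1 ∈ S5} ∪ {ω | ω.2.1 ∈ S6}))
  have u4 := measureReal_union_le (μ := Paux n N) {ω | ω.2.1 ∈ S4}
    ({ω | ω.2.1 ∈ S5} ∪ {ω | ω.2.1 ∈ S6})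
  have u5 := measureReal_union_le (μ := Paux n N) {ω | ω.2.1 ∈ S5} {ω | ω.2.1 ∈ S6}
  linarith

/-- Quantitative Cauchy–Schwarz inequality for two vectors augmented by the coordinate `σ`. -/
lemma sq_dist_le {σ e f W V I D : ℝ} (he : 0 ≤ e) (hf : 0 ≤ f) (he2 : e ^ 2 = σ ^ 2 + W)
    (hf2 : f ^ 2 = σ ^ 2 + V) (hD : D ^ 2 = W - 2 * I + V) (hI : I ^ 2 ≤ W * V) :
    σ ^ 2 * D ^ 2 ≤ 2 * (e * f) * (e * f - σ ^ 2 - I) := by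
  have hef : 0 ≤ e * f := mul_nonneg he hf
  have h1 : (e * f) ^ 2 - (σ ^ 2 + I) ^ 2 = σ ^ 2 * D ^ 2 + (W * V - I ^ 2) := by
    rw [mul_pow, he2, hf2, hD]; ring
  have h2 : σ ^ 2 + I ≤ e * f := by
    refine abs_le_of_sq_le_sq' ?_ hef |>.2
    have := mul_nonneg (sq_nonneg σ) (sq_nonneg D)
    linarith
  have h3 : 0 ≤ (e * f - (σ ^ 2 + I)) ^ 2 := sq_nonneg _
  nlinarith

lemma abs_sub_le_mul_of_sq {f W V I D σ : ℝ} (hf : 0 ≤ f) (hf2 : f ^ 2 = σ ^ 2 + V) (hD0 : 0 ≤ D)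
    (hD : D ^ 2 = W - 2 * I + V) (hI : I ^ 2 ≤ W * V) : |I - V| ≤ f * D := by
  refine abs_le_of_sq_le_sq ?_ (mul_nonneg hf hD0)
  rw [mul_pow, hf2, add_mul]
  have h1 : V * D ^ 2 - (I - V) ^ 2 = W * V - I ^ 2 := by rw [hD]; ring
  have h2 := mul_nonneg (sq_nonneg σ) (sq_nonneg D)
  linarith

lemma le_add_of_sq_dist {σ e f W V I D : ℝ} (hf : 0 ≤ f) (he2 : e ^ 2 = σ ^ 2 + W)
    (hf2 : f ^ 2 = σ ^ 2 + V) (hD0 : 0 ≤ D) (hD : D ^ 2 = W - 2 * I + V) (hI : I ^ 2 ≤ W * V) :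
    e ≤ f + D := by
  refine (abs_le_of_sq_le_sq' ?_ (add_nonneg hf hD0)).2
  have h := (abs_le.1 (abs_sub_le_mul_of_sq hf hf2 hD0 hD hI)).2
  nlinarith

lemma dist_sq_le_aux {σ τ T e f κ W V I D t R : ℝ} (hσ : 0 < σ) (hτ : σ ≤ τ)
    (hf0 : 0 < f) (hfT : f ≤ 2 * T) (hκ : |κ - 1| ≤ t) (ht : t ≤ 1 / 2) (hft : |f - τ| ≤ t / σ)
    (he0 : 0 < e) (he2 : e ^ 2 = σ ^ 2 + W) (hf2 : f ^ 2 = σ ^ 2 + V) (hD0 : 0 ≤ D)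
    (hD : D ^ 2 = W - 2 * I + V) (hI : I ^ 2 ≤ W * V) (hR : 0 ≤ R)
    (h : κ * e - (I - V) / τ ≤ τ + R) :
    σ ^ 2 / (16 * T ^ 2) * D ^ 2 ≤
      (f + D) * ((R + t / σ + 2 * T * t) + t * (1 + 1 / σ ^ 2) * D) := by
  have hτ0 : 0 < τ := hσ.trans_le hτ
  have ht0 : 0 ≤ t := (abs_nonneg _).trans hκ
  have hT0 : 0 ≤ T := by linarith
  have hf := hf0.le
  have he := he0.le
  have hT : 0 < T := by linarith
  obtain ⟨hκ1, hκ2⟩ := abs_le.1 hκ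
  obtain ⟨hf1, hf3⟩ := abs_le.1 hft
  have hIV := abs_sub_le_mul_of_sq hf hf2 hD0 hD hI
  have h1 := sq_dist_le he hf he2 hf2 hD hI
  have h2 := le_add_of_sq_dist hf he2 hf2 hD0 hD hI
  set X := e * f - σ ^ 2 - I with hX
  have hef : 0 < e * f := mul_pos he0 hf0
  have hX0 : 0 ≤ X := by
    have h3 : 0 ≤ 2 * (e * f) * X := (mul_nonneg (sq_nonneg σ) (sq_nonneg D)).trans h1
    exact nonneg_of_mul_nonneg_right h3 (by positivity)
  set r := R + t / σ + 2 * T * t with hr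
  have hr0 : 0 ≤ r := by positivity
  set u := t * (1 + 1 / σ ^ 2) with hu
  have hu0 : 0 ≤ u := by positivity
  have hκX : κ * X ≤ f * (r + u * D) := by
    have e1 : X = e * f - f ^ 2 - (I - V) := by rw [hX, hf2]; ring
    have e2 : κ * e * f ≤ f * (τ + R) + (I - V) * (f / τ) := by
      have := mul_le_mul_of_nonneg_right h hf
      have e3 : (κ * e - (I - V) / τ) * f = κ * e * f - (I - V) * (f / τ) := by ring
      rw [e3] at this
      linarith
    have e4 : |f / τ - κ| ≤ u := by
      have e5 : f / τ - κ = (f - τ) / τ - (κ - 1) := by field_simp; ring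
      have e6 : |(f - τ) / τ| ≤ t / σ ^ 2 := by
        rw [abs_div, abs_of_pos hτ0, div_le_div_iff₀ hτ0 (by positivity)]
        calc |f - τ| * σ ^ 2 ≤ t / σ * σ ^ 2 := by gcongr
          _ = t * σ := by field_simp
          _ ≤ t * τ := by gcongr
      rw [e5, hu]
      refine (abs_sub _ _).trans ?_
      have : t * (1 + 1 / σ ^ 2) = t / σ ^ 2 + t := by ring
      linarith
    have e7 : (I - V) * (f / τ - κ) ≤ f * D * u := by
      refine (le_abs_self _).trans ?_
      rw [abs_mul]
      exact mul_le_mul hIV e4 (abs_nonneg _) (mul_nonneg hf hD0)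
    have e8 : τ - κ * f ≤ t / σ + 2 * T * t := by
      have : (1 - κ) * f ≤ t * (2 * T) := by
        calc (1 - κ) * f ≤ t * f := by gcongr; linarith
          _ ≤ _ := by gcongr
      linarith
    have e9 := mul_le_mul_of_nonneg_left e8 hf
    rw [e1, hr]
    linarith
  have hrD : 0 ≤ r + u * D := by positivity
  have hXle : e * f * X ≤ e * f * (2 * (f * (r + u * D))) := by
    refine mul_le_mul_of_nonneg_left ?_ hef.le
    have : 1 / 2 * X ≤ κ * X := mul_le_mul_of_nonneg_right (by linarith) hX0
    linarith
  have h3 : σ ^ 2 * D ^ 2 ≤ 4 * f ^ 2 * e * (r + u * D) := by linarith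
  have h4 : 4 * f ^ 2 * e * (r + u * D) ≤ 16 * T ^ 2 * ((f + D) * (r + u * D)) := by
    have : f ^ 2 ≤ (2 * T) ^ 2 := pow_le_pow_left₀ hf hfT 2
    calc 4 * f ^ 2 * e * (r + u * D) ≤ 4 * (2 * T) ^ 2 * (f + D) * (r + u * D) := by gcongr
      _ = _ := by ring
  rw [div_mul_eq_mul_div, div_le_iff₀ (by positivity)]
  linarith

lemma sq_le_of_mul_sq_le {s f D r u T σ : ℝ} (hs : 0 < s) (hf : σ ≤ f) (hfT : f ≤ 2 * T)
    (hσ : 0 < σ) (hD : 0 ≤ D) (hu : u ≤ s / 4) (hr0 : 0 ≤ r) (hu0 : 0 ≤ u)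
    (hr : 4 * r < s * σ) (h : s * D ^ 2 ≤ (f + D) * (r + u * D)) :
    s * D ^ 2 ≤ 4 * T * (r + 2 * T * u) := by
  have hrD : 0 ≤ r + u * D := by positivity
  rcases le_total f D with hfD | hfD
  · exfalso
    have hD0 : 0 < D := by linarith
    have h1 : s * D ^ 2 ≤ 2 * D * (r + u * D) :=
      h.trans (mul_le_mul_of_nonneg_right (by linarith) hrD)
    have h2 : s * D ≤ 2 * (r + u * D) := by
      have : D * (s * D) ≤ D * (2 * (r + u * D)) := by linarith
      exact le_of_mul_le_mul_left this hD0
    have h3 : u * D ≤ s / 4 * D := mul_le_mul_of_nonneg_right hu hD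
    have h4 : s * σ ≤ s * D := mul_le_mul_of_nonneg_left (by linarith) hs.le
    linarith
  · refine h.trans ?_
    have h1 : f + D ≤ 4 * T := by linarith
    have h2 : r + u * D ≤ r + 2 * T * u := by
      have : u * D ≤ u * (2 * T) := mul_le_mul_of_nonneg_left (by linarith) hu0
      linarith
    exact mul_le_mul h1 h2 hrD (by linarith)

/-- The `ℓ₁` penalty, centred at `θ`. -/
def penal (lam : ℝ) (n : ℕ) {N : ℕ} (θ w : Fin N → ℝ) : ℝ :=
  lam / n * ∑ i, (|θ i + w i| - |θ i|)

/-- The value of the Lasso problem predicted by state evolution. -/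
def popCost (lam β τ b : ℝ) (n : ℕ) {N : ℕ} (θ : Fin N → ℝ) : ℝ :=
  β ^ 2 / 2 + lam / n * ∑ i, ∫ z, (|θ i + seErr θ τ b i z| - |θ i|) ∂stdG

lemma abs_sub_le_of_abs_sq_sub {x y t s : ℝ} (hs : 0 < s) (hx : 0 ≤ x) (hy : s ≤ y)
    (h : |x ^ 2 - y ^ 2| ≤ t) : |x - y| ≤ t / s := by
  rw [le_div_iff₀ hs]
  refine le_trans ?_ h
  rw [sq_sub_sq, abs_mul, mul_comm]
  exact mul_le_mul_of_nonneg_right (by rw [abs_of_nonneg (by linarith)]; linarith) (abs_nonneg _)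

lemma abs_div_sub_le {S x t : ℝ} {n : ℕ} (hn : 0 < n) (h : |S - n * x| ≤ n * t) :
    |S / n - x| ≤ t := by
  have hn' : (0 : ℝ) < n := by exact_mod_cast hn
  have e : S / n - x = (S - n * x) / n := by field_simp
  rw [e, abs_div, abs_of_pos hn', div_le_iff₀ hn']
  linarith

section
variable {n N : ℕ} {θ : Fin N → ℝ} {δ σ β τ b t q lam : ℝ}
  {ω : (Fin n → ℝ) × (Fin N → ℝ) × ℝ}

lemma Typical.abs_norm_sub (h : Typical θ τ b t q ω) (hn : 0 < n) :
    |enorm2 ω.1 / √n - 1| ≤ t := by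
  have hn' : (0 : ℝ) < n := by exact_mod_cast hn
  have h1 := h.noise
  rw [Finset.sum_sub_distrib, ← enorm2_sq] at h1
  simp only [Finset.sum_const, Finset.card_univ, Fintype.card_fin, nsmul_eq_mul] at h1
  have h2 := abs_div_sub_le hn h1
  have := abs_sub_le_of_abs_sq_sub (x := enorm2 ω.1 / √n) (y := 1) (t := t) one_pos
    (div_nonneg (enorm2_nonneg _) (Real.sqrt_nonneg _)) le_rfl (by
      rwa [div_pow, Real.sq_sqrt hn'.le, one_pow])
  rwa [div_one] at this

lemma Typical.abs_scalar (h : Typical θ τ b t q ω) (hn : 0 < n) (hσ : 0 < σ) :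
    |σ * ω.2.2 / √n| ≤ σ * t := by
  have hn' : (0 : ℝ) < √n := Real.sqrt_pos.2 (by exact_mod_cast hn)
  rw [mul_div_assoc, abs_mul, abs_of_pos hσ, abs_div, abs_of_pos hn']
  exact mul_le_mul_of_nonneg_left ((div_le_iff₀ hn').2 h.scalar) hσ.le

lemma Typical.abs_effNoise_sub (h : Typical θ τ b t q ω) (hn : 0 < n) (hnN : (n : ℝ) = δ * N)
    (hσ : 0 < σ) (hS : SEPoint δ σ θ β τ b) :
    |effNoise σ n (fun i => seErr θ τ b i (ω.2.1 i)) - τ| ≤ t / σ := by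
  refine abs_sub_le_of_abs_sq_sub hσ (effNoise_nonneg _ _ _) hS.sigma_le ?_
  have h1 := h.sq
  rw [Finset.sum_sub_distrib, hS.sum_sq] at h1
  have e : (N : ℝ) * (δ * (τ ^ 2 - σ ^ 2)) = n * (τ ^ 2 - σ ^ 2) := by rw [hnN]; ring
  rw [e] at h1
  have h2 := abs_div_sub_le hn h1
  rw [effNoise_sq]
  convert h2 using 2
  ring

lemma Typical.abs_mul_sub (h : Typical θ τ b t q ω) (hn : 0 < n) (hnN : (n : ℝ) = δ * N)
    (hS : SEPoint δ σ θ β τ b) :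
    |(∑ i, ω.2.1 i * seErr θ τ b i (ω.2.1 i)) / n - (τ - β)| ≤ t := by
  have h1 := h.mul
  rw [Finset.sum_sub_distrib, hS.sum_mul] at h1
  have e : (N : ℝ) * (δ * (τ - β)) = n * (τ - β) := by rw [hnN]; ring
  rw [e] at h1
  exact abs_div_sub_le hn h1

lemma Typical.abs_penal_sub (h : Typical θ τ b t q ω) (hn : 0 < n) (hlam : 0 ≤ lam) :
    |penal lam n θ (fun i => seErr θ τ b i (ω.2.1 i)) -
      (popCost lam β τ b n θ - β ^ 2 / 2)| ≤ lam * t := by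
  have hn' : (0 : ℝ) < n := by exact_mod_cast hn
  have h1 := h.abs
  rw [Finset.sum_sub_distrib] at h1
  unfold penal popCost
  rw [add_sub_cancel_left, ← mul_sub, abs_mul, abs_of_nonneg (by positivity : 0 ≤ lam / n)]
  calc _ ≤ lam / n * (n * t) := mul_le_mul_of_nonneg_left h1 (by positivity)
    _ = lam * t := by field_simp

/-- The auxiliary cost of the state evolution point on the typical event. -/
lemma Typical.auxFun_le (h : Typical θ τ b t q ω) (hn : 0 < n) (hnN : (n : ℝ) = δ * N)
    (hσ : 0 < σ) (hS : SEPoint δ σ θ β τ b) (hlam : 0 ≤ lam) {T lmax : ℝ} (hT : τ ≤ T)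
    (hlmax : lam ≤ lmax) (ht : t ≤ 1) :
    max (auxFun σ 1 ω (fun i => seErr θ τ b i (ω.2.1 i))) 0 ^ 2 / 2 +
      penal lam n θ (fun i => seErr θ τ b i (ω.2.1 i)) ≤
    popCost lam β τ b n θ +
      t * (T * (T + 2 / σ + σ + 1) + (T + 2 / σ + σ + 1) ^ 2 + lmax) := by
  have ht0 : 0 ≤ t := (abs_nonneg _).trans (h.abs_norm_sub hn)
  have h1 := (abs_le.1 (h.abs_norm_sub hn)).2
  have h2 := (abs_le.1 (h.abs_scalar hn hσ)).2
  have h3 := (abs_le.1 (h.abs_effNoise_sub hn hnN hσ hS)).2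
  have h4 := (abs_le.1 (h.abs_mul_sub hn hnN hS)).1
  have h5 := (abs_le.1 (h.abs_penal_sub (β := β) hn hlam)).2
  have hβ := hS.beta_pos
  have hβτ := hS.beta_le
  have hτ : 0 < τ := hσ.trans_le hS.sigma_le
  have he0 := effNoise_nonneg σ n (fun i => seErr θ τ b i (ω.2.1 i))
  have ha : auxFun σ 1 ω (fun i => seErr θ τ b i (ω.2.1 i)) ≤
      β + t * (T + 2 / σ + σ + 1) := by
    unfold auxFun
    rw [one_mul]
    have h6 : enorm2 ω.1 / √n * effNoise σ n (fun i => seErr θ τ b i (ω.2.1 i)) ≤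
        (1 + t) * (τ + t / σ) :=
      mul_le_mul (by linarith) (by linarith) he0 (by linarith)
    have h7 : (1 + t) * (τ + t / σ) ≤ τ + t * (T + 2 / σ) := by
      have : t * (t / σ) ≤ t * (1 / σ) := by gcongr
      have : t * τ ≤ t * T := by gcongr
      have e : t * (T + 2 / σ) = t * T + t / σ + t * (1 / σ) := by ring
      rw [e]; linarith
    linarith
  have hK0 : 0 ≤ T + 2 / σ + σ + 1 := by
    have : 0 ≤ T := by linarith
    positivity
  set K := T + 2 / σ + σ + 1
  have hK : 0 ≤ K := hK0
  have hm : max (auxFun σ 1 ω (fun i => seErr θ τ b i (ω.2.1 i))) 0 ≤ β + t * K :=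
    max_le ha (by positivity)
  have hm2 := pow_le_pow_left₀ (le_max_right _ 0) hm 2
  have h8 : (t * K) ^ 2 ≤ t * K ^ 2 := by
    rw [mul_pow]
    exact mul_le_mul_of_nonneg_right (by nlinarith) (sq_nonneg K)
  have h9 : β * (t * K) ≤ T * (t * K) := mul_le_mul_of_nonneg_right (by linarith) (by positivity)
  have h10 : lam * t ≤ lmax * t := mul_le_mul_of_nonneg_right hlmax ht0
  have h11 : 0 ≤ t * K ^ 2 := by positivity
  clear_value K
  nlinarith

/-- Optimality of soft thresholding, summed over the coordinates. -/
lemma penal_sub_penal_ge (hlam : 0 ≤ lam) (hτ : 0 < τ) (hβ : 0 < β) (hb : b = τ * lam / β)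
    (g w : Fin N → ℝ) :
    β / n * ∑ i, (g i - seErr θ τ b i (g i) / τ) * (w i - seErr θ τ b i (g i)) ≤
      penal lam n θ w - penal lam n θ (fun i => seErr θ τ b i (g i)) := by
  unfold penal
  have hb0 : 0 ≤ b := by rw [hb]; positivity
  rw [← mul_sub, ← Finset.sum_sub_distrib, Finset.mul_sum, Finset.mul_sum]
  refine Finset.sum_le_sum fun i _ => ?_
  have h1 := eta_prox (x := θ i + τ * g i) hb0 (θ i + w i)
  have e1 : θ i + seErr θ τ b i (g i) = eta (θ i + τ * g i) b := by unfold seErr; ring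
  have e2 : eta (θ i + τ * g i) b = θ i + seErr θ τ b i (g i) := e1.symm
  rw [e2] at h1
  have h2 := mul_le_mul_of_nonneg_left h1 (by positivity : 0 ≤ β / τ / n)
  have e3 : β / τ / n * (b * (|θ i + w i| - |θ i + seErr θ τ b i (g i)|)) =
      lam / n * (|θ i + w i| - |θ i| - (|θ i + seErr θ τ b i (g i)| - |θ i|)) := by
    have : β / τ / n * b = lam / n := by rw [hb]; field_simp
    rw [← mul_assoc, this]; ring
  rw [e3] at h2
  refine le_trans (le_of_eq ?_) h2
  field_simp
  ring

end

lemma abs_one_sub_mul_sub_one_le {x y t : ℝ} (hx : 0 ≤ x) (hx1 : x ≤ 1) (hy : |y - 1| ≤ t) :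
    |(1 - x) * y - 1| ≤ t + x := by
  have e : (1 - x) * y - 1 = (1 - x) * (y - 1) - x := by ring
  have ht : 0 ≤ t := (abs_nonneg _).trans hy
  rw [e]
  refine (abs_sub _ _).trans ?_
  rw [abs_mul, abs_of_nonneg hx, abs_of_nonneg (by linarith : 0 ≤ 1 - x)]
  have h1 : (1 - x) * |y - 1| ≤ 1 * t := mul_le_mul (by linarith) hy (abs_nonneg _) zero_le_one
  linarith

section
variable {n N : ℕ} {θ : Fin N → ℝ} {δ σ β τ b t q lam : ℝ}
  {ω : (Fin n → ℝ) × (Fin N → ℝ) × ℝ}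

lemma scalar_chain {β τ κ e S G Gs IV P ls l Q r η t lam σ : ℝ} (hβ : 0 < β)
    (haux : κ * e + S - G ≤ Q + η) (hQ : β * Q ≤ β ^ 2 / 2 + (P + r - l))
    (hprox : β * (G - Gs - IV / τ) ≤ l - ls) (hls : P - β ^ 2 / 2 - ls ≤ lam * t)
    (hS : -S ≤ σ * t) (hG : Gs - (τ - β) ≤ t) :
    κ * e - IV / τ ≤ τ + ((r + lam * t) / β + η + (σ + 1) * t) := by
  have h1 := mul_le_mul_of_nonneg_left haux hβ.le
  have h2 : β * (κ * e - IV / τ) ≤ β * (τ + (η + (σ + 1) * t)) + (r + lam * t) := by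
    have h3 := mul_le_mul_of_nonneg_left hS hβ.le
    have h4 := mul_le_mul_of_nonneg_left hG hβ.le
    nlinarith
  have h5 : β * (τ + ((r + lam * t) / β + η + (σ + 1) * t)) =
      β * (τ + (η + (σ + 1) * t)) + (r + lam * t) := by field_simp; ring
  rw [← h5] at h2
  exact le_of_mul_le_mul_left h2 hβ

/-- Any vector competing with the state evolution point on the typical event is close to it. -/
lemma Typical.dist_le (h : Typical θ τ b t q ω) (hn : 0 < n) (hnN : (n : ℝ) = δ * N)
    (hσ : 0 < σ) (hS : SEPoint δ σ θ β τ b) (hlam : 0 ≤ lam) (hb : b = τ * lam / β)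
    {T lmax bmin x r η : ℝ} (hT : τ ≤ T) (hlmax : lam ≤ lmax) (hbmin : 0 < bmin) (hβ : bmin ≤ β)
    (hx : 0 ≤ x) (hr : 0 ≤ r) (hη : 0 ≤ η) (htx : t + x ≤ 1 / 2) (htσ : t + x ≤ σ ^ 2)
    {w : Fin N → ℝ} (hw : penal lam n θ w ≤ popCost lam β τ b n θ + r)
    (haux : auxFun σ (1 - x) ω w ≤
      √(2 * (popCost lam β τ b n θ + r - penal lam n θ w)) + η)
    (hu : (t + x) * (1 + 1 / σ ^ 2) ≤ σ ^ 2 / (16 * T ^ 2) / 4)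
    (hrr : 4 * ((r + lmax * t) / bmin + η + (σ + 1) * t + (t + x) / σ + 2 * T * (t + x)) <
      σ ^ 2 / (16 * T ^ 2) * σ) :
    σ ^ 2 / (16 * T ^ 2) * ((∑ i, (w i - seErr θ τ b i (ω.2.1 i)) ^ 2) / n) ≤
      4 * T * (((r + lmax * t) / bmin + η + (σ + 1) * t + (t + x) / σ + 2 * T * (t + x)) +
        2 * T * ((t + x) * (1 + 1 / σ ^ 2))) := by
  have hn' : (0 : ℝ) < n := by exact_mod_cast hn
  have hβ0 := hS.beta_pos
  have hτσ := hS.sigma_le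
  have hτ : 0 < τ := hσ.trans_le hτσ
  have hT0 : 0 < T := hτ.trans_le hT
  obtain ⟨k1, k2⟩ := abs_le.1 (h.abs_norm_sub hn)
  have ht0 : 0 ≤ t := (abs_nonneg _).trans (h.abs_norm_sub hn)
  have hft := h.abs_effNoise_sub hn hnN hσ hS
  have h3 := (abs_le.1 hft).2
  have h5 := (abs_le.1 (h.abs_penal_sub (β := β) hn hlam)).1
  have h6 := penal_sub_penal_ge (n := n) (θ := θ) hlam hτ hβ0 hb ω.2.1 w
  have hS2 := (abs_le.1 (h.abs_scalar hn hσ)).1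
  have hG := (abs_le.1 (h.abs_mul_sub hn hnN hS)).2
  set v : Fin N → ℝ := fun i => seErr θ τ b i (ω.2.1 i) with hv
  set W := (∑ i, w i ^ 2) / n with hW
  set V := (∑ i, v i ^ 2) / n with hV
  set I := (∑ i, w i * v i) / n with hI
  set D := √((∑ i, (w i - v i) ^ 2) / n) with hD
  have hD2 : D ^ 2 = (∑ i, (w i - v i) ^ 2) / n := Real.sq_sqrt (by positivity)
  have hD2' : D ^ 2 = W - 2 * I + V := by
    rw [hD2, hW, hI, hV, ← mul_div_assoc, ← sub_div, ← add_div, Finset.mul_sum,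
      ← Finset.sum_sub_distrib, ← Finset.sum_add_distrib]
    congr 1
    exact Finset.sum_congr rfl fun i _ => by ring
  have hCS : I ^ 2 ≤ W * V := by
    rw [hI, hW, hV, div_pow, div_mul_div_comm, ← pow_two (n : ℝ)]
    exact div_le_div_of_nonneg_right (Finset.sum_mul_sq_le_sq_mul_sq _ _ _) (by positivity)
  have hprox : β * ((∑ j, ω.2.1 j * w j) / n - (∑ j, ω.2.1 j * v j) / n - (I - V) / τ) ≤
      penal lam n θ w - penal lam n θ v := by
    refine le_trans (le_of_eq ?_) h6
    rw [hI, hV, ← sub_div, ← sub_div, ← Finset.sum_sub_distrib, ← Finset.sum_sub_distrib,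
      div_div, mul_comm (n : ℝ) τ, ← div_div, ← sub_div, Finset.sum_div, ← Finset.sum_sub_distrib,
      div_mul_eq_mul_div, mul_div_assoc]
    congr 2
    exact Finset.sum_congr rfl fun i _ => by ring
  have hQ : β * √(2 * (popCost lam β τ b n θ + r - penal lam n θ w)) ≤
      β ^ 2 / 2 + (popCost lam β τ b n θ + r - penal lam n θ w) := by
    have e := Real.sq_sqrt
      (by linarith : 0 ≤ 2 * (popCost lam β τ b n θ + r - penal lam n θ w))
    nlinarith [sq_nonneg (β - √(2 * (popCost lam β τ b n θ + r - penal lam n θ w)))]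
  have hmain := scalar_chain (κ := (1 - x) * (enorm2 ω.1 / √n)) (e := effNoise σ n w) (t := t)
    (lam := lam) (r := r) (P := popCost lam β τ b n θ) (l := penal lam n θ w) hβ0
    haux hQ hprox (by linarith) (by linarith : -(σ * ω.2.2 / √n) ≤ σ * t) hG
  have hpos : ∀ u : Fin N → ℝ, 0 < effNoise σ n u := fun u => by
    unfold effNoise; exact Real.sqrt_pos.2 (by positivity)
  have hσf : σ ≤ effNoise σ n v := by
    unfold effNoise
    refine Real.le_sqrt_of_sq_le ?_
    have : 0 ≤ (∑ j, v j ^ 2) / n := by positivity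
    linarith
  have hfT : effNoise σ n v ≤ 2 * T := by
    have : t / σ ≤ σ := by rw [div_le_iff₀ hσ, ← pow_two]; linarith
    linarith
  have hκ : |(1 - x) * (enorm2 ω.1 / √n) - 1| ≤ t + x :=
    abs_one_sub_mul_sub_one_le hx (by linarith) (abs_le.2 ⟨k1, k2⟩)
  have hR : (r + lam * t) / β + η + (σ + 1) * t ≤ (r + lmax * t) / bmin + η + (σ + 1) * t := by
    have h1 : (r + lam * t) / β ≤ (r + lmax * t) / bmin := by
      have : lam * t ≤ lmax * t := mul_le_mul_of_nonneg_right hlmax ht0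
      exact div_le_div₀ (by linarith [mul_nonneg hlam ht0]) (by linarith) hbmin hβ
    linarith
  have hlmax0 : 0 ≤ lmax := hlam.trans hlmax
  have hd := dist_sq_le_aux (κ := (1 - x) * (enorm2 ω.1 / √n)) (t := t + x)
    (R := (r + lmax * t) / bmin + η + (σ + 1) * t) hσ hτσ (hpos v) hfT hκ htx
    (hft.trans (div_le_div_of_nonneg_right (by linarith) hσ.le)) (hpos w) (effNoise_sq σ n w)
    (effNoise_sq σ n v) (Real.sqrt_nonneg _) hD2' hCS (by positivity) (hmain.trans (by linarith))
  have hfin := sq_le_of_mul_sq_le (by positivity : 0 < σ ^ 2 / (16 * T ^ 2)) hσf hfT hσ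
    (Real.sqrt_nonneg _) hu (by positivity) (by positivity) hrr hd
  rw [← hD, hD2] at hfin
  exact hfin

end

section
variable {N : ℕ} {ι : Fin N → ℝ → Fin N} {θ w v : Fin N → ℝ} {e e' : Fin N → ℝ → ℝ}

lemma integrable_planCost (hι : IsPlan ι) (θ w : Fin N → ℝ) (he : ∀ j, Measurable (e j))
    (he2 : ∀ j, Integrable (fun z => e j z ^ 2) stdG) (j : Fin N) :
    Integrable (fun z => (θ (ι j z) + w (ι j z) - (θ j + e j z)) ^ 2 + (θ (ι j z) - θ j) ^ 2)
      stdG := by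
  have h1 := integrable_comp_plan hι (fun i => 2 * (θ i + w i - θ j) ^ 2 + (θ i - θ j) ^ 2) j
  have h2 : Integrable (fun z => (2 * (θ (ι j z) + w (ι j z) - θ j) ^ 2 + (θ (ι j z) - θ j) ^ 2) +
      2 * e j z ^ 2) stdG := h1.add ((he2 j).const_mul 2)
  refine h2.mono' ?_ (Filter.Eventually.of_forall fun z => ?_)
  · exact ((((measurable_comp_plan hι (fun i => θ i + w i) j).sub
      (measurable_const.add (he j))).pow_const 2).add
      ((measurable_comp_plan hι (fun i => θ i - θ j) j).pow_const 2)).aestronglyMeasurable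
  · rw [Real.norm_of_nonneg (by positivity)]
    nlinarith [sq_nonneg (θ (ι j z) + w (ι j z) - θ j + e j z)]

lemma planCost_le_of_vec (hι : IsPlan ι) (he : ∀ j, Measurable (e j))
    (he2 : ∀ j, Integrable (fun z => e j z ^ 2) stdG) :
    planCost θ w e ι ≤ 2 * planCost θ v e ι + 2 * ((∑ i, (w i - v i) ^ 2) / N) := by
  have h : ∀ j, ∫ z, ((θ (ι j z) + w (ι j z) - (θ j + e j z)) ^ 2 + (θ (ι j z) - θ j) ^ 2) ∂stdG ≤
      2 * ∫ z, ((θ (ι j z) + v (ι j z) - (θ j + e j z)) ^ 2 + (θ (ι j z) - θ j) ^ 2) ∂stdG +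
      2 * ∫ z, (fun i => (w i - v i) ^ 2) (ι j z) ∂stdG := fun j => by
    have h1 := integrable_planCost hι θ v he he2 j
    have h2 := integrable_comp_plan hι (fun i => (w i - v i) ^ 2) j
    rw [← integral_const_mul, ← integral_const_mul, ← integral_add (h1.const_mul 2) (h2.const_mul 2)]
    refine integral_mono (integrable_planCost hι θ w he he2 j)
      ((h1.const_mul 2).add (h2.const_mul 2)) fun z => ?_
    simp only
    nlinarith [sq_nonneg (θ (ι j z) + v (ι j z) - (θ j + e j z) - (w (ι j z) - v (ι j z))),
      sq_nonneg (θ (ι j z) - θ j)]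
  unfold planCost
  rw [mul_div_assoc', mul_div_assoc', ← add_div]
  refine div_le_div_of_nonneg_right ?_ (Nat.cast_nonneg N)
  refine (Finset.sum_le_sum fun j _ => h j).trans (le_of_eq ?_)
  rw [Finset.sum_add_distrib, ← Finset.mul_sum, ← Finset.mul_sum,
    hι.sum_integral_comp (fun i => (w i - v i) ^ 2)]

lemma planCost_le_of_fun (hι : IsPlan ι) (he : ∀ j, Measurable (e j))
    (he2 : ∀ j, Integrable (fun z => e j z ^ 2) stdG) (he' : ∀ j, Measurable (e' j))
    (he2' : ∀ j, Integrable (fun z => e' j z ^ 2) stdG) :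
    planCost θ w e ι ≤
      2 * planCost θ w e' ι + 2 * ((∑ j, ∫ z, (e j z - e' j z) ^ 2 ∂stdG) / N) := by
  have hd : ∀ j, Integrable (fun z => (e j z - e' j z) ^ 2) stdG := fun j => by
    have h2 : Integrable (fun z => 2 * e j z ^ 2 + 2 * e' j z ^ 2) stdG :=
      ((he2 j).const_mul 2).add ((he2' j).const_mul 2)
    refine h2.mono' (((he j).sub (he' j)).pow_const 2).aestronglyMeasurable
      (Filter.Eventually.of_forall fun z => ?_)
    rw [Real.norm_of_nonneg (by positivity)]
    nlinarith [sq_nonneg (e j z + e' j z)]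
  have h : ∀ j, ∫ z, ((θ (ι j z) + w (ι j z) - (θ j + e j z)) ^ 2 + (θ (ι j z) - θ j) ^ 2) ∂stdG ≤
      2 * ∫ z, ((θ (ι j z) + w (ι j z) - (θ j + e' j z)) ^ 2 + (θ (ι j z) - θ j) ^ 2) ∂stdG +
      2 * ∫ z, (e j z - e' j z) ^ 2 ∂stdG := fun j => by
    have h1 := integrable_planCost hι θ w he' he2' j
    rw [← integral_const_mul, ← integral_const_mul,
      ← integral_add (h1.const_mul 2) ((hd j).const_mul 2)]
    refine integral_mono (integrable_planCost hι θ w he he2 j)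
      ((h1.const_mul 2).add ((hd j).const_mul 2)) fun z => ?_
    simp only
    nlinarith [sq_nonneg (θ (ι j z) + w (ι j z) - (θ j + e' j z) + (e j z - e' j z)),
      sq_nonneg (θ (ι j z) - θ j)]
  unfold planCost
  rw [mul_div_assoc', mul_div_assoc', ← add_div]
  refine div_le_div_of_nonneg_right ?_ (Nat.cast_nonneg N)
  refine (Finset.sum_le_sum fun j _ => h j).trans (le_of_eq ?_)
  rw [Finset.sum_add_distrib, ← Finset.mul_sum, ← Finset.mul_sum]

end

lemma continuous_penal (lam : ℝ) (n : ℕ) {N : ℕ} (θ : Fin N → ℝ) : Continuous (penal lam n θ) := by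
  unfold penal; fun_prop

lemma convexOn_penal {lam : ℝ} (hlam : 0 ≤ lam) (n : ℕ) {N : ℕ} (θ : Fin N → ℝ) :
    ConvexOn ℝ Set.univ (penal lam n θ) := by
  refine ⟨convex_univ, fun u _ v _ a c ha hc hac => ?_⟩
  unfold penal
  simp only [smul_eq_mul, Pi.add_apply, Pi.smul_apply]
  rw [mul_left_comm a, mul_left_comm c, ← mul_add, Finset.mul_sum _ _ a, Finset.mul_sum _ _ c,
    ← Finset.sum_add_distrib]
  refine mul_le_mul_of_nonneg_left (Finset.sum_le_sum fun i _ => ?_) (by positivity)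
  have e1 : θ i + (a * u i + c * v i) = a * (θ i + u i) + c * (θ i + v i) := by
    have : θ i = (a + c) * θ i := by rw [hac, one_mul]
    linear_combination this
  have e2 : a * (|θ i + u i| - |θ i|) + c * (|θ i + v i| - |θ i|) =
      a * |θ i + u i| + c * |θ i + v i| - |θ i| := by linear_combination -|θ i| * hac
  rw [e1, e2]
  have h := abs_add_le (a * (θ i + u i)) (c * (θ i + v i))
  rw [abs_mul, abs_mul, abs_of_nonneg ha, abs_of_nonneg hc] at h
  linarith

/-- Vectors without a cheap plan to the prediction, or of large norm. -/
def badSet {N : ℕ} (θ : Fin N → ℝ) (τ b ε R : ℝ) : Set (Fin N → ℝ) :=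
  {w | (¬ ∃ ι, IsPlan ι ∧ planCost θ w (seErr θ τ b) ι < ε / 4) ∨ R ^ 2 * N ≤ ∑ i, w i ^ 2}

lemma exists_pos_forall_mul_le_one (l : List ℝ) : ∃ c : ℝ, 0 < c ∧ ∀ k ∈ l, c * k ≤ 1 := by
  induction l with
  | nil => exact ⟨1, one_pos, by simp⟩
  | cons a l ih =>
    obtain ⟨c, hc, h⟩ := ih
    refine ⟨min c (1 / (|a| + 1)), by positivity, ?_⟩
    have hm : 0 < min c (1 / (|a| + 1)) := by positivity
    intro k hk
    rcases List.mem_cons.1 hk with rfl | hk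
    · have h1 : min c (1 / (|k| + 1)) * (|k| + 1) ≤ 1 := by
        rw [← le_div_iff₀ (by positivity)]; exact min_le_right _ _
      nlinarith [le_abs_self k]
    · rcases le_total k 0 with h0 | h0
      · nlinarith
      · exact (mul_le_mul_of_nonneg_right (min_le_left _ _) h0).trans (h k hk)

section
variable {n N : ℕ} {θ : Fin N → ℝ} {δ σ β τ b t q lam ε R : ℝ}
  {ω : (Fin n → ℝ) × (Fin N → ℝ) × ℝ}

/-- Vectors close to the state evolution point are not bad. -/
lemma Typical.notMem_badSet (h : Typical θ τ b t (1 / 16 * ε) ω) (hn : 0 < n) (hN : 0 < N)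
    (hnN : (n : ℝ) = δ * N) (hσ : 0 < σ) (hδ : 0 < δ) (hS : SEPoint δ σ θ β τ b) (hb : 0 ≤ b)
    (hε : 0 < ε) (hε1 : ε ≤ 1) (ht : t ≤ 1) {T : ℝ} (hT : τ ≤ T)
    (hR : R ^ 2 = 2 * δ * (T + 1 / σ) ^ 2 + 1) {w : Fin N → ℝ}
    (hw : (∑ i, (w i - seErr θ τ b i (ω.2.1 i)) ^ 2) / n ≤ ε / (32 * δ)) :
    w ∉ badSet θ τ b ε R := by
  have hn' : (0 : ℝ) < n := by exact_mod_cast hn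
  have hN' : (0 : ℝ) < N := by exact_mod_cast hN
  have hτ : 0 < τ := hσ.trans_le hS.sigma_le
  rw [div_le_div_iff₀ hn' (by positivity), hnN] at hw
  have hD : (∑ i, (w i - seErr θ τ b i (ω.2.1 i)) ^ 2) ≤ ε / 32 * N := by
    have : (∑ i, (w i - seErr θ τ b i (ω.2.1 i)) ^ 2) * (32 * δ) ≤ ε / 32 * N * (32 * δ) := by
      linarith
    exact le_of_mul_le_mul_right this (by positivity)
  intro hbad
  rw [badSet, Set.mem_ofPred_eq] at hbad
  rcases hbad with hbad | hbad
  · obtain ⟨ι, hι, hc⟩ := h.plan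
    refine hbad ⟨ι, hι, ?_⟩
    have h1 := planCost_le_of_vec (θ := θ) (w := w) (e := seErr θ τ b) (v := fun i => seErr θ τ b i (ω.2.1 i)) hι
      (fun j => (continuous_seErr hb j).measurable) (integrable_seErr_sq hτ.le hb)
    have h2 : (∑ i, (w i - seErr θ τ b i (ω.2.1 i)) ^ 2) / N ≤ ε / 32 := by
      rwa [div_le_iff₀ hN']
    linarith
  · have h1 : ∑ i, w i ^ 2 ≤ 2 * ∑ i, seErr θ τ b i (ω.2.1 i) ^ 2 +
        2 * ∑ i, (w i - seErr θ τ b i (ω.2.1 i)) ^ 2 := by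
      rw [Finset.mul_sum, Finset.mul_sum, ← Finset.sum_add_distrib]
      refine Finset.sum_le_sum fun i _ => ?_
      nlinarith [sq_nonneg (seErr θ τ b i (ω.2.1 i) - (w i - seErr θ τ b i (ω.2.1 i)))]
    have h2 := effNoise_sq σ n (fun i => seErr θ τ b i (ω.2.1 i))
    have h3 := (abs_le.1 (h.abs_effNoise_sub hn hnN hσ hS)).2
    have h4 := effNoise_nonneg σ n (fun i => seErr θ τ b i (ω.2.1 i))
    have h5 : t / σ ≤ 1 / σ := div_le_div_of_nonneg_right ht hσ.le
    have h6 : effNoise σ n (fun i => seErr θ τ b i (ω.2.1 i)) ≤ T + 1 / σ := by linarith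
    have h7 : (∑ i, seErr θ τ b i (ω.2.1 i) ^ 2) / n ≤ (T + 1 / σ) ^ 2 := by
      have := pow_le_pow_left₀ h4 h6 2
      nlinarith [sq_nonneg σ]
    rw [div_le_iff₀ hn', hnN] at h7
    rw [hR] at hbad
    nlinarith

end

lemma error_scale {t η x r m σ T lmax bmin : ℝ} (ht : t ≤ m)
    (hη : η ≤ m) (hx : x ≤ m) (hr : r ≤ 2 * m) (hσ : 0 < σ) (hT : 0 ≤ T) (hl : 0 ≤ lmax)
    (hb : 0 < bmin) :
    (r + lmax * t) / bmin + η + (σ + 1) * t + (t + x) / σ + 2 * T * (t + x) ≤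
      m * ((2 + lmax) / bmin + 1 + (σ + 1) + 2 / σ + 4 * T) := by
  have h1 : (r + lmax * t) / bmin ≤ m * ((2 + lmax) / bmin) := by
    rw [← mul_div_assoc]
    refine div_le_div_of_nonneg_right ?_ hb.le
    nlinarith
  have h2 : (t + x) / σ ≤ m * (2 / σ) := by
    rw [← mul_div_assoc]
    exact div_le_div_of_nonneg_right (by linarith) hσ.le
  nlinarith [mul_le_mul_of_nonneg_left ht (by linarith : 0 ≤ σ + 1),
    mul_le_mul_of_nonneg_left ht hT, mul_le_mul_of_nonneg_left hx hT]


lemma le_of_mul_div_le_one {c a b : ℝ} (hb : 0 < b) (h : c * (a / b) ≤ 1) : c * a ≤ b := by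
  rwa [← mul_div_assoc, div_le_one hb] at h

/-- The costs of the Lasso problem: the minimum is at most the prediction, and bad vectors
are suboptimal. -/
def GoodCosts {n N : ℕ} (σ lam β τ b κ ε R : ℝ) (θ : Fin N → ℝ)
    (ω : (Fin n → Fin N → ℝ) × (Fin n → ℝ)) : Prop :=
  (∃ w, primCost σ (penal lam n θ) ω w ≤ popCost lam β τ b n θ + κ) ∧
    ∀ w ∈ badSet θ τ b ε R, popCost lam β τ b n θ + 2 * κ ≤ primCost σ (penal lam n θ) ω w

lemma Pmodel_real_not_goodCosts_le {n N : ℕ} (hn : n ≠ 0) {σ lam β τ b κ ε R x : ℝ}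
    (θ : Fin N → ℝ) (hlam : 0 ≤ lam) (hκ : 0 < κ) (hx : 0 < x)
    (hmin : ∀ ω, ∃ v, ∀ w, primCost (n := n) σ (penal lam n θ) ω v ≤
      primCost σ (penal lam n θ) ω w)
    {S : Set ((Fin n → ℝ) × (Fin N → ℝ) × ℝ)}
    (h1 : ∀ ω, (∀ w, popCost lam β τ b n θ + κ - κ / 2 ≤
      max (auxFun σ 1 ω w) 0 ^ 2 / 2 + penal lam n θ w) → ω ∈ S)
    (h2 : ∀ ω, (∃ w ∈ badSet θ τ b ε R, penal lam n θ w ≤ popCost lam β τ b n θ + 2 * κ ∧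
      auxFun σ (1 - x) ω w ≤
        √(2 * (popCost lam β τ b n θ + 2 * κ - penal lam n θ w)) + x) → ω ∈ S) :
    (Pmodel n N).real {ω | ¬ GoodCosts σ lam β τ b κ ε R θ ω} ≤ 4 * (Paux n N).real S := by
  have e1 := lt_primCost_le hn σ (continuous_penal lam n θ) (convexOn_penal hlam n θ) hmin
    (popCost lam β τ b n θ + κ) (half_pos hκ)
  have e2 := primCost_lt_le hn σ (badSet θ τ b ε R) (continuous_penal lam n θ)
    (popCost lam β τ b n θ + 2 * κ) hx hx
  have hsub : {ω | ¬ GoodCosts σ lam β τ b κ ε R θ ω} ⊆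
      {ω | ∀ w, popCost lam β τ b n θ + κ < primCost (n := n) σ (penal lam n θ) ω w} ∪
      {ω | ∃ w ∈ badSet θ τ b ε R,
        primCost (n := n) σ (penal lam n θ) ω w < popCost lam β τ b n θ + 2 * κ} := by
    intro ω hω
    rw [Set.mem_ofPred_eq, GoodCosts, not_and_or] at hω
    push Not at hω
    exact hω
  have h3 : Pmodel n N {ω | ¬ GoodCosts σ lam β τ b κ ε R θ ω} ≤ 4 * Paux n N S := by
    refine (measure_mono hsub).trans ((measure_union_le _ _).trans ?_)
    refine (add_le_add (e1.trans (mul_le_mul_right (measure_mono h1) 2))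
      (e2.trans (mul_le_mul_right (measure_mono h2) 2))).trans (le_of_eq ?_)
    rw [← add_mul]; norm_num
  have h4 := ENNReal.toReal_mono (ENNReal.mul_ne_top (by simp) (measure_ne_top _ _)) h3
  rw [ENNReal.toReal_mul] at h4
  simpa [measureReal_def] using h4

theorem exists_goodCosts_rate {δ σ lmin lmax p ξ : ℝ} (hδ : 0 < δ) (hσ : 0 < σ) (hl : 0 < lmin)
    (hp : 0 < p) (hξ : 0 < ξ) :
    ∃ κ R C c : ℝ, 0 < κ ∧ 0 < R ∧ 0 < C ∧ 0 < c ∧ ∀ n N : ℕ, 0 < N → (n : ℝ) = δ * N →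
      ∀ θ ∈ Fball N p ξ, ∀ lam ∈ Set.Icc lmin lmax, ∀ β τ,
      StateEvo δ σ (empDist θ) lam β τ →
      (∀ ω, ∃ v, ∀ w, primCost (n := n) σ (penal lam n θ) ω v ≤
        primCost σ (penal lam n θ) ω w) →
      ∀ ε, 0 < ε → ε ≤ 1 / 2 →
      (Pmodel n N).real {ω | ¬ GoodCosts σ lam β τ (τ * lam / β) (κ * ε) ε R θ ω} ≤
        C * Real.exp (-(c * rate p N ε)) := by
  rcases lt_or_ge lmax lmin with hll | hll
  · exact ⟨1, 1, 1, 1, one_pos, one_pos, one_pos, one_pos, fun n N _ _ θ _ lam hlam =>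
      absurd (hlam.1.trans hlam.2) hll.not_ge⟩
  obtain ⟨A, T', hA, hT', hAT⟩ := exists_stateEvo_bounds (lmax := lmax) hδ hσ hl hp hξ
  set T := max T' 1 with hTdef
  have hT1 : 1 ≤ T := le_max_right _ _
  have hT0 : 0 < T := one_pos.trans_le hT1
  set bmin := lmin / A with hbmindef
  have hbmin : 0 < bmin := by positivity
  have hlmax : 0 < lmax := hl.trans_le hll
  set s := σ ^ 2 / (16 * T ^ 2) with hs
  have hs0 : 0 < s := by positivity
  set Mr := (2 + lmax) / bmin + 1 + (σ + 1) + 2 / σ + 4 * T with hMr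
  have hMr0 : 0 < Mr := by positivity
  set Mu := 2 * (1 + 1 / σ ^ 2) with hMu
  have hMu0 : 0 < Mu := by positivity
  set K := T * (T + 2 / σ + σ + 1) + (T + 2 / σ + σ + 1) ^ 2 + lmax with hK
  have hK0 : 0 < K := by positivity
  clear_value T bmin s Mr Mu K
  obtain ⟨c₁, hc₁, hc⟩ := exists_pos_forall_mul_le_one [2, δ, 1 / σ ^ 2, Mu / (s / 4),
    4 * Mr / (s * σ), 4 * T * (Mr + 2 * T * Mu) / (s / (32 * δ))]
  have k1 := hc 2 (by simp)
  have k2 := hc δ (by simp)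
  have k3 := le_of_mul_div_le_one (by positivity) (hc (1 / σ ^ 2) (by simp))
  have k4 := le_of_mul_div_le_one (by positivity) (hc (Mu / (s / 4)) (by simp))
  have k5 := le_of_mul_div_le_one (by positivity) (hc (4 * Mr / (s * σ)) (by simp))
  have k6 := le_of_mul_div_le_one (by positivity)
    (hc (4 * T * (Mr + 2 * T * Mu) / (s / (32 * δ))) (by simp))
  clear hc
  obtain ⟨c₂, hc₂, hc⟩ := exists_pos_forall_mul_le_one [1 / c₁, 4 * K / c₁]
  have j1 := le_of_mul_div_le_one (by positivity) (hc (1 / c₁) (by simp))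
  have j2 := le_of_mul_div_le_one (by positivity) (hc (4 * K / c₁) (by simp))
  clear hc
  rw [mul_one] at k3 j1
  obtain ⟨C, c, hC, hc, hrate⟩ := exists_typical_rate (p := p) (ξ := ξ) (δ := δ) (T₀ := T)
    (B₀ := T * A) (s := c₂) (c₀ := 1 / 16) hp hξ hδ hT1 (by positivity) hc₂ (by linarith)
    ((mul_le_mul_of_nonneg_left j1 hδ.le).trans (by linarith)) (by norm_num) (by norm_num)
  refine ⟨c₁, √(2 * δ * (T + 1 / σ) ^ 2 + 1), 4 * C, c, hc₁, by positivity, by positivity, hc,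
    fun n N hN hnN θ hθ lam hlam β τ hSE hmin ε hε hε' => ?_⟩
  have hn : 0 < n := by
    have : (0 : ℝ) < n := by rw [hnN]; exact mul_pos hδ (by exact_mod_cast hN)
    exact_mod_cast this
  have hlam0 : 0 < lam := hl.trans_le hlam.1
  obtain ⟨hA', hT''⟩ := hAT N hN θ hθ lam hlam β τ hSE
  have hS := hSE.sePoint hN hδ hlam0.le
  have hτ : 0 < τ := hσ.trans_le hS.sigma_le
  have hβ : 0 < β := hS.beta_pos
  have hτT : τ ≤ T := hT''.trans (hTdef ▸ le_max_left _ _)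
  have hβmin : bmin ≤ β := by
    rw [div_le_iff₀ hβ] at hA'
    rw [hbmindef, div_le_iff₀ hA]
    linarith [hlam.1]
  set b := τ * lam / β with hb
  have hb0 : 0 ≤ b := by positivity
  have hbB : b ≤ T * A := by
    rw [hb, mul_div_assoc]
    exact mul_le_mul hτT hA' (by positivity) hT0.le
  have hm0 : 0 < c₁ * ε := by positivity
  have hx0 : 0 < c₂ * ε := by positivity
  have hx1 : c₂ * ε ≤ c₁ * ε := mul_le_mul_of_nonneg_right j1 hε.le
  have hc₁ε : c₁ * ε ≤ c₁ / 2 := by linarith [mul_le_mul_of_nonneg_left hε' hc₁.le]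
  refine (Pmodel_real_not_goodCosts_le (x := c₂ * ε)
    (S := {ω | ¬ Typical θ τ b (c₂ * ε) (1 / 16 * ε) ω}) hn.ne' θ hlam0.le hm0 hx0 hmin
    ?_ ?_).trans ?_
  · intro ω hω h
    have g1 := hω fun i => seErr θ τ b i (ω.2.1 i)
    have g2 := h.auxFun_le hn hnN hσ hS hlam0.le hτT hlam.2 (by linarith)
    rw [← hK] at g2
    have g3 : c₂ * ε * K ≤ c₁ * ε / 4 := by linarith [mul_le_mul_of_nonneg_right j2 hε.le]
    linarith
  · rintro ω ⟨w, hw, hwp, haux⟩ h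
    refine h.notMem_badSet hn hN hnN hσ hδ hS hb0 hε (by linarith) (by linarith) hτT
      (Real.sq_sqrt (by positivity)) ?_ hw
    have g1 : (2 * (c₁ * ε) + lmax * (c₂ * ε)) / bmin + c₂ * ε + (σ + 1) * (c₂ * ε) +
        (c₂ * ε + c₂ * ε) / σ + 2 * T * (c₂ * ε + c₂ * ε) ≤ c₁ * ε * Mr := by
      rw [hMr]
      exact error_scale hx1 hx1 hx1 le_rfl hσ hT0.le hlmax.le hbmin
    have g2 : (c₂ * ε + c₂ * ε) * (1 + 1 / σ ^ 2) ≤ c₁ * ε * Mu := by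
      rw [hMu, ← mul_assoc]
      exact mul_le_mul_of_nonneg_right (by linarith) (by positivity)
    have g3 : c₁ * ε * Mu ≤ s / 4 := by
      linarith [mul_le_mul_of_nonneg_right hc₁ε hMu0.le, mul_pos hc₁ hMu0]
    have g4 : 4 * (c₁ * ε * Mr) < s * σ := by
      have : 0 < s * σ := by positivity
      linarith [mul_le_mul_of_nonneg_right hc₁ε hMr0.le]
    have g5 : 4 * T * (c₁ * ε * Mr + 2 * T * (c₁ * ε * Mu)) ≤ ε * (s / (32 * δ)) := by
      have := mul_le_mul_of_nonneg_left k6 hε.le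
      linarith
    have g6 := h.dist_le hn hnN hσ hS hlam0.le hb hτT hlam.2 hbmin hβmin hx0.le
      (r := 2 * (c₁ * ε)) (η := c₂ * ε) (by positivity) hx0.le (by linarith) (by linarith)
      hwp haux (by rw [← hs]; exact g2.trans g3) (by rw [← hs]; linarith)
    rw [← hs] at g6
    have g7 : 4 * T * (((2 * (c₁ * ε) + lmax * (c₂ * ε)) / bmin + c₂ * ε + (σ + 1) * (c₂ * ε) +
        (c₂ * ε + c₂ * ε) / σ + 2 * T * (c₂ * ε + c₂ * ε)) +
        2 * T * ((c₂ * ε + c₂ * ε) * (1 + 1 / σ ^ 2))) ≤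
        4 * T * (c₁ * ε * Mr + 2 * T * (c₁ * ε * Mu)) := by
      refine mul_le_mul_of_nonneg_left (add_le_add g1 ?_) (by positivity)
      exact mul_le_mul_of_nonneg_left g2 (by positivity)
    have g8 := (g6.trans g7).trans g5
    have e : ε * (s / (32 * δ)) = s * (ε / (32 * δ)) := by ring
    rw [e] at g8
    exact le_of_mul_le_mul_left g8 hs0
  · have := hrate n N hN hnN θ hθ τ b hτ.le hτT hb0 hbB ε hε hε'
    linarith

section
variable {N : ℕ} {θ : Fin N → ℝ} {δ σ β β' τ τ' b b' lam lam' : ℝ}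

lemma seErr_prox (hτ : 0 < τ) (hβ : 0 < β) (hlam : 0 ≤ lam) (hb : b = τ * lam / β) (i : Fin N)
    (z y : ℝ) : β * (z * (y - seErr θ τ b i z)) -
      β / τ * (seErr θ τ b i z * (y - seErr θ τ b i z)) ≤
      lam * (|θ i + y| - |θ i + seErr θ τ b i z|) := by
  have h := eta_prox (x := θ i + τ * z) (b := b) (by rw [hb]; positivity) (θ i + y)
  have e : eta (θ i + τ * z) b = θ i + seErr θ τ b i z := by unfold seErr; ring
  rw [e] at h
  have h1 := mul_le_mul_of_nonneg_left h (by positivity : 0 ≤ β / τ)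
  have e1 : β / τ * (b * (|θ i + y| - |θ i + seErr θ τ b i z|)) =
      lam * (|θ i + y| - |θ i + seErr θ τ b i z|) := by rw [hb]; field_simp
  have e2 : β / τ * ((θ i + τ * z - (θ i + seErr θ τ b i z)) *
      (θ i + y - (θ i + seErr θ τ b i z))) = β * (z * (y - seErr θ τ b i z)) -
      β / τ * (seErr θ τ b i z * (y - seErr θ τ b i z)) := by field_simp; ring
  rwa [e1, e2] at h1

lemma integrable_seErr_mul_seErr (hτ : 0 ≤ τ) (hb : 0 ≤ b) (hτ' : 0 ≤ τ') (hb' : 0 ≤ b')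
    (i : Fin N) : Integrable (fun z => seErr θ τ b i z * seErr θ τ' b' i z) stdG := by
  have h : Integrable (fun z => seErr θ τ b i z ^ 2 + seErr θ τ' b' i z ^ 2) stdG :=
    (integrable_seErr_sq hτ hb i).add (integrable_seErr_sq hτ' hb' i)
  refine h.mono' ((continuous_seErr hb i).mul (continuous_seErr hb' i)).aestronglyMeasurable
    (Filter.Eventually.of_forall fun z => ?_)
  rw [Real.norm_eq_abs, abs_le]
  constructor <;> nlinarith [sq_nonneg (seErr θ τ b i z + seErr θ τ' b' i z),
    sq_nonneg (seErr θ τ b i z - seErr θ τ' b' i z), sq_nonneg (seErr θ τ b i z),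
    sq_nonneg (seErr θ τ' b' i z)]

lemma integral_five_add {f₁ f₂ f₃ f₄ f₅ : ℝ → ℝ} {w : ℝ} (h₁ : Integrable f₁ stdG)
    (h₂ : Integrable f₂ stdG) (h₃ : Integrable f₃ stdG) (h₄ : Integrable f₄ stdG)
    (h₅ : Integrable f₅ stdG) :
    ∫ z, (f₁ z + f₂ z + f₃ z + f₄ z + f₅ z + w) ∂stdG = ∫ z, f₁ z ∂stdG + ∫ z, f₂ z ∂stdG +
      ∫ z, f₃ z ∂stdG + ∫ z, f₄ z ∂stdG + ∫ z, f₅ z ∂stdG + w := by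
  have h12 : Integrable (fun z => f₁ z + f₂ z) stdG := h₁.add h₂
  have h123 : Integrable (fun z => f₁ z + f₂ z + f₃ z) stdG := h12.add h₃
  have h1234 : Integrable (fun z => f₁ z + f₂ z + f₃ z + f₄ z) stdG := h123.add h₄
  have h12345 : Integrable (fun z => f₁ z + f₂ z + f₃ z + f₄ z + f₅ z) stdG := h1234.add h₅
  rw [integral_add h12345 (integrable_const w), integral_add h1234 h₅, integral_add h123 h₄,
    integral_add h12 h₃, integral_add h₁ h₂]
  simp

lemma integral_quad (hτ : 0 ≤ τ) (hb : 0 ≤ b) (hτ' : 0 ≤ τ') (hb' : 0 ≤ b') (i : Fin N)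
    (r s t u v w : ℝ) :
    ∫ z, (r * seErr θ τ b i z ^ 2 + s * (seErr θ τ b i z * seErr θ τ' b' i z) +
      t * seErr θ τ' b' i z ^ 2 + u * (z * seErr θ τ b i z) + v * (z * seErr θ τ' b' i z) + w)
      ∂stdG = r * ∫ z, seErr θ τ b i z ^ 2 ∂stdG +
      s * ∫ z, seErr θ τ b i z * seErr θ τ' b' i z ∂stdG + t * ∫ z, seErr θ τ' b' i z ^ 2 ∂stdG +
      u * ∫ z, z * seErr θ τ b i z ∂stdG + v * ∫ z, z * seErr θ τ' b' i z ∂stdG + w := by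
  have h1 : Integrable (fun z => r * seErr θ τ b i z ^ 2) stdG :=
    (integrable_seErr_sq hτ hb i).const_mul r
  have h2 : Integrable (fun z => s * (seErr θ τ b i z * seErr θ τ' b' i z)) stdG :=
    (integrable_seErr_mul_seErr hτ hb hτ' hb' i).const_mul s
  have h3 : Integrable (fun z => t * seErr θ τ' b' i z ^ 2) stdG :=
    (integrable_seErr_sq hτ' hb' i).const_mul t
  have h4 : Integrable (fun z => u * (z * seErr θ τ b i z)) stdG :=
    (integrable_mul_seErr hτ hb i).const_mul u
  have h5 : Integrable (fun z => v * (z * seErr θ τ' b' i z)) stdG :=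
    (integrable_mul_seErr hτ' hb' i).const_mul v
  rw [integral_five_add h1 h2 h3 h4 h5]
  simp [integral_const_mul]

/-- Correlation between the errors at two points of the state evolution. -/
lemma SEPoint.mul_sub_corr_le (hS : SEPoint δ σ θ β τ b) (hS' : SEPoint δ σ θ β' τ' b')
    (hσ : 0 < σ) (hδ : 0 < δ) (hN : 0 < N) (hlam : 0 ≤ lam) (hlam' : 0 ≤ lam')
    (hb : b = τ * lam / β) (hb' : b' = τ' * lam' / β') {κ I : ℝ} (hκ : 0 < κ)
    (hI : ∑ i, ∫ z, seErr θ τ b i z * seErr θ τ' b' i z ∂stdG = N * (δ * I)) :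
    (β / τ + β' / τ') * (τ * τ' - σ ^ 2 - I) ≤
      κ * ((τ ^ 2 - σ ^ 2) - 2 * I + (τ' ^ 2 - σ ^ 2)) + (lam - lam') ^ 2 / (4 * κ * δ) := by
  have hβ := hS.beta_pos
  have hβ' := hS'.beta_pos
  have hτ : 0 < τ := hσ.trans_le hS.sigma_le
  have hτ' : 0 < τ' := hσ.trans_le hS'.sigma_le
  have hN' : (0 : ℝ) < N := by exact_mod_cast hN
  have hb0 : 0 ≤ b := by rw [hb]; positivity
  have hb0' : 0 ≤ b' := by rw [hb']; positivity
  have hpt : ∀ i z, 0 ≤ (κ - β / τ) * seErr θ τ b i z ^ 2 +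
      (β / τ + β' / τ' - 2 * κ) * (seErr θ τ b i z * seErr θ τ' b' i z) +
      (κ - β' / τ') * seErr θ τ' b' i z ^ 2 + (β - β') * (z * seErr θ τ b i z) +
      (β' - β) * (z * seErr θ τ' b' i z) + (lam - lam') ^ 2 / (4 * κ) := fun i z => by
    have h1 := seErr_prox (θ := θ) hτ hβ hlam hb i z (seErr θ τ' b' i z)
    have h2 := seErr_prox (θ := θ) hτ' hβ' hlam' hb' i z (seErr θ τ b i z)
    generalize seErr θ τ b i z = f at *
    generalize seErr θ τ' b' i z = f' at *
    have h3 := abs_abs_sub_abs_le_abs_sub (θ i + f') (θ i + f)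
    have e3 : θ i + f' - (θ i + f) = f' - f := by ring
    rw [e3] at h3
    have h4 : (lam - lam') * (|θ i + f'| - |θ i + f|) ≤ |lam - lam'| * |f' - f| := by
      refine (le_abs_self _).trans ?_
      rw [abs_mul]
      exact mul_le_mul_of_nonneg_left h3 (abs_nonneg _)
    have h5 : |lam - lam'| * |f' - f| ≤ κ * (f' - f) ^ 2 + (lam - lam') ^ 2 / (4 * κ) := by
      rw [← sq_abs (f' - f), ← sq_abs (lam - lam')]
      have e5 : κ * |f' - f| ^ 2 + |lam - lam'| ^ 2 / (4 * κ) - |lam - lam'| * |f' - f| =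
          (2 * κ * |f' - f| - |lam - lam'|) ^ 2 / (4 * κ) := by field_simp; ring
      have := div_nonneg (sq_nonneg (2 * κ * |f' - f| - |lam - lam'|)) (by positivity : 0 ≤ 4 * κ)
      linarith
    linarith
  have hint := fun i => integral_quad (θ := θ) hτ.le hb0 hτ'.le hb0' i (κ - β / τ)
    (β / τ + β' / τ' - 2 * κ) (κ - β' / τ') (β - β') (β' - β) ((lam - lam') ^ 2 / (4 * κ))
  have hsum := Finset.sum_nonneg fun i (_ : i ∈ Finset.univ) =>
    (integral_nonneg (hpt i)).trans_eq (hint i)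
  simp only [Finset.sum_add_distrib, ← Finset.mul_sum] at hsum
  rw [hS.sum_sq, hS.sum_mul, hS'.sum_sq, hS'.sum_mul, hI] at hsum
  simp only [Finset.sum_const, Finset.card_univ, Fintype.card_fin, nsmul_eq_mul] at hsum
  have e : (κ - β / τ) * (N * (δ * (τ ^ 2 - σ ^ 2))) +
      (β / τ + β' / τ' - 2 * κ) * (N * (δ * I)) + (κ - β' / τ') * (N * (δ * (τ' ^ 2 - σ ^ 2))) +
      (β - β') * (N * (δ * (τ - β))) + (β' - β) * (N * (δ * (τ' - β'))) +
      N * ((lam - lam') ^ 2 / (4 * κ)) =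
      N * δ * (κ * ((τ ^ 2 - σ ^ 2) - 2 * I + (τ' ^ 2 - σ ^ 2)) +
        (lam - lam') ^ 2 / (4 * κ * δ) - (β / τ + β' / τ') * (τ * τ' - σ ^ 2 - I) -
        (β - β') ^ 2) := by
    field_simp; ring
  rw [e] at hsum
  have := nonneg_of_mul_nonneg_right hsum (by positivity)
  linarith [sq_nonneg (β - β')]

/-- The state evolution prediction is Lipschitz in the regularization. -/
lemma SEPoint.dist_le (hS : SEPoint δ σ θ β τ b) (hS' : SEPoint δ σ θ β' τ' b')
    (hσ : 0 < σ) (hδ : 0 < δ) (hN : 0 < N) (hlam : 0 ≤ lam) (hlam' : 0 ≤ lam')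
    (hb : b = τ * lam / β) (hb' : b' = τ' * lam' / β') {T bmin κ : ℝ} (hT : τ ≤ T) (hT' : τ' ≤ T)
    (hbmin : 0 < bmin) (hβ : bmin ≤ β) (hβ' : bmin ≤ β') (hκ : κ = bmin * σ ^ 2 / (2 * T ^ 3)) :
    (∑ i, ∫ z, (seErr θ τ b i z - seErr θ τ' b' i z) ^ 2 ∂stdG) / N ≤
      (lam - lam') ^ 2 / (4 * κ ^ 2) := by
  have hβ0 := hS.beta_pos
  have hβ0' := hS'.beta_pos
  have hτ : 0 < τ := hσ.trans_le hS.sigma_le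
  have hτ' : 0 < τ' := hσ.trans_le hS'.sigma_le
  have hT0 : 0 < T := hτ.trans_le hT
  have hN' : (0 : ℝ) < N := by exact_mod_cast hN
  have hb0 : 0 ≤ b := by rw [hb]; positivity
  have hb0' : 0 ≤ b' := by rw [hb']; positivity
  have hκ0 : 0 < κ := by rw [hκ]; positivity
  obtain ⟨I, hI⟩ : ∃ I, ∑ i, ∫ z, seErr θ τ b i z * seErr θ τ' b' i z ∂stdG = N * (δ * I) :=
    ⟨(∑ i, ∫ z, seErr θ τ b i z * seErr θ τ' b' i z ∂stdG) / (N * δ), by field_simp⟩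
  have hquad : ∀ s, ∑ i, ∫ z, (seErr θ τ b i z - s * seErr θ τ' b' i z) ^ 2 ∂stdG =
      N * δ * ((τ ^ 2 - σ ^ 2) - 2 * s * I + s ^ 2 * (τ' ^ 2 - σ ^ 2)) := fun s => by
    have h1 : ∀ i, ∫ z, (seErr θ τ b i z - s * seErr θ τ' b' i z) ^ 2 ∂stdG =
        1 * ∫ z, seErr θ τ b i z ^ 2 ∂stdG +
        -(2 * s) * ∫ z, seErr θ τ b i z * seErr θ τ' b' i z ∂stdG +
        s ^ 2 * ∫ z, seErr θ τ' b' i z ^ 2 ∂stdG := fun i => by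
      have h2 := integral_quad (θ := θ) hτ.le hb0 hτ'.le hb0' i 1 (-(2 * s)) (s ^ 2) 0 0 0
      rw [zero_mul, zero_mul, add_zero, add_zero, add_zero] at h2
      rw [← h2]
      congr 1; ext z; ring
    simp_rw [h1, Finset.sum_add_distrib, ← Finset.mul_sum]
    rw [hS.sum_sq, hS'.sum_sq, hI]; ring
  have hCS : I ^ 2 ≤ (τ ^ 2 - σ ^ 2) * (τ' ^ 2 - σ ^ 2) := by
    have h1 : discrim (τ' ^ 2 - σ ^ 2) (-(2 * I)) (τ ^ 2 - σ ^ 2) ≤ 0 := by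
      refine discrim_le_zero fun s => ?_
      have h2 : 0 ≤ N * δ * ((τ ^ 2 - σ ^ 2) - 2 * s * I + s ^ 2 * (τ' ^ 2 - σ ^ 2)) := by
        rw [← hquad]
        exact Finset.sum_nonneg fun i _ => integral_nonneg fun z => sq_nonneg _
      have := nonneg_of_mul_nonneg_right h2 (by positivity)
      linarith
    unfold discrim at h1
    linarith
  have hq1 := hquad 1
  simp only [one_mul, one_pow, mul_one] at hq1
  have hD0 : 0 ≤ (τ ^ 2 - σ ^ 2) - 2 * I + (τ' ^ 2 - σ ^ 2) := by
    have h2 : 0 ≤ N * δ * ((τ ^ 2 - σ ^ 2) - 2 * I + (τ' ^ 2 - σ ^ 2)) := by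
      rw [← hq1]
      exact Finset.sum_nonneg fun i _ => integral_nonneg fun z => sq_nonneg _
    exact nonneg_of_mul_nonneg_right h2 (by positivity)
  have hc := hS.mul_sub_corr_le hS' hσ hδ hN hlam hlam' hb hb' hκ0 hI
  have hd := sq_dist_le (σ := σ) hτ.le hτ'.le (by ring) (by ring) (Real.sq_sqrt hD0) hCS
  rw [Real.sq_sqrt hD0] at hd
  rw [hq1]
  generalize (τ ^ 2 - σ ^ 2) - 2 * I + (τ' ^ 2 - σ ^ 2) = D at *
  generalize τ * τ' - σ ^ 2 - I = J at *
  have hJ : 0 ≤ J := by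
    have : 0 ≤ 2 * (τ * τ') * J := le_trans (by positivity) hd
    exact nonneg_of_mul_nonneg_right this (by positivity)
  have hTT : τ * τ' ≤ T * T := mul_le_mul hT hT' hτ'.le hT0.le
  have h1 : σ ^ 2 * D ≤ 2 * (T * T) * J :=
    hd.trans (mul_le_mul_of_nonneg_right (by linarith) hJ)
  have h2 : bmin / T ≤ β / τ := div_le_div₀ hβ0.le hβ hτ hT
  have h3 : bmin / T ≤ β' / τ' := div_le_div₀ hβ0'.le hβ' hτ' hT'
  have h4 : 2 * κ * D ≤ (β / τ + β' / τ') * J := by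
    refine le_trans ?_ (mul_le_mul_of_nonneg_right (add_le_add h2 h3) hJ)
    have e1 : 2 * κ * D = bmin / T ^ 3 * (σ ^ 2 * D) := by rw [hκ]; field_simp
    have e2 : (bmin / T + bmin / T) * J = bmin / T ^ 3 * (2 * (T * T) * J) := by
      field_simp; ring
    rw [e1, e2]
    exact mul_le_mul_of_nonneg_left h1 (by positivity)
  have h5 : κ * D ≤ (lam - lam') ^ 2 / (4 * κ * δ) := by linarith
  have e : N * δ * D / N = κ * D * (δ / κ) := by field_simp
  have e' : (lam - lam') ^ 2 / (4 * κ ^ 2) = (lam - lam') ^ 2 / (4 * κ * δ) * (δ / κ) := by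
    field_simp
  rw [e, e']
  exact mul_le_mul_of_nonneg_right h5 (by positivity)

end

section
variable {n N : ℕ} {σ : ℝ} {ω : (Fin n → Fin N → ℝ) × (Fin n → ℝ)}

lemma convexOn_primCost {ℓ : (Fin N → ℝ) → ℝ} (hℓ : ConvexOn ℝ Set.univ ℓ) :
    ConvexOn ℝ Set.univ (primCost σ ℓ ω) := by
  refine ⟨convex_univ, fun u _ v _ a c ha hc hac => ?_⟩
  have h1 := hℓ.2 (Set.mem_univ u) (Set.mem_univ v) ha hc hac
  have hr : ∀ i, resid σ ω (a • u + c • v) i = a * resid σ ω u i + c * resid σ ω v i := fun i => by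
    simp only [resid, Pi.add_apply, Pi.smul_apply, smul_eq_mul, mul_add, Finset.sum_add_distrib,
      mul_left_comm _ a, mul_left_comm _ c, ← Finset.mul_sum]
    have e : σ * ω.2 i = (a + c) * (σ * ω.2 i) := by rw [hac, one_mul]
    linear_combination e
  have h2 : (∑ i, resid σ ω (a • u + c • v) i ^ 2) / (2 * n) ≤
      a * ((∑ i, resid σ ω u i ^ 2) / (2 * n)) + c * ((∑ i, resid σ ω v i ^ 2) / (2 * n)) := by
    rw [← mul_div_assoc, ← mul_div_assoc, ← add_div, Finset.mul_sum, Finset.mul_sum,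
      ← Finset.sum_add_distrib]
    refine div_le_div_of_nonneg_right (Finset.sum_le_sum fun i _ => ?_) (by positivity)
    rw [hr]
    obtain rfl : c = 1 - a := by linarith
    nlinarith [mul_nonneg (mul_nonneg ha hc) (sq_nonneg (resid σ ω u i - resid σ ω v i))]
  unfold primCost
  simp only [smul_eq_mul] at h1 ⊢
  linarith

lemma lassoCost_add (lam : ℝ) (θ w : Fin N → ℝ) :
    lassoCost ω.1 (yvec σ θ ω.1 ω.2) lam (fun i => θ i + w i) =
      primCost σ (penal lam n θ) ω w + lam / n * ∑ i, |θ i| := by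
  unfold lassoCost primCost penal
  have h : ∀ i, yvec σ θ ω.1 ω.2 i - ∑ j, ω.1 i j * (θ j + w j) = resid σ ω w i := fun i => by
    simp only [yvec, resid, mul_add, Finset.sum_add_distrib]; ring
  simp only [h, Finset.sum_sub_distrib]
  ring

lemma primCost_sub_le_of_isMinOn {lam : ℝ} {θ v : Fin N → ℝ}
    (h : IsMinOn (lassoCost ω.1 (yvec σ θ ω.1 ω.2) lam) Set.univ v) (w : Fin N → ℝ) :
    primCost σ (penal lam n θ) ω (fun i => v i - θ i) ≤ primCost σ (penal lam n θ) ω w := by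
  have h1 := isMinOn_iff.1 h (fun i => θ i + w i) (Set.mem_univ _)
  have e : v = fun i => θ i + (fun i => v i - θ i) i := by ext i; simp
  rw [lassoCost_add, e, lassoCost_add] at h1
  simpa using h1

lemma abs_sum_abs_sub_le (θ u w : Fin N → ℝ) :
    |∑ i, (|θ i + u i| - |θ i|) - ∑ i, (|θ i + w i| - |θ i|)| ≤
      √N * enorm2 (fun i => u i - w i) := by
  rw [← Finset.sum_sub_distrib]
  refine (Finset.abs_sum_le_sum_abs _ _).trans ?_
  have h1 : ∀ i, |(|θ i + u i| - |θ i|) - (|θ i + w i| - |θ i|)| ≤ 1 * |u i - w i| := fun i => by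
    have := abs_abs_sub_abs_le_abs_sub (θ i + u i) (θ i + w i)
    rw [add_sub_add_left_eq_sub] at this
    rwa [one_mul, sub_sub_sub_cancel_right]
  refine (Finset.sum_le_sum fun i _ => h1 i).trans ((sum_mul_le_enorm2 _ _).trans (le_of_eq ?_))
  simp [enorm2]

lemma primCost_penal_sub (lam lam' : ℝ) (θ w : Fin N → ℝ) :
    primCost σ (penal lam n θ) ω w = primCost σ (penal lam' n θ) ω w +
      (lam - lam') / n * ∑ i, (|θ i + w i| - |θ i|) := by
  unfold primCost penal; ring

lemma enorm2_sub_ge (u w : Fin N → ℝ) : enorm2 (fun i => u i - w i) ≤ enorm2 u + enorm2 w := by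
  refine abs_le_of_sq_le_sq' ?_ (add_nonneg (enorm2_nonneg _) (enorm2_nonneg _)) |>.2
  rw [add_sq, enorm2_sq, enorm2_sq, enorm2_sq]
  have h := sum_mul_le_enorm2 u (fun i => -w i)
  have e : enorm2 (fun i => -w i) = enorm2 w := by simp [enorm2]
  rw [e] at h
  have e2 : ∑ i, (u i - w i) ^ 2 = ∑ i, u i ^ 2 + 2 * ∑ i, u i * -w i + ∑ i, w i ^ 2 := by
    rw [Finset.mul_sum, ← Finset.sum_add_distrib, ← Finset.sum_add_distrib]
    exact Finset.sum_congr rfl fun i _ => by ring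
  rw [e2]; linarith

/-- Near the regularization where the costs are good, the minimizer is not bad. -/
lemma GoodCosts.notMem_badSet {lam lam' β τ b κ ε R δ : ℝ} {θ w : Fin N → ℝ}
    (h : GoodCosts σ lam' β τ b κ ε R θ ω) (hN : 0 < N) (hδ : 0 < δ) (hnN : (n : ℝ) = δ * N)
    (hlam : 0 ≤ lam) (hR : 0 < R) (hκ : 3 * R * |lam - lam'| / δ < κ)
    (hw : ∀ v, primCost σ (penal lam n θ) ω w ≤ primCost σ (penal lam n θ) ω v) :
    w ∉ badSet θ τ b ε R := by
  have hN' : (0 : ℝ) < N := by exact_mod_cast hN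
  have hn' : (0 : ℝ) < n := by rw [hnN]; positivity
  have hsN : 0 < √(N : ℝ) := Real.sqrt_pos.2 hN'
  have hκ0 : 0 < κ := lt_of_le_of_lt (by positivity) hκ
  obtain ⟨⟨w0, hw0⟩, hbad⟩ := h
  have hnear : ∀ u, enorm2 (fun i => u i - w0 i) ≤ 3 * R * √N →
      primCost σ (penal lam n θ) ω u ≤ primCost σ (penal lam n θ) ω w0 →
      u ∉ badSet θ τ b ε R := fun u hu huw hub => by
    have h1 := hbad u hub
    rw [primCost_penal_sub lam lam', primCost_penal_sub lam lam'] at huw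
    have h2 := abs_sum_abs_sub_le θ w0 u
    have h3 : enorm2 (fun i => w0 i - u i) = enorm2 (fun i => u i - w0 i) := by
      simp only [enorm2, sub_sq_comm]
    rw [h3] at h2
    set S := ∑ i, (|θ i + w0 i| - |θ i|) - ∑ i, (|θ i + u i| - |θ i|) with hSdef
    have h4 : |S| ≤ 3 * R * N := by
      refine h2.trans ((mul_le_mul_of_nonneg_left hu hsN.le).trans (le_of_eq ?_))
      rw [mul_left_comm, Real.mul_self_sqrt hN'.le]
    have h5 : (lam - lam') / n * S ≤ 3 * R * |lam - lam'| / δ := by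
      refine (le_abs_self _).trans ?_
      rw [abs_mul, abs_div, abs_of_pos hn', div_mul_eq_mul_div, div_le_div_iff₀ hn' hδ, hnN]
      have := mul_le_mul_of_nonneg_left h4 (mul_nonneg (abs_nonneg (lam - lam')) hδ.le)
      linarith
    have h6 : (lam - lam') / n * S = (lam - lam') / n * ∑ i, (|θ i + w0 i| - |θ i|) -
      (lam - lam') / n * ∑ i, (|θ i + u i| - |θ i|) := by rw [hSdef]; ring
    linarith
  have hnorm : ∀ u, u ∉ badSet θ τ b ε R → enorm2 u < R * √N := fun u hu => by
    rw [badSet, Set.mem_ofPred_eq, not_or, not_le] at hu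
    refine lt_of_pow_lt_pow_left₀ 2 (by positivity) ?_
    rw [enorm2_sq, mul_pow, Real.sq_sqrt hN'.le]
    exact hu.2
  have hw0n := hnorm w0 (hnear w0 (by simp [enorm2]; positivity) le_rfl)
  rcases le_or_gt (enorm2 fun i => w i - w0 i) (3 * R * √N) with hd | hd
  · exact hnear w hd (hw w0)
  · exfalso
    have hpos : 0 < enorm2 fun i => w i - w0 i := lt_trans (by positivity) hd
    set s := 3 * R * √N / enorm2 (fun i => w i - w0 i) with hs
    have hs0 : 0 ≤ s := by positivity
    have hs1 : s ≤ 1 := by rw [hs, div_le_one hpos]; exact hd.le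
    set u := (1 - s) • w0 + s • w with hu
    have hud : enorm2 (fun i => u i - w0 i) = 3 * R * √N := by
      have e : (fun i => u i - w0 i) = fun i => s * (w i - w0 i) := by
        ext i; simp only [hu, Pi.add_apply, Pi.smul_apply, smul_eq_mul]; ring
      have e2 : enorm2 (fun i => s * (w i - w0 i)) = s * enorm2 (fun i => w i - w0 i) := by
        simp only [enorm2, mul_pow, ← Finset.mul_sum]
        rw [Real.sqrt_mul (sq_nonneg s), Real.sqrt_sq hs0]
      rw [e, e2, hs, div_mul_cancel₀ _ hpos.ne']
    have hc := (convexOn_primCost (σ := σ) (ω := ω) (convexOn_penal hlam n θ)).2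
      (Set.mem_univ w0) (Set.mem_univ w) (sub_nonneg.2 hs1) hs0 (by ring)
    rw [← hu] at hc
    simp only [smul_eq_mul] at hc
    have huc : primCost σ (penal lam n θ) ω u ≤ primCost σ (penal lam n θ) ω w0 := by
      have := mul_le_mul_of_nonneg_left (hw w0) hs0
      linarith
    have hun := hnorm u (hnear u hud.le huc)
    have := enorm2_sub_ge u w0
    rw [hud] at this
    have hRN : 0 < R * √N := by positivity
    linarith


lemma GoodCosts.W2sq_lt {lam lam' β β' τ τ' κ ε R δ T bmin : ℝ} {θ w : Fin N → ℝ}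
    (h : GoodCosts σ lam' β' τ' (τ' * lam' / β') (κ * ε) ε R θ ω) (hN : 0 < N) (hσ : 0 < σ)
    (hδ : 0 < δ) (hnN : (n : ℝ) = δ * N) (hlam : 0 ≤ lam) (hlam' : 0 ≤ lam') (hR : 0 < R)
    (hS : SEPoint δ σ θ β τ (τ * lam / β)) (hS' : SEPoint δ σ θ β' τ' (τ' * lam' / β'))
    (hT : τ ≤ T) (hT' : τ' ≤ T) (hbmin : 0 < bmin) (hβ : bmin ≤ β) (hβ' : bmin ≤ β')
    (hε : 0 < ε) (hε' : ε ≤ 1 / 2) (hκ : 3 * R * |lam - lam'| / δ < κ * ε)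
    (hll : |lam - lam'| ≤ bmin * σ ^ 2 / (2 * T ^ 3) * ε)
    (hw : IsMinOn (lassoCost ω.1 (yvec σ θ ω.1 ω.2) lam) Set.univ w) :
    W2sq (empDist2 w θ) (muStar (empDist θ) τ (lam / β)) < ε := by
  have hβ0 := hS.beta_pos
  have hβ0' := hS'.beta_pos
  have hτ : 0 < τ := hσ.trans_le hS.sigma_le
  have hτ' : 0 < τ' := hσ.trans_le hS'.sigma_le
  have hT0 : 0 < T := hτ.trans_le hT
  have hb : 0 ≤ τ * lam / β := by positivity
  have hb' : 0 ≤ τ' * lam' / β' := by positivity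
  have h1 := h.notMem_badSet hN hδ hnN hlam hR hκ (primCost_sub_le_of_isMinOn hw)
  rw [badSet, Set.mem_ofPred_eq, not_or, not_not] at h1
  obtain ⟨⟨ι, hι, hc⟩, -⟩ := h1
  have h2 := W2sq_le_planCost hι θ w hτ.le (by positivity : 0 ≤ lam / β)
  have e : lam / β * τ = τ * lam / β := by ring
  rw [e] at h2
  have h3 := planCost_le_of_fun (θ := θ) (w := fun i => w i - θ i) (e := seErr θ τ (τ * lam / β))
    (e' := seErr θ τ' (τ' * lam' / β')) hι (fun j => (continuous_seErr hb j).measurable)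
    (integrable_seErr_sq hτ.le hb) (fun j => (continuous_seErr hb' j).measurable)
    (integrable_seErr_sq hτ'.le hb')
  have h4 := hS.dist_le hS' hσ hδ hN hlam hlam' rfl rfl hT hT' hbmin hβ hβ' rfl
  set κ' := bmin * σ ^ 2 / (2 * T ^ 3) with hκ'
  have hκ0' : 0 < κ' := by positivity
  have h5 : (lam - lam') ^ 2 / (4 * κ' ^ 2) ≤ ε / 8 := by
    rw [div_le_iff₀ (by positivity), ← sq_abs]
    have h6 := pow_le_pow_left₀ (abs_nonneg _) hll 2
    have h7 : ε ^ 2 ≤ ε / 2 := by nlinarith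
    have h8 := mul_le_mul_of_nonneg_left h7 (sq_nonneg κ')
    rw [mul_pow] at h6
    linarith
  linarith

end

lemma exists_net {lmin lmax Δ : ℝ} (hll : lmin ≤ lmax) (hΔ : 0 < Δ) :
    ∃ (M : ℕ) (l : ℕ → ℝ), (M : ℝ) ≤ (lmax - lmin) / Δ + 1 ∧ (∀ k, l k ∈ Set.Icc lmin lmax) ∧
      ∀ lam ∈ Set.Icc lmin lmax, ∃ k ∈ Finset.range M, |lam - l k| ≤ Δ := by
  have h0 : 0 ≤ (lmax - lmin) / Δ := div_nonneg (sub_nonneg.2 hll) hΔ.le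
  refine ⟨⌊(lmax - lmin) / Δ⌋₊ + 1, fun k => min (lmin + k * Δ) lmax, ?_, fun k => ?_, ?_⟩
  · push_cast
    linarith [Nat.floor_le h0]
  · exact ⟨le_min (le_add_of_nonneg_right (by positivity)) hll, min_le_right _ _⟩
  · rintro lam ⟨h1, h2⟩
    have h3 : 0 ≤ (lam - lmin) / Δ := div_nonneg (sub_nonneg.2 h1) hΔ.le
    refine ⟨⌊(lam - lmin) / Δ⌋₊, ?_, ?_⟩
    · rw [Finset.mem_range, Nat.lt_succ_iff]
      exact Nat.floor_le_floor (div_le_div_of_nonneg_right (by linarith) hΔ.le)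
    · have h4 := Nat.floor_le h3
      have h5 := Nat.lt_floor_add_one ((lam - lmin) / Δ)
      rw [le_div_iff₀ hΔ] at h4
      rw [div_lt_iff₀ hΔ] at h5
      simp only
      rw [min_eq_left (by linarith), abs_le]
      constructor <;> linarith

/-- Theorem 1 (uniform Wasserstein control of the Lasso empirical distribution)
from "The distribution of the Lasso: uniform control over sparse balls and
adaptive parameter tuning", for D = F_p(ξ). -/
theorem stmt0 (δ σ lmin lmax p ξ : ℝ)
    (hδ : 0 < δ) (hσ : 0 < σ) (hl : 0 < lmin) (hll : lmin ≤ lmax)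
    (hp : 0 < p) (hξ : 0 < ξ) :
    ∃ C c : ℝ, 0 < C ∧ 0 < c ∧
      ∀ (N n : ℕ), 0 < N → (n : ℝ) = δ * N →
      ∀ θstar ∈ Fball N p ξ,
      ∀ βstar τstar : ℝ → ℝ,
      (∀ lam ∈ Set.Icc lmin lmax,
        StateEvo δ σ (empDist θstar) lam (βstar lam) (τstar lam)) →
      ∀ θhat : ℝ → (Fin n → Fin N → ℝ) → (Fin n → ℝ) → (Fin N → ℝ),
      (∀ lam ∈ Set.Icc lmin lmax, ∀ (X : Fin n → Fin N → ℝ) (z : Fin n → ℝ),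
        IsMinOn (lassoCost X (yvec σ θstar X z) lam) Set.univ (θhat lam X z)) →
      ∀ ε : ℝ, ε ∈ Set.Ioc (0 : ℝ) (1 / 2) →
      Pmodel n N
        {ω | ∃ lam ∈ Set.Icc lmin lmax,
          ε ≤ W2sq (empDist2 (θhat lam ω.1 ω.2) θstar)
                (muStar (empDist θstar) (τstar lam) (lam / βstar lam))}
      ≤ ENNReal.ofReal (C * ε ^ (-(max (1 : ℝ) (1 / 2 + 1 / p)) - 1)
          * (N : ℝ) ^ (max (1 / p - 1) 0)
          * Real.exp (-c * N * ε ^ 2 * ε ^ (1 / 2 + 1 / p) / (Real.log ε) ^ 2)) := by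
  obtain ⟨A, T, hA, hT, hAT⟩ := exists_stateEvo_bounds (lmax := lmax) hδ hσ hl hp hξ
  obtain ⟨κ, R, C, c, hκ, hR, hC, hc, hgood⟩ :=
    exists_goodCosts_rate (lmax := lmax) hδ hσ hl hp hξ
  set bmin := lmin / A with hbmindef
  have hbmin : 0 < bmin := by positivity
  obtain ⟨d, hd, hdc⟩ := exists_pos_forall_mul_le_one
    [1 / (bmin * σ ^ 2 / (2 * T ^ 3)), 6 * R / δ / κ]
  have d1 := le_of_mul_div_le_one (by positivity)
    (hdc (1 / (bmin * σ ^ 2 / (2 * T ^ 3))) (by simp))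
  have d2 := le_of_mul_div_le_one (by positivity) (hdc (6 * R / δ / κ) (by simp))
  rw [mul_one] at d1
  clear hdc
  refine ⟨((lmax - lmin) / d + 1) * C, c,
    mul_pos (add_pos_of_nonneg_of_pos (div_nonneg (sub_nonneg.2 hll) hd.le) one_pos) hC, hc,
    fun N n hN hnN θ hθ β τ hSE θhat hmin ε hε => ?_⟩
  obtain ⟨hε, hε'⟩ := hε
  obtain ⟨M, l, hM, hl', hnet⟩ := exists_net hll (mul_pos hd hε)
  have hS : ∀ lam ∈ Set.Icc lmin lmax, 0 ≤ lam ∧ SEPoint δ σ θ (β lam) (τ lam)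
      (τ lam * lam / β lam) ∧ τ lam ≤ T ∧ bmin ≤ β lam := fun lam hlam => by
    have h0 : 0 ≤ lam := hl.le.trans hlam.1
    have hS := (hSE lam hlam).sePoint hN hδ h0
    have h1 := hAT N hN θ hθ lam hlam _ _ (hSE lam hlam)
    refine ⟨h0, hS, h1.2, ?_⟩
    have h2 := h1.1
    rw [div_le_iff₀ hS.beta_pos] at h2
    rw [hbmindef, div_le_iff₀ hA]
    linarith [hlam.1]
  have hsub : {ω : (Fin n → Fin N → ℝ) × (Fin n → ℝ) | ∃ lam ∈ Set.Icc lmin lmax,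
      ε ≤ W2sq (empDist2 (θhat lam ω.1 ω.2) θ) (muStar (empDist θ) (τ lam) (lam / β lam))} ⊆
      ⋃ k ∈ Finset.range M, {ω | ¬ GoodCosts σ (l k) (β (l k)) (τ (l k))
        (τ (l k) * l k / β (l k)) (κ * ε) ε R θ ω} := by
    intro ω hω
    rw [Set.mem_ofPred_eq] at hω
    obtain ⟨lam, hlam, hlt⟩ := hω
    obtain ⟨k, hk, hkl⟩ := hnet lam hlam
    refine Set.mem_biUnion hk fun h => hlt.not_gt ?_
    obtain ⟨a1, a2, a3, a4⟩ := hS lam hlam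
    obtain ⟨b1, b2, b3, b4⟩ := hS (l k) (hl' k)
    refine h.W2sq_lt hN hσ hδ hnN a1 b1 hR a2 b2 a3 b3 hbmin a4 b4 hε hε' ?_
      (hkl.trans (mul_le_mul_of_nonneg_right d1 hε.le)) (hmin lam hlam ω.1 ω.2)
    have e1 : 3 * R * |lam - l k| / δ = 3 * R / δ * |lam - l k| := by ring
    have e2 := mul_le_mul_of_nonneg_left hkl (by positivity : 0 ≤ 3 * R / δ)
    have e3 := mul_le_mul_of_nonneg_right d2 hε.le
    have e4 : d * (6 * R / δ) * ε = 2 * (3 * R / δ * (d * ε)) := by ring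
    have e5 := mul_pos hκ hε
    linarith
  have hP : (Pmodel n N).real {ω | ∃ lam ∈ Set.Icc lmin lmax,
      ε ≤ W2sq (empDist2 (θhat lam ω.1 ω.2) θ) (muStar (empDist θ) (τ lam) (lam / β lam))} ≤
      M * (C * Real.exp (-(c * rate p N ε))) := by
    refine (measureReal_le_sum_of_subset _ hsub).trans ?_
    have := Finset.sum_le_card_nsmul (Finset.range M) _ _ fun k _ =>
      hgood n N hN hnN θ hθ (l k) (hl' k) _ _ (hSE (l k) (hl' k)) (fun ω =>
        ⟨_, primCost_sub_le_of_isMinOn (hmin (l k) (hl' k) ω.1 ω.2)⟩) ε hε hε'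
    rwa [Finset.card_range, nsmul_eq_mul] at this
  rw [← ofReal_measureReal]
  refine ENNReal.ofReal_le_ofReal (hP.trans ?_)
  have he : -c * N * ε ^ 2 * ε ^ (1 / 2 + 1 / p) / (Real.log ε) ^ 2 = -(c * rate p N ε) := by
    unfold rate; ring
  rw [he]
  have hM' : (M : ℝ) ≤ ((lmax - lmin) / d + 1) * ε⁻¹ := by
    have h1 : (1 : ℝ) ≤ ε⁻¹ := (one_le_inv₀ hε).2 (by linarith)
    have h2 : (lmax - lmin) / (d * ε) = (lmax - lmin) / d * ε⁻¹ := by field_simp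
    rw [h2] at hM
    linarith
  have h1 : ε⁻¹ ≤ ε ^ (-(max (1 : ℝ) (1 / 2 + 1 / p)) - 1) := by
    rw [← Real.rpow_neg_one]
    refine Real.rpow_le_rpow_of_exponent_ge hε (by linarith) ?_
    linarith [le_max_left (1 : ℝ) (1 / 2 + 1 / p)]
  have h2 : (1 : ℝ) ≤ (N : ℝ) ^ (max (1 / p - 1) 0) :=
    Real.one_le_rpow (by exact_mod_cast hN) (le_max_right _ _)
  have hD : 0 ≤ (lmax - lmin) / d + 1 :=
    add_nonneg (div_nonneg (sub_nonneg.2 hll) hd.le) zero_le_one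
  have h3 : (M : ℝ) ≤ ((lmax - lmin) / d + 1) *
      (ε ^ (-(max (1 : ℝ) (1 / 2 + 1 / p)) - 1) * (N : ℝ) ^ (max (1 / p - 1) 0)) :=
    hM'.trans (mul_le_mul_of_nonneg_left
      (h1.trans (le_mul_of_one_le_right (by positivity) h2)) hD)
  refine (mul_le_mul_of_nonneg_right h3 (by positivity)).trans (le_of_eq ?_)
  ring
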